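/- Let (λ_N)_{N≥2} be any sequence of positive reals with N·λ_N → 1 as N → ∞. Then N·( E(λ_N, N) − E(λ_N, N−1) − λ_N (N−1) ŵ(0) ) converges, as N → ∞, to e_B − ∑_{p ∈ (2πℤ)^d \ {0}} |p|² α_p² / (1 − α_p²). -/

import Mathlib

open MeasureTheory Real

noncomputable section

/-- The unit cube `[0,1]^{dN}` in the configuration space of `N` particles in `ℝ^d`. -/
def cube (d N : ℕ) : Set (Fin N → Fin d → ℝ) :=
  Set.univ.pi fun _ => Set.univ.pi fun _ => Set.Icc (0 : ℝ) 1

/-- The unit cube `[0,1]^d` in `ℝ^d`. -/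
def cube1 (d : ℕ) : Set (Fin d → ℝ) :=
  Set.univ.pi fun _ => Set.Icc (0 : ℝ) 1

/-- `Ψ` is admissible: smooth, `ℤ^d`-periodic in each particle variable, symmetric under
permutations of the particles, and `L²`-normalized on the unit cube. -/
def IsAdmissible (d N : ℕ) (Ψ : (Fin N → Fin d → ℝ) → ℂ) : Prop :=
  ContDiff ℝ (⊤ : ℕ∞) Ψ ∧
  (∀ (x : Fin N → Fin d → ℝ) (j : Fin N) (v : Fin d → ℤ),
      Ψ (Function.update x j (x j + fun i => (v i : ℝ))) = Ψ x) ∧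
  (∀ (σ : Equiv.Perm (Fin N)) (x : Fin N → Fin d → ℝ), Ψ (x ∘ σ) = Ψ x) ∧
  (∫ x in cube d N, ‖Ψ x‖ ^ 2) = 1

/-- The energy `ℰ_{λ,N}(Ψ)` of a wave function `Ψ`. -/
def energy (d N : ℕ) (lam : ℝ) (w : (Fin d → ℝ) → ℝ)
    (Ψ : (Fin N → Fin d → ℝ) → ℂ) : ℝ :=
  ∫ x in cube d N,
    ((∑ j : Fin N, ∑ i : Fin d, ‖fderiv ℝ Ψ x (Pi.single j (Pi.single i 1))‖ ^ 2) +
      lam * (∑ j : Fin N, ∑ k : Fin N, if j < k then w (x j - x k) else 0) * ‖Ψ x‖ ^ 2)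

/-- The ground state energy `E(λ,N)`. -/
def GSE (d N : ℕ) (lam : ℝ) (w : (Fin d → ℝ) → ℝ) : ℝ :=
  sInf {e | ∃ Ψ, IsAdmissible d N Ψ ∧ energy d N lam w Ψ = e}

/-- The interaction potential defined by the absolutely convergent Fourier series
`w(x) = ∑_{p ∈ (2πℤ)^d} ŵ(p) e^{ip·x}`, with the lattice point `p = 2πk` indexed by
`k ∈ ℤ^d`. -/
def wOf (d : ℕ) (hw : (Fin d → ℤ) → ℝ) (x : Fin d → ℝ) : ℝ :=
  (∑' k : Fin d → ℤ,
    (hw k : ℂ) * Complex.exp (Complex.I * ((∑ i, (2 * π * (k i : ℝ)) * x i : ℝ) : ℂ))).re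

/-- `|p|²` for the lattice point `p = 2πk`. -/
def pSq (d : ℕ) (k : Fin d → ℤ) : ℝ := ∑ i, (2 * π * (k i : ℝ)) ^ 2

/-- The elementary excitation energy `e_p = √(|p|⁴ + 2|p|²ŵ(p))`. -/
def ePk (d : ℕ) (hw : (Fin d → ℤ) → ℝ) (k : Fin d → ℤ) : ℝ :=
  Real.sqrt (pSq d k ^ 2 + 2 * pSq d k * hw k)

/-- The Bogoliubov coefficient `α_p = ŵ(p)/(|p|² + ŵ(p) + e_p)`. -/
def alphaP (d : ℕ) (hw : (Fin d → ℤ) → ℝ) (k : Fin d → ℤ) : ℝ :=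
  hw k / (pSq d k + hw k + ePk d hw k)

/-- The Bogoliubov ground state energy
`e_B = -(1/2) ∑_{p ≠ 0} (|p|² + ŵ(p) - e_p)`. -/
def eB (d : ℕ) (hw : (Fin d → ℤ) → ℝ) : ℝ :=
  -(1 / 2) * ∑' k : {k : Fin d → ℤ // k ≠ 0}, (pSq d k.1 + hw k.1 - ePk d hw k.1)

/-- The projection `Q_j` removing the condensate in the `j`-th variable. -/
def Qop (d N : ℕ) (j : Fin N) (Ψ : (Fin N → Fin d → ℝ) → ℂ) :
    (Fin N → Fin d → ℝ) → ℂ :=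
  fun x => Ψ x - ∫ y in cube1 d, Ψ (Function.update x j y)

/-- The expected number of excited particles `⟨𝒩₊⟩_Ψ`. -/
def NplusExp (d N : ℕ) (Ψ : (Fin N → Fin d → ℝ) → ℂ) : ℝ :=
  ∑ j : Fin N, ∫ x in cube d N, ‖Qop d N j Ψ x‖ ^ 2

/-- The second moment `⟨𝒩₊²⟩_Ψ` of the number of excited particles. -/
def NplusSqExp (d N : ℕ) (Ψ : (Fin N → Fin d → ℝ) → ℂ) : ℝ :=
  ∑ j : Fin N, ∑ k : Fin N, ∫ x in cube d N, ‖Qop d N j (Qop d N k Ψ) x‖ ^ 2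

/-! ## Part A: compactly supported probability measures -/

/-- A measure carried by a compact set. -/
class CSM {α : Type} [TopologicalSpace α] [MeasurableSpace α] (ν : Measure α) : Prop where
  ex : ∃ K : Set α, IsCompact K ∧ ν Kᶜ = 0

set_option linter.unusedSectionVars false

/-- Insert a coordinate. -/
def ins {α : Type} {n : ℕ} (k : Fin (n + 1)) (x : α) (y : Fin n → α) : Fin (n + 1) → α :=
  Fin.insertNth (α := fun _ => α) k x y

/-- Remove a coordinate. -/
def rem {α : Type} {n : ℕ} (k : Fin (n + 1)) (x : Fin (n + 1) → α) : Fin n → α :=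
  fun j => x (k.succAbove j)

@[simp] lemma ins_same {α : Type} {n : ℕ} (k : Fin (n + 1)) (x : α) (y : Fin n → α) : ins k x y k = x := by
  simp [ins]

@[simp] lemma ins_succAbove {α : Type} {n : ℕ} (k : Fin (n + 1)) (x : α) (y : Fin n → α) (j : Fin n) :
    ins k x y (k.succAbove j) = y j := by
  simp [ins]

@[simp] lemma rem_ins {α : Type} {n : ℕ} (k : Fin (n + 1)) (x : α) (y : Fin n → α) : rem k (ins k x y) = y := by
  funext j; simp [rem]

@[simp] lemma ins_rem {α : Type} {n : ℕ} (k : Fin (n + 1)) (z : α) (x : Fin (n + 1) → α) :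
    ins k z (rem k x) = Function.update x k z := by
  funext j
  rcases Fin.eq_self_or_eq_succAbove k j with rfl | ⟨i, rfl⟩
  · simp
  · simp [rem]


section generic
variable {α : Type} [NormedAddCommGroup α] [NormedSpace ℝ α] [MeasurableSpace α] [BorelSpace α]
  [SecondCountableTopology α]

lemma CSM.integrable {ν : Measure α} [IsFiniteMeasure ν] [hν : CSM ν] {G : Type}
    [NormedAddCommGroup G] {f : α → G} (hf : Continuous f) : Integrable f ν := by
  obtain ⟨K, hK, h0⟩ := hν.ex
  obtain ⟨C, hC⟩ := hK.exists_bound_of_continuousOn hf.continuousOn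
  refine Integrable.of_bound hf.aestronglyMeasurable C ?_
  have : ∀ᵐ x ∂ν, x ∈ K := by
    rw [ae_iff]; exact h0
  filter_upwards [this] with x hx using hC x hx

lemma CSM.hasFDerivAt {ν : Measure α} [IsFiniteMeasure ν] [hν : CSM ν]
    {E : Type} [NormedAddCommGroup E] [NormedSpace ℝ E] [ProperSpace E]
    {G : Type} [NormedAddCommGroup G] [NormedSpace ℝ G] (F : E × α → G) (hF : ContDiff ℝ 1 F)
    (y : E) :
    HasFDerivAt (fun y => ∫ x, F (y, x) ∂ν)
      (∫ x, (fderiv ℝ F (y, x)).comp (ContinuousLinearMap.inl ℝ E α) ∂ν) y := by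
  obtain ⟨K, hK, h0⟩ := hν.ex
  have hae : ∀ᵐ x ∂ν, x ∈ K := by
    rw [ae_iff]; exact h0
  have hcont : Continuous (fun p : E × α =>
      (fderiv ℝ F p).comp (ContinuousLinearMap.inl ℝ E α)) :=
    (hF.continuous_fderiv one_ne_zero).clm_comp continuous_const
  obtain ⟨C, hC⟩ := ((isCompact_closedBall y 1).prod hK).exists_bound_of_continuousOn
    hcont.continuousOn
  refine hasFDerivAt_integral_of_dominated_of_fderiv_le (s := Metric.closedBall y 1)
    (bound := fun _ => C)
    (F' := fun y x => (fderiv ℝ F (y, x)).comp (ContinuousLinearMap.inl ℝ E α))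
    (Metric.closedBall_mem_nhds y one_pos) ?_ ?_ ?_ ?_ ?_ ?_
  · exact Filter.Eventually.of_forall fun z =>
      (hF.continuous.comp (by fun_prop : Continuous fun x : α => (z, x))).aestronglyMeasurable
  · exact CSM.integrable (hF.continuous.comp (by fun_prop : Continuous fun x : α => (y, x)))
  · exact (hcont.comp (by fun_prop : Continuous fun x : α => (y, x))).aestronglyMeasurable
  · filter_upwards [hae] with x hx z hz using hC (z, x) ⟨hz, hx⟩
  · exact integrable_const _
  · refine Filter.Eventually.of_forall fun x z _ => ?_
    have h1 := (hF.differentiable one_ne_zero (z, x)).hasFDerivAt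
    exact h1.comp z (hasFDerivAt_prodMk_left z x)

lemma CSM.contDiff {ν : Measure α} [IsFiniteMeasure ν] [hν : CSM ν]
    {E : Type} [NormedAddCommGroup E] [NormedSpace ℝ E] [ProperSpace E]
    (n : ℕ) : ∀ {G : Type} [NormedAddCommGroup G] [NormedSpace ℝ G] (F : E × α → G)
    (_ : ContDiff ℝ (⊤ : ℕ∞) F), ContDiff ℝ n (fun y => ∫ x, F (y, x) ∂ν) := by
  induction n with
  | zero =>
    intro G _ _ F hF
    have h1 : ContDiff ℝ 1 F := hF.of_le (by exact_mod_cast le_top)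
    simp only [Nat.cast_zero, contDiff_zero]
    exact continuous_iff_continuousAt.2 fun y => (CSM.hasFDerivAt F h1 y).continuousAt
  | succ n ih =>
    intro G _ _ F hF
    have h1 : ContDiff ℝ 1 F := hF.of_le (by exact_mod_cast le_top)
    rw [Nat.cast_succ, contDiff_succ_iff_fderiv]
    refine ⟨fun y => (CSM.hasFDerivAt F h1 y).differentiableAt, by simp, ?_⟩
    have : fderiv ℝ (fun y => ∫ x, F (y, x) ∂ν) = fun y =>
        ∫ x, (fun p : E × α => (fderiv ℝ F p).comp (ContinuousLinearMap.inl ℝ E α)) (y, x) ∂ν := by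
      funext y
      exact (CSM.hasFDerivAt F h1 y).fderiv
    rw [this]
    have h2 : ContDiff ℝ (⊤ : ℕ∞) (fderiv ℝ F) := hF.fderiv_right (by simp)
    exact ih (G := E →L[ℝ] G) (fun p => (fderiv ℝ F p).comp (ContinuousLinearMap.inl ℝ E α))
      (h2.clm_comp contDiff_const)

lemma CSM.contDiff_top {ν : Measure α} [IsFiniteMeasure ν] [hν : CSM ν]
    {E : Type} [NormedAddCommGroup E] [NormedSpace ℝ E] [ProperSpace E]
    {G : Type} [NormedAddCommGroup G] [NormedSpace ℝ G] (F : E × α → G)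
    (hF : ContDiff ℝ (⊤ : ℕ∞) F) : ContDiff ℝ (⊤ : ℕ∞) (fun y => ∫ x, F (y, x) ∂ν) := by
  rw [contDiff_infty]
  intro n
  exact CSM.contDiff n F hF

lemma CSM.continuous_integral {ν : Measure α} [IsFiniteMeasure ν] [hν : CSM ν]
    {E : Type} [TopologicalSpace E] [FirstCountableTopology E] [LocallyCompactSpace E]
    {F : E → α → ℝ} (hF : Continuous (Function.uncurry F)) :
    Continuous (fun y => ∫ x, F y x ∂ν) := by
  obtain ⟨K, hK, h0⟩ := hν.ex
  have hae : ∀ᵐ x ∂ν, x ∈ K := by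
    rw [ae_iff]; exact h0
  rw [continuous_iff_continuousAt]
  intro y
  obtain ⟨S, hS, hSy⟩ := exists_compact_mem_nhds y
  obtain ⟨C, hC⟩ := (hS.prod hK).exists_bound_of_continuousOn hF.continuousOn
  refine continuousAt_of_dominated (bound := fun _ => C) ?_ ?_ (integrable_const _) ?_
  · exact Filter.Eventually.of_forall fun z =>
      (hF.comp (by fun_prop : Continuous fun x : α => (z, x))).aestronglyMeasurable
  · filter_upwards [hSy] with z hz
    filter_upwards [hae] with x hx using hC (z, x) ⟨hz, hx⟩
  · refine Filter.Eventually.of_forall fun x => ?_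
    exact (hF.comp (by fun_prop : Continuous fun z : E => (z, x))).continuousAt

instance CSM.pi {ν : Measure α} [IsProbabilityMeasure ν] [hν : CSM ν] (n : ℕ) :
    CSM (Measure.pi (fun _ : Fin n => ν)) := by
  obtain ⟨K, hK, h0⟩ := hν.ex
  refine ⟨Set.univ.pi fun _ => K, isCompact_univ_pi fun _ => hK, ?_⟩
  have hae : ∀ᵐ x ∂ν, x ∈ K := by
    rw [ae_iff]; exact h0
  have : ∀ᵐ x ∂(Measure.pi (fun _ : Fin n => ν)), ∀ i, x i ∈ K := by
    rw [ae_all_iff]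
    intro i
    exact (Measure.quasiMeasurePreserving_eval (μ := fun _ : Fin n => ν) i).ae hae
  have h2 := ae_iff.1 this
  convert h2 using 2
  ext x; simp

lemma contDiff_ins {n : ℕ} (k : Fin (n + 1)) :
    ContDiff ℝ (⊤ : ℕ∞) (fun p : (Fin n → α) × α => ins k p.2 p.1) := by
  rw [contDiff_pi]
  intro j
  rcases Fin.eq_self_or_eq_succAbove k j with rfl | ⟨i, rfl⟩
  · simp only [ins_same]; exact contDiff_snd
  · simp only [ins_succAbove]; fun_prop

lemma continuous_ins {n : ℕ} (k : Fin (n + 1)) :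
    Continuous (fun p : (Fin n → α) × α => ins k p.2 p.1) :=
  (contDiff_ins k).continuous

lemma continuous_rem {n : ℕ} (k : Fin (n + 1)) :
    Continuous (rem k : (Fin (n + 1) → α) → (Fin n → α)) := by
  unfold rem; fun_prop

lemma fubini {ν : Measure α} [IsProbabilityMeasure ν] [hν : CSM ν] {n : ℕ} (k : Fin (n + 1))
    {f : (Fin (n + 1) → α) → ℝ} (hf : Continuous f) :
    ∫ x, f x ∂(Measure.pi fun _ : Fin (n + 1) => ν) =
      ∫ y, ∫ x, f (ins k x y) ∂ν ∂(Measure.pi fun _ : Fin n => ν) := by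
  have hmp := measurePreserving_piFinSuccAbove (fun _ : Fin (n + 1) => ν) k
  have h1 := hmp.symm.integral_comp' (g := f)
  rw [← h1]
  have hintegr : Integrable f (Measure.pi fun _ : Fin (n + 1) => ν) := CSM.integrable hf
  have hint2 := (hmp.symm.integrable_comp_emb (MeasurableEquiv.measurableEmbedding _)
    (g := f)).2 hintegr
  exact integral_prod_symm _ hint2

end generic

/-! ## Part B: averaging operators, Poincare inequality, integration by parts -/

set_option linter.unusedSectionVars false

section generic2
variable {α : Type} [NormedAddCommGroup α] [NormedSpace ℝ α] [MeasurableSpace α] [BorelSpace α]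
  [SecondCountableTopology α]

/-- `ins` as a continuous linear map. -/
def insL {n : ℕ} (k : Fin (n + 1)) : ((Fin n → α) × α) →L[ℝ] (Fin (n + 1) → α) where
  toFun := fun p => ins k p.2 p.1
  map_add' := by
    intro p q
    funext j
    rcases Fin.eq_self_or_eq_succAbove k j with rfl | ⟨i, rfl⟩ <;> simp
  map_smul' := by
    intro c p
    funext j
    rcases Fin.eq_self_or_eq_succAbove k j with rfl | ⟨i, rfl⟩ <;> simp
  cont := continuous_ins k

lemma insL_apply {n : ℕ} (k : Fin (n + 1)) (p : (Fin n → α) × α) : insL k p = ins k p.2 p.1 := rfl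

/-- average over the `k`-th variable -/
def Rop (ν : Measure α) {n : ℕ} (k : Fin (n + 1)) (f : (Fin (n + 1) → α) → ℝ) :
    (Fin n → α) → ℝ := fun y => ∫ x, f (ins k x y) ∂ν

lemma Rop_contDiff {ν : Measure α} [IsFiniteMeasure ν] [CSM ν] [ProperSpace α] {n : ℕ}
    (k : Fin (n + 1)) {f : (Fin (n + 1) → α) → ℝ} (hf : ContDiff ℝ (⊤ : ℕ∞) f) :
    ContDiff ℝ (⊤ : ℕ∞) (Rop ν k f) :=
  CSM.contDiff_top (ν := ν) (fun p : (Fin n → α) × α => f (ins k p.2 p.1))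
    (hf.comp (contDiff_ins k))

lemma Rop_continuous {ν : Measure α} [IsFiniteMeasure ν] [CSM ν] [ProperSpace α] {n : ℕ}
    (k : Fin (n + 1)) {f : (Fin (n + 1) → α) → ℝ} (hf : Continuous f) :
    Continuous (Rop ν k f) := by
  refine CSM.continuous_integral (ν := ν) (F := fun y x => f (ins k x y)) ?_
  exact hf.comp (continuous_ins k)

lemma Rop_fderiv {ν : Measure α} [IsFiniteMeasure ν] [CSM ν] [ProperSpace α] {n : ℕ}
    (k : Fin (n + 1)) {f : (Fin (n + 1) → α) → ℝ} (hf : ContDiff ℝ (⊤ : ℕ∞) f)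
    (y v : Fin n → α) :
    fderiv ℝ (Rop ν k f) y v = ∫ x, fderiv ℝ f (ins k x y) (ins k 0 v) ∂ν := by
  have h1 : ContDiff ℝ 1 (fun p : (Fin n → α) × α => f (ins k p.2 p.1)) :=
    (hf.comp (contDiff_ins k)).of_le (by exact_mod_cast le_top)
  have hf1 : ContDiff ℝ 1 f := hf.of_le (by exact_mod_cast le_top)
  have h2 := (CSM.hasFDerivAt (ν := ν) _ h1 y).fderiv
  have hcont : Continuous (fun x : α => (fderiv ℝ (fun p : (Fin n → α) × α =>
      f (ins k p.2 p.1)) (y, x)).comp (ContinuousLinearMap.inl ℝ (Fin n → α) α)) :=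
    ((h1.continuous_fderiv one_ne_zero).comp (by fun_prop)).clm_comp continuous_const
  change fderiv ℝ (fun y => ∫ x, f (ins k x y) ∂ν) y v = _
  rw [h2, ContinuousLinearMap.integral_apply (CSM.integrable hcont)]
  congr 1
  funext x
  have h3 : HasFDerivAt (fun p : (Fin n → α) × α => f (ins k p.2 p.1))
      ((fderiv ℝ f (ins k x y)).comp (insL k)) (y, x) := by
    have := (hf1.differentiable one_ne_zero (ins k x y)).hasFDerivAt
    have hi : HasFDerivAt (fun p : (Fin n → α) × α => ins k p.2 p.1) (insL k) (y, x) :=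
      (insL (α := α) k).hasFDerivAt
    exact HasFDerivAt.comp (y, x) this hi
  rw [h3.fderiv]
  simp [insL_apply]

lemma sq_integral_le {ν : Measure α} [IsProbabilityMeasure ν] [CSM ν] {f : α → ℝ}
    (hf : Continuous f) : (∫ x, f x ∂ν) ^ 2 ≤ ∫ x, f x ^ 2 ∂ν := by
  set m := ∫ x, f x ∂ν with hm
  have h0 : 0 ≤ ∫ x, (f x - m) ^ 2 ∂ν := integral_nonneg fun x => sq_nonneg _
  have h1 : ∫ x, (f x - m) ^ 2 ∂ν = ∫ x, f x ^ 2 ∂ν - 2 * m * m + m ^ 2 := by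
    have : (fun x => (f x - m) ^ 2) = fun x => f x ^ 2 - 2 * m * f x + m ^ 2 := by
      funext x; ring
    rw [this, integral_add, integral_sub, integral_const_mul, ← hm]
    · simp
    all_goals exact CSM.integrable (by fun_prop)
  nlinarith

lemma var_shift {ν : Measure α} [IsProbabilityMeasure ν] [CSM ν] {f : α → ℝ}
    (hf : Continuous f) (c : ℝ) :
    ∫ x, (f x - c) ^ 2 ∂ν = ∫ x, (f x - ∫ z, f z ∂ν) ^ 2 ∂ν + ((∫ z, f z ∂ν) - c) ^ 2 := by
  set m := ∫ x, f x ∂ν with hm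
  have h1 : ∀ c : ℝ, ∫ x, (f x - c) ^ 2 ∂ν = ∫ x, f x ^ 2 ∂ν - 2 * c * m + c ^ 2 := by
    intro c
    have : (fun x => (f x - c) ^ 2) = fun x => f x ^ 2 - 2 * c * f x + c ^ 2 := by
      funext x; ring
    rw [this, integral_add, integral_sub, integral_const_mul, ← hm]
    · simp
    all_goals exact CSM.integrable (by fun_prop)
  rw [h1, h1]; ring

end generic2

/-- Lebesgue measure on `[0,1]`. -/
def u0 : Measure ℝ := volume.restrict (Set.Icc 0 1)

instance : IsProbabilityMeasure u0 := ⟨by simp [u0]⟩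

instance : CSM u0 := ⟨⟨Set.Icc 0 1, isCompact_Icc, by
  simp [u0, Measure.restrict_apply measurableSet_Icc.compl]⟩⟩

lemma u0_eq (f : ℝ → ℝ) : ∫ x, f x ∂u0 = ∫ x in (0:ℝ)..1, f x := by
  rw [intervalIntegral.integral_of_le zero_le_one, u0, integral_Icc_eq_integral_Ioc]

/-- Lebesgue measure on the unit cube. -/
def nu (d : ℕ) : Measure (Fin d → ℝ) := Measure.pi fun _ => u0

instance (d : ℕ) : IsProbabilityMeasure (nu d) := by unfold nu; infer_instance
instance (d : ℕ) : CSM (nu d) := by unfold nu; infer_instance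

/-- Configurations. -/
abbrev Cfg (d N : ℕ) := Fin N → Fin d → ℝ

/-- Lebesgue measure on the configuration cube. -/
def mu (d N : ℕ) : Measure (Cfg d N) := Measure.pi fun _ => nu d

instance (d N : ℕ) : IsProbabilityMeasure (mu d N) := by unfold mu; infer_instance
instance (d N : ℕ) : CSM (mu d N) := by unfold mu; infer_instance

lemma nu_eq (d : ℕ) : volume.restrict (cube1 d) = nu d := by
  rw [cube1, volume_pi, Measure.restrict_pi_pi]; rfl

lemma mu_eq (d N : ℕ) : volume.restrict (cube d N) = mu d N := by
  rw [cube, volume_pi, Measure.restrict_pi_pi]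
  unfold mu
  congr 1
  funext i
  exact nu_eq d

lemma diff_sq_le {g : ℝ → ℝ} (hg : ContDiff ℝ 1 g) {a b : ℝ} (ha : a ∈ Set.Icc (0:ℝ) 1)
    (hb : b ∈ Set.Icc (0:ℝ) 1) : (g a - g b) ^ 2 ≤ ∫ t, deriv g t ^ 2 ∂u0 := by
  have hc : Continuous (deriv g) := hg.continuous_deriv_one
  have h1 : g a - g b = ∫ t in b..a, deriv g t := by
    rw [intervalIntegral.integral_deriv_eq_sub]
    · exact fun x _ => hg.differentiable one_ne_zero x
    · exact hc.intervalIntegrable _ _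
  have h2 : |g a - g b| ≤ ∫ t, |deriv g t| ∂u0 := by
    rw [h1]
    refine (intervalIntegral.norm_integral_le_integral_norm_uIoc (f := deriv g)).trans ?_
    refine setIntegral_mono_set ?_ ?_ ?_
    · exact (CSM.integrable (ν := u0) (hc.abs) : _)
    · exact Filter.Eventually.of_forall fun x => abs_nonneg _
    · refine Filter.Eventually.of_forall fun x hx => ?_
      have := Set.uIoc_subset_uIcc hx
      exact (Set.uIcc_subset_Icc hb ha) this
  have h3 := sq_integral_le (ν := u0) hc.abs
  simp only [sq_abs] at h3
  rw [← sq_abs]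
  refine le_trans ?_ h3
  exact pow_le_pow_left₀ (abs_nonneg _) h2 2

lemma ae_u0 : ∀ᵐ x ∂u0, x ∈ Set.Icc (0:ℝ) 1 := ae_restrict_mem measurableSet_Icc

lemma poincare1 {g : ℝ → ℝ} (hg : ContDiff ℝ 1 g) :
    ∫ a, (g a - ∫ b, g b ∂u0) ^ 2 ∂u0 ≤ ∫ t, deriv g t ^ 2 ∂u0 := by
  have hc := hg.continuous
  have key : ∀ᵐ a ∂u0, (g a - ∫ b, g b ∂u0) ^ 2 ≤ ∫ t, deriv g t ^ 2 ∂u0 := by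
    filter_upwards [ae_u0] with a ha
    have h1 : g a - ∫ b, g b ∂u0 = ∫ b, (g a - g b) ∂u0 := by
      rw [integral_sub (integrable_const _) (CSM.integrable hc)]; simp
    rw [h1]
    refine (sq_integral_le (ν := u0) (by fun_prop)).trans ?_
    calc ∫ b, (g a - g b) ^ 2 ∂u0 ≤ ∫ _b, (∫ t, deriv g t ^ 2 ∂u0) ∂u0 := by
          refine integral_mono_ae (CSM.integrable (by fun_prop)) (integrable_const _) ?_
          filter_upwards [ae_u0] with b hb using diff_sq_le hg ha hb
      _ = _ := by simp
  calc ∫ a, (g a - ∫ b, g b ∂u0) ^ 2 ∂u0 ≤ ∫ _a, (∫ t, deriv g t ^ 2 ∂u0) ∂u0 :=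
        integral_mono_ae (CSM.integrable (by fun_prop)) (integrable_const _) key
    _ = _ := by simp

lemma ins_single_same {n : ℕ} {α : Type} [NormedAddCommGroup α] (k : Fin (n + 1)) (a : α) :
    ins k a (0 : Fin n → α) = Pi.single k a := by
  funext j
  rcases Fin.eq_self_or_eq_succAbove k j with rfl | ⟨i, rfl⟩
  · simp
  · simp [Fin.succAbove_ne]

lemma ins_zero_single {n : ℕ} {α : Type} [NormedAddCommGroup α] (k : Fin (n + 1)) (j : Fin n)
    (a : α) : ins k 0 (Pi.single j a : Fin n → α) = Pi.single (k.succAbove j) a := by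
  funext l
  rcases Fin.eq_self_or_eq_succAbove k l with rfl | ⟨i, rfl⟩
  · simp [(Fin.succAbove_ne _ _).symm]
  · simp only [ins_succAbove]
    by_cases h : i = j
    · subst h; simp
    · rw [Pi.single_eq_of_ne h, Pi.single_eq_of_ne]
      exact fun h' => h (Fin.succAbove_right_injective h')

lemma poincare : ∀ (d : ℕ) {g : (Fin d → ℝ) → ℝ} (_ : ContDiff ℝ (⊤ : ℕ∞) g),
    ∫ x, (g x - ∫ z, g z ∂(nu d)) ^ 2 ∂(nu d) ≤
      ∑ i, ∫ x, (fderiv ℝ g x (Pi.single i 1)) ^ 2 ∂(nu d) := by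
  intro d
  induction d with
  | zero =>
    intro g hg
    have : ∀ x, g x = g 0 := fun x => by congr 1; exact Subsingleton.elim _ _
    simp [this]
  | succ d ih =>
    intro g hg
    have hc := hg.continuous
    have hdc : ∀ v, Continuous fun x => fderiv ℝ g x v := fun v =>
      (hg.continuous_fderiv (by simp)).clm_apply continuous_const
    set m := Rop u0 0 g with hm
    have hmc : ContDiff ℝ (⊤ : ℕ∞) m := Rop_contDiff 0 hg
    have hmean : ∫ z, g z ∂(nu (d + 1)) = ∫ y, m y ∂(nu d) := fubini 0 hc
    rw [hmean]
    set c := ∫ y, m y ∂(nu d) with hcdef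
    have e1 : ∫ x, (g x - c) ^ 2 ∂(nu (d + 1)) =
        ∫ y, ((∫ a, (g (ins 0 a y) - m y) ^ 2 ∂u0) + (m y - c) ^ 2) ∂(nu d) := by
      rw [nu, fubini 0 (by fun_prop)]
      change _ = ∫ y, _ ∂(Measure.pi fun _ => u0)
      congr 1
      funext y
      have hcy : Continuous fun a : ℝ => g (ins 0 a y) :=
        hc.comp ((continuous_ins 0).comp (by fun_prop : Continuous fun a : ℝ => (y, a)))
      exact var_shift hcy c
    have hc2 : Continuous fun y => ∫ a, (g (ins 0 a y) - m y) ^ 2 ∂u0 := by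
      refine CSM.continuous_integral ?_
      have h1 : Continuous fun p : (Fin d → ℝ) × ℝ => g (ins 0 p.2 p.1) :=
        hc.comp (continuous_ins 0)
      have h2 := hmc.continuous
      exact (h1.sub (h2.comp continuous_fst)).pow 2
    have hmcc := hmc.continuous
    rw [e1, integral_add (CSM.integrable hc2) (CSM.integrable (by fun_prop)), Fin.sum_univ_succ]
    refine add_le_add ?_ ?_
    · rw [show nu (d + 1) = Measure.pi fun _ => u0 from rfl,
        fubini 0 (by have := hdc (Pi.single 0 1); fun_prop)]
      refine integral_mono (CSM.integrable (ν := nu d) hc2) (CSM.integrable (ν := nu d) ?_) ?_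
      · refine CSM.continuous_integral ?_
        have h1 : Continuous fun p : (Fin d → ℝ) × ℝ =>
          fderiv ℝ g (ins 0 p.2 p.1) (Pi.single 0 1) := (hdc _).comp (continuous_ins 0)
        exact h1.pow 2
      · intro y
        have hgy : ContDiff ℝ (⊤ : ℕ∞) fun a : ℝ => g (ins 0 a y) :=
          hg.comp ((contDiff_ins 0).comp (by fun_prop : ContDiff ℝ (⊤ : ℕ∞) fun a : ℝ => (y, a)))
        have h1 := poincare1 (hgy.of_le (by exact_mod_cast le_top))
        have h2 : ∀ t, deriv (fun a : ℝ => g (ins 0 a y)) t =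
            fderiv ℝ g (ins 0 t y) (Pi.single 0 1) := by
          intro t
          have h3 : HasDerivAt (fun a : ℝ => ins (0 : Fin (d + 1)) a y) (Pi.single 0 1) t := by
            have h4 : HasDerivAt (fun a : ℝ => (y, a)) ((0 : Fin d → ℝ), (1 : ℝ)) t :=
              (hasDerivAt_const t y).prodMk (hasDerivAt_id t)
            have h5 := (insL (α := ℝ) (0 : Fin (d + 1))).hasFDerivAt.comp_hasDerivAt t h4
            rw [insL_apply] at h5
            simp only [ins_single_same] at h5
            exact h5
          exact ((hg.differentiable (by simp) _).hasFDerivAt.comp_hasDerivAt t h3).deriv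
        simp only [h2] at h1
        exact h1
    · refine (ih hmc).trans ?_
      refine Finset.sum_le_sum fun i _ => ?_
      rw [show nu (d + 1) = Measure.pi fun _ => u0 from rfl,
        fubini 0 (by have := hdc (Pi.single i.succ 1); fun_prop)]
      have hdm : Continuous fun x => fderiv ℝ m x (Pi.single i 1) :=
        (hmc.continuous_fderiv (by simp)).clm_apply continuous_const
      refine integral_mono (CSM.integrable (ν := nu d) (by fun_prop))
        (CSM.integrable (ν := nu d) ?_) ?_
      · refine CSM.continuous_integral ?_
        have h1 : Continuous fun p : (Fin d → ℝ) × ℝ =>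
          fderiv ℝ g (ins 0 p.2 p.1) (Pi.single i.succ 1) := (hdc _).comp (continuous_ins 0)
        exact h1.pow 2
      · intro y
        change (fderiv ℝ m y (Pi.single i 1)) ^ 2 ≤
          ∫ x, (fderiv ℝ g (ins 0 x y) (Pi.single i.succ 1)) ^ 2 ∂u0
        rw [hm, Rop_fderiv 0 hg, ins_zero_single]
        refine sq_integral_le ?_
        exact (hdc _).comp
          ((continuous_ins 0).comp (by fun_prop : Continuous fun a : ℝ => (y, a)))

/-! ## Part C: periodic functions and operators on them -/

section cfg
variable {d N : ℕ}

/-- partial derivative in coordinate `i` of particle `j` -/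
def pd (j : Fin N) (i : Fin d) (f : Cfg d N → ℝ) (x : Cfg d N) : ℝ :=
  fderiv ℝ f x (Pi.single j (Pi.single i 1))

/-- smooth periodic real functions -/
structure Per (f : Cfg d N → ℝ) : Prop where
  smooth : ContDiff ℝ (⊤ : ℕ∞) f
  per : ∀ (x : Cfg d N) (j : Fin N) (v : Fin d → ℤ),
    f (Function.update x j (x j + fun i => (v i : ℝ))) = f x

/-- integral over the configuration cube -/
def II (f : Cfg d N → ℝ) : ℝ := ∫ x, f x ∂(mu d N)

lemma intg {f : Cfg d N → ℝ} (hf : Continuous f) : Integrable f (mu d N) := CSM.integrable hf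

lemma II_add {f g : Cfg d N → ℝ} (hf : Continuous f) (hg : Continuous g) :
    II (fun x => f x + g x) = II f + II g := integral_add (intg hf) (intg hg)

lemma II_sub {f g : Cfg d N → ℝ} (hf : Continuous f) (hg : Continuous g) :
    II (fun x => f x - g x) = II f - II g := integral_sub (intg hf) (intg hg)

lemma II_neg {f : Cfg d N → ℝ} : II (fun x => - f x) = - II f := integral_neg _

lemma II_cmul {f : Cfg d N → ℝ} (c : ℝ) : II (fun x => c * f x) = c * II f :=
  integral_const_mul _ _

lemma II_sum {ι : Type} {s : Finset ι} {f : ι → Cfg d N → ℝ} (hf : ∀ i ∈ s, Continuous (f i)) :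
    II (fun x => ∑ i ∈ s, f i x) = ∑ i ∈ s, II (f i) :=
  integral_finsetSum _ fun i hi => intg (hf i hi)

lemma II_const (c : ℝ) : II (fun _ : Cfg d N => c) = c := by simp [II]

lemma II_mono {f g : Cfg d N → ℝ} (hf : Continuous f) (hg : Continuous g) (h : ∀ x, f x ≤ g x) :
    II f ≤ II g := integral_mono (intg hf) (intg hg) h

lemma II_nonneg {f : Cfg d N → ℝ} (h : ∀ x, 0 ≤ f x) : 0 ≤ II f := integral_nonneg h

lemma II_abs {f : Cfg d N → ℝ} : |II f| ≤ II fun x => |f x| := abs_integral_le_integral_abs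

lemma II_congr {f g : Cfg d N → ℝ} (h : ∀ x, f x = g x) : II f = II g := by
  congr 1; funext x; exact h x

lemma Per.cont {f : Cfg d N → ℝ} (hf : Per f) : Continuous f := hf.smooth.continuous

lemma Per.diff {f : Cfg d N → ℝ} (hf : Per f) : Differentiable ℝ f :=
  hf.smooth.differentiable (by simp)

lemma Per.pdc {f : Cfg d N → ℝ} (hf : Per f) (j : Fin N) (i : Fin d) : Continuous (pd j i f) :=
  (hf.smooth.continuous_fderiv (by simp)).clm_apply continuous_const

lemma Per.pd {f : Cfg d N → ℝ} (hf : Per f) (j : Fin N) (i : Fin d) : Per (pd j i f) := by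
  refine ⟨(hf.smooth.fderiv_right (by simp)).clm_apply contDiff_const, fun x l v => ?_⟩
  have key : f = fun y => f (y + Pi.single l (fun i => (v i : ℝ))) := by
    funext y
    rw [← hf.per y l v]
    congr 1
    funext m
    by_cases h : m = l
    · subst h; simp
    · simp [h]
  have h2 : x + Pi.single l (fun i => (v i : ℝ)) =
      Function.update x l (x l + fun i => (v i : ℝ)) := by
    funext m
    by_cases h : m = l
    · subst h; simp
    · simp [h]
  unfold _root_.pd
  conv_rhs => rw [key]
  rw [fderiv_comp_add_right, h2]

lemma Per.const (c : ℝ) : Per (fun _ : Cfg d N => c) := ⟨contDiff_const, fun _ _ _ => rfl⟩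

lemma Per.add {f g : Cfg d N → ℝ} (hf : Per f) (hg : Per g) : Per (fun x => f x + g x) :=
  ⟨hf.smooth.add hg.smooth, fun x j v => by rw [hf.per, hg.per]⟩

lemma Per.sub {f g : Cfg d N → ℝ} (hf : Per f) (hg : Per g) : Per (fun x => f x - g x) :=
  ⟨hf.smooth.sub hg.smooth, fun x j v => by rw [hf.per, hg.per]⟩

lemma Per.mul {f g : Cfg d N → ℝ} (hf : Per f) (hg : Per g) : Per (fun x => f x * g x) :=
  ⟨hf.smooth.mul hg.smooth, fun x j v => by rw [hf.per, hg.per]⟩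

lemma Per.cmul {f : Cfg d N → ℝ} (c : ℝ) (hf : Per f) : Per (fun x => c * f x) :=
  (Per.const c).mul hf

lemma Per.sum {ι : Type} {s : Finset ι} {f : ι → Cfg d N → ℝ} (hf : ∀ i ∈ s, Per (f i)) :
    Per (fun x => ∑ i ∈ s, f i x) :=
  ⟨ContDiff.sum fun i hi => (hf i hi).smooth, fun x j v =>
    Finset.sum_congr rfl fun i hi => (hf i hi).per x j v⟩

lemma Per.exp {f : Cfg d N → ℝ} (hf : Per f) : Per (fun x => Real.exp (f x)) :=
  ⟨hf.smooth.exp, fun x j v => by rw [hf.per]⟩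

lemma pd_add {f g : Cfg d N → ℝ} (hf : Per f) (hg : Per g) (j : Fin N) (i : Fin d) (x : Cfg d N) :
    pd j i (fun x => f x + g x) x = pd j i f x + pd j i g x := by
  unfold pd
  rw [fderiv_fun_add (hf.diff x) (hg.diff x)]; rfl

lemma pd_sub {f g : Cfg d N → ℝ} (hf : Per f) (hg : Per g) (j : Fin N) (i : Fin d) (x : Cfg d N) :
    pd j i (fun x => f x - g x) x = pd j i f x - pd j i g x := by
  unfold pd
  rw [fderiv_fun_sub (hf.diff x) (hg.diff x)]; rfl

lemma pd_mul {f g : Cfg d N → ℝ} (hf : Per f) (hg : Per g) (j : Fin N) (i : Fin d) (x : Cfg d N) :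
    pd j i (fun x => f x * g x) x = pd j i f x * g x + f x * pd j i g x := by
  unfold pd
  rw [fderiv_fun_mul (hf.diff x) (hg.diff x)]
  simp; ring

lemma pd_const (c : ℝ) (j : Fin N) (i : Fin d) (x : Cfg d N) :
    pd j i (fun _ => c) x = 0 := by
  simp [pd]

lemma pd_cmul {f : Cfg d N → ℝ} (c : ℝ) (hf : Per f) (j : Fin N) (i : Fin d) (x : Cfg d N) :
    pd j i (fun x => c * f x) x = c * pd j i f x := by
  rw [pd_mul (Per.const c) hf, pd_const]; ring

lemma pd_sum {ι : Type} {s : Finset ι} {f : ι → Cfg d N → ℝ} (hf : ∀ i ∈ s, Per (f i))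
    (j : Fin N) (i : Fin d) (x : Cfg d N) :
    pd j i (fun x => ∑ a ∈ s, f a x) x = ∑ a ∈ s, pd j i (f a) x := by
  unfold pd
  rw [fderiv_fun_sum fun a ha => (hf a ha).diff x]; simp

lemma pd_exp {f : Cfg d N → ℝ} (hf : Per f) (j : Fin N) (i : Fin d) (x : Cfg d N) :
    pd j i (fun x => Real.exp (f x)) x = Real.exp (f x) * pd j i f x := by
  unfold pd
  rw [fderiv_exp (hf.diff x)]; simp

lemma fubini_cfg {n : ℕ} (k : Fin (n + 1)) {f : Cfg d (n + 1) → ℝ} (hf : Continuous f) :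
    II f = ∫ y, ∫ x, f (ins k x y) ∂(nu d) ∂(mu d n) := fubini k hf

/-- periodic integration by parts -/
lemma ibp {f : Cfg d N → ℝ} (hf : Per f) (j : Fin N) (i : Fin d) : II (pd j i f) = 0 := by
  obtain ⟨n, rfl⟩ : ∃ n, N = n + 1 := ⟨N - 1, by have := j.pos; omega⟩
  obtain ⟨e, rfl⟩ : ∃ e, d = e + 1 := ⟨d - 1, by have := i.pos; omega⟩
  rw [fubini_cfg j (hf.pdc j i)]
  have : ∀ y, ∫ x, pd j i f (ins j x y) ∂(nu (e + 1)) = 0 := by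
    intro y
    have hc : Continuous fun x : Fin (e + 1) → ℝ => pd j i f (ins j x y) :=
      (hf.pdc j i).comp ((continuous_ins j).comp (by fun_prop :
        Continuous fun a : Fin (e + 1) → ℝ => (y, a)))
    rw [nu, fubini i hc]
    have h2 : ∀ x', ∫ t, pd j i f (ins j (ins i t x') y) ∂u0 = 0 := by
      intro x'
      rw [u0_eq]
      have hd : ∀ t : ℝ, HasDerivAt (fun t : ℝ => f (ins j (ins i t x') y))
          (pd j i f (ins j (ins i t x') y)) t := by
        intro t
        have h3 : HasDerivAt (fun a : ℝ => ins i a x') (Pi.single i 1) t := by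
          have h4 : HasDerivAt (fun a : ℝ => (x', a)) ((0 : Fin e → ℝ), (1 : ℝ)) t :=
            (hasDerivAt_const t x').prodMk (hasDerivAt_id t)
          have h5 := (insL (α := ℝ) i).hasFDerivAt.comp_hasDerivAt t h4
          rw [insL_apply] at h5
          simp only [ins_single_same] at h5
          exact h5
        have h6 : HasDerivAt (fun a : ℝ => ins j (ins i a x') y)
            (Pi.single j (Pi.single i 1)) t := by
          have h4 : HasDerivAt (fun a : ℝ => (y, ins i a x'))
              ((0 : Fin n → Fin (e + 1) → ℝ), (Pi.single i 1 : Fin (e + 1) → ℝ)) t :=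
            (hasDerivAt_const t y).prodMk h3
          have h5 := (insL (α := Fin (e + 1) → ℝ) j).hasFDerivAt.comp_hasDerivAt t h4
          rw [insL_apply] at h5
          simp only [ins_single_same] at h5
          exact h5
        exact (hf.diff _).hasFDerivAt.comp_hasDerivAt t h6
      have hcc : Continuous fun t : ℝ => pd j i f (ins j (ins i t x') y) :=
        hc.comp ((continuous_ins i).comp (by fun_prop : Continuous fun a : ℝ => (x', a)))
      rw [intervalIntegral.integral_eq_sub_of_hasDerivAt (fun t _ => hd t)
        (hcc.intervalIntegrable _ _)]
      have h7 := hf.per (ins j (ins i 0 x') y) j (Pi.single i 1)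
      have h8 : Function.update (ins j (ins i 0 x') y) j ((ins j (ins i 0 x') y) j +
          fun i_1 => ((Pi.single i (1 : ℤ) : Fin (e + 1) → ℤ) i_1 : ℝ)) =
          ins j (ins i 1 x') y := by
        funext l
        rcases Fin.eq_self_or_eq_succAbove j l with rfl | ⟨l', rfl⟩
        · simp only [Function.update_self, ins_same]
          funext m
          rcases Fin.eq_self_or_eq_succAbove i m with rfl | ⟨m', rfl⟩
          · simp
          · simp [Fin.succAbove_ne]
        · simp [Fin.succAbove_ne]
      rw [h8] at h7
      rw [h7]; ring
    simp [h2]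
  simp [this]

lemma ibp2 {f g : Cfg d N → ℝ} (hf : Per f) (hg : Per g) (j : Fin N) (i : Fin d) :
    II (fun x => pd j i f x * g x) = - II (fun x => f x * pd j i g x) := by
  have h := ibp (hf.mul hg) j i
  have e : II (pd j i fun x => f x * g x) =
      II (fun x => pd j i f x * g x + f x * pd j i g x) :=
    II_congr fun x => pd_mul hf hg j i x
  have c1 := hf.cont
  have c2 := hg.cont
  have c3 := hf.pdc j i
  have c4 := hg.pdc j i
  rw [e, II_add (by fun_prop) (by fun_prop)] at h
  linarith

/-- Averaging over particle `k`. -/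
def Pop (k : Fin N) (f : Cfg d N → ℝ) : Cfg d N → ℝ :=
  fun x => ∫ z, f (Function.update x k z) ∂(nu d)

/-- Complementary projection. -/
def Qp (k : Fin N) (f : Cfg d N → ℝ) : Cfg d N → ℝ := fun x => f x - Pop k f x

/-- update as a continuous linear map. -/
def updL (k : Fin N) : (Cfg d N × (Fin d → ℝ)) →L[ℝ] Cfg d N where
  toFun := fun p => Function.update p.1 k p.2
  map_add' := by
    intro p q; funext j
    by_cases h : j = k
    · subst h; simp
    · simp [h]
  map_smul' := by
    intro c p; funext j
    by_cases h : j = k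
    · subst h; simp
    · simp [h]
  cont := by fun_prop

lemma updL_apply (k : Fin N) (p : Cfg d N × (Fin d → ℝ)) :
    updL k p = Function.update p.1 k p.2 := rfl

lemma Pop_cont (k : Fin N) {f : Cfg d N → ℝ} (hf : Continuous f) : Continuous (Pop k f) := by
  refine CSM.continuous_integral (ν := nu d) (F := fun x z => f (Function.update x k z)) ?_
  exact hf.comp (updL k).cont

lemma Qp_cont (k : Fin N) {f : Cfg d N → ℝ} (hf : Continuous f) : Continuous (Qp k f) :=
  hf.sub (Pop_cont k hf)

lemma Per.Pop {f : Cfg d N → ℝ} (hf : Per f) (k : Fin N) : Per (Pop k f) := by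
  refine ⟨CSM.contDiff_top (ν := nu d) (fun p => f (updL k p))
    (hf.smooth.comp (updL k).contDiff), fun x j v => ?_⟩
  unfold _root_.Pop
  congr 1
  funext z
  by_cases h : j = k
  · subst h; simp
  · rw [Function.update_comm h]
    have := hf.per (Function.update x k z) j v
    rwa [Function.update_of_ne h] at this

lemma Per.Qp {f : Cfg d N → ℝ} (hf : Per f) (k : Fin N) : Per (Qp k f) := hf.sub (hf.Pop k)

lemma Pop_upd (k : Fin N) (f : Cfg d N → ℝ) (x : Cfg d N) (z : Fin d → ℝ) :
    Pop k f (Function.update x k z) = Pop k f x := by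
  simp [Pop]

lemma II_Pop (k : Fin N) {f : Cfg d N → ℝ} (hf : Continuous f) : II (Pop k f) = II f := by
  obtain ⟨n, rfl⟩ : ∃ n, N = n + 1 := ⟨N - 1, by have := k.pos; omega⟩
  rw [fubini_cfg k (Pop_cont k hf), fubini_cfg k hf]
  congr 1
  funext y
  have : ∀ x, Pop k f (ins k x y) = ∫ z, f (ins k z y) ∂(nu d) := by
    intro x
    unfold Pop
    congr 1; funext z
    rw [← ins_rem, rem_ins]
  simp [this]

lemma Pop_mul_left (k : Fin N) {f g : Cfg d N → ℝ}
    (hg : ∀ x z, g (Function.update x k z) = g x) (x : Cfg d N) :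
    Pop k (fun x => g x * f x) x = g x * Pop k f x := by
  simp only [Pop, hg]
  exact integral_const_mul _ _

/-- integrate `f` against a function independent of variable `k` -/
lemma II_indep (k : Fin N) {f g : Cfg d N → ℝ} (hf : Continuous f) (hgc : Continuous g)
    (hg : ∀ x z, g (Function.update x k z) = g x) :
    II (fun x => g x * f x) = II (fun x => g x * Pop k f x) := by
  rw [← II_Pop k (by fun_prop)]
  exact II_congr fun x => Pop_mul_left k hg x

lemma pd_Pop_ne {k j : Fin N} (h : j ≠ k) (i : Fin d) {f : Cfg d N → ℝ} (hf : Per f)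
    (x : Cfg d N) : pd j i (Pop k f) x = Pop k (pd j i f) x := by
  have h1 : ContDiff ℝ 1 (fun p : Cfg d N × (Fin d → ℝ) => f (updL k p)) :=
    (hf.smooth.comp (updL k).contDiff).of_le (by exact_mod_cast le_top)
  have h2 := (CSM.hasFDerivAt (ν := nu d) _ h1 x).fderiv
  have hcont : Continuous (fun z : Fin d → ℝ => (fderiv ℝ (fun p : Cfg d N × (Fin d → ℝ) =>
      f (updL k p)) (x, z)).comp (ContinuousLinearMap.inl ℝ (Cfg d N) (Fin d → ℝ))) :=
    ((h1.continuous_fderiv one_ne_zero).comp (by fun_prop)).clm_comp continuous_const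
  change fderiv ℝ (fun y => ∫ z, f (updL k (y, z)) ∂(nu d)) x _ = _
  rw [h2, ContinuousLinearMap.integral_apply (CSM.integrable hcont)]
  unfold Pop
  congr 1
  funext z
  have h3 : HasFDerivAt (fun p : Cfg d N × (Fin d → ℝ) => f (updL k p))
      ((fderiv ℝ f (Function.update x k z)).comp (updL k)) (x, z) := by
    have := (hf.diff (Function.update x k z)).hasFDerivAt
    have hi : HasFDerivAt (fun p : Cfg d N × (Fin d → ℝ) => updL k p) (updL k) (x, z) :=
      (updL k).hasFDerivAt
    exact HasFDerivAt.comp (x, z) this hi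
  rw [h3.fderiv]
  have h4 : Function.update (Pi.single j (Pi.single i 1) : Cfg d N) k 0 =
      Pi.single j (Pi.single i 1) := by
    rw [Function.update_eq_self_iff]
    rw [Pi.single_eq_of_ne h.symm]
  simp [updL_apply, h4, pd]

/-- derivative in a direction along which the function is constant -/
lemma pd_indep {k : Fin N} (i : Fin d) {f : Cfg d N → ℝ} (hf : Per f)
    (hg : ∀ x z, f (Function.update x k z) = f x) (x : Cfg d N) : pd k i f x = 0 := by
  have hl : HasDerivAt (fun t : ℝ => x + t • (Pi.single k (Pi.single i 1) : Cfg d N))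
      (Pi.single k (Pi.single i 1)) 0 := by
    have := ((hasDerivAt_id (0 : ℝ)).smul_const
      (Pi.single k (Pi.single i 1) : Cfg d N)).const_add x
    simpa using this
  have h1 : HasDerivAt (fun t : ℝ => f (x + t • (Pi.single k (Pi.single i 1) : Cfg d N)))
      (pd k i f x) 0 := by
    have := (hf.diff (x + (0 : ℝ) • (Pi.single k (Pi.single i 1) : Cfg d N))).hasFDerivAt
    have h3 := this.comp_hasDerivAt (0 : ℝ) hl
    have e0 : x + (0 : ℝ) • (Pi.single k (Pi.single i 1) : Cfg d N) = x := by simp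
    rw [e0] at h3
    exact h3
  have h2 : (fun t : ℝ => f (x + t • (Pi.single k (Pi.single i 1) : Cfg d N))) = fun _ => f x := by
    funext t
    rw [← hg x (x k + t • Pi.single i 1)]
    congr 1
    funext l
    by_cases h : l = k
    · subst h; simp
    · simp [h]
  rw [h2] at h1
  exact h1.unique (hasDerivAt_const _ _)

lemma pd_Pop_self (k : Fin N) (i : Fin d) {f : Cfg d N → ℝ} (hf : Per f) (x : Cfg d N) :
    pd k i (Pop k f) x = 0 := pd_indep i (hf.Pop k) (fun x z => Pop_upd k f x z) x

/-- Poincare in one particle variable -/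
lemma poincare_k (k : Fin N) {f : Cfg d N → ℝ} (hf : Per f) :
    II (fun x => Qp k f x ^ 2) ≤ ∑ i, II (fun x => pd k i f x ^ 2) := by
  obtain ⟨n, rfl⟩ : ∃ n, N = n + 1 := ⟨N - 1, by have := k.pos; omega⟩
  have c1 := Qp_cont k hf.cont
  have c2 := fun i => hf.pdc k i
  have hcy : ∀ y : Fin n → Fin d → ℝ, Continuous fun x : Fin d → ℝ => ins k x y := fun y =>
    (continuous_ins k).comp (by fun_prop : Continuous fun a : Fin d → ℝ => (y, a))
  rw [← II_sum (fun i _ => by have := c2 i; fun_prop),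
    fubini_cfg k (by fun_prop), fubini_cfg k (by fun_prop)]
  refine integral_mono (CSM.integrable ?_) (CSM.integrable ?_) ?_
  · refine CSM.continuous_integral ?_
    exact (c1.comp (continuous_ins k)).pow 2
  · refine CSM.continuous_integral ?_
    exact continuous_finsetSum _ fun i _ => ((c2 i).comp (continuous_ins k)).pow 2
  · intro y
    have hg : ContDiff ℝ (⊤ : ℕ∞) fun x => f (ins k x y) :=
      hf.smooth.comp ((contDiff_ins k).comp
        (by fun_prop : ContDiff ℝ (⊤ : ℕ∞) fun a : Fin d → ℝ => (y, a)))
    have h1 := poincare d hg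
    have h2 : ∀ x i, fderiv ℝ (fun x => f (ins k x y)) x (Pi.single i 1) =
        pd k i f (ins k x y) := by
      intro x i
      have hi : HasFDerivAt (fun x : Fin d → ℝ => ins k x y)
          ((insL k).comp (ContinuousLinearMap.inr ℝ (Fin n → Fin d → ℝ) (Fin d → ℝ))) x := by
        have hj : HasFDerivAt (fun x : Fin d → ℝ => (y, x))
          (ContinuousLinearMap.inr ℝ (Fin n → Fin d → ℝ) (Fin d → ℝ)) x :=
            hasFDerivAt_prodMk_right y x
        have hk : HasFDerivAt (fun p : (Fin n → Fin d → ℝ) × (Fin d → ℝ) => ins k p.2 p.1)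
          (insL k) (y, x) := (insL (α := Fin d → ℝ) k).hasFDerivAt
        exact HasFDerivAt.comp x hk hj
      have := HasFDerivAt.comp x (hf.diff (ins k x y)).hasFDerivAt hi
      rw [show (fun x => f (ins k x y)) = f ∘ fun x => ins k x y from rfl, this.fderiv]
      simp [insL_apply, ins_single_same, pd]
    simp only [h2] at h1
    have h3 : ∀ x, Qp k f (ins k x y) = f (ins k x y) - ∫ z, f (ins k z y) ∂(nu d) := by
      intro x
      unfold Qp Pop
      congr 2; funext z
      rw [← ins_rem, rem_ins]
    simp only [h3]
    refine h1.trans (le_of_eq ?_)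
    rw [← integral_finsetSum]
    intro i _
    exact CSM.integrable (((c2 i).comp (hcy y)).pow 2)

end cfg

/-! ## Part D: forms -/

/-- Properties of the (mean zero) interaction. -/
structure Wok {d : ℕ} (w : (Fin d → ℝ) → ℝ) (B : ℝ) : Prop where
  cont : Continuous w
  even : ∀ x, w (-x) = w x
  mean : ∀ y, ∫ z, w (z - y) ∂(nu d) = 0
  bnd : ∀ x, |w x| ≤ B
  psd : ∀ (N : ℕ) (x : Cfg d N), 0 ≤ ∑ a, ∑ b, w (x a - x b)

section forms
variable {d N : ℕ}

/-- pair interaction -/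
def pw (w : (Fin d → ℝ) → ℝ) (j k : Fin N) (x : Cfg d N) : ℝ :=
  if j = k then 0 else w (x j - x k)

/-- total interaction -/
def Wf (w : (Fin d → ℝ) → ℝ) (x : Cfg d N) : ℝ := (1 / 2) * ∑ j, ∑ k, pw w j k x

/-- squared norm -/
def n2 (f : Cfg d N → ℝ) : ℝ := II fun x => f x ^ 2

/-- kinetic form -/
def TT (f g : Cfg d N → ℝ) : ℝ := ∑ j, ∑ i, II fun x => pd j i f x * pd j i g x

/-- energy form -/
def qq (lam : ℝ) (w : (Fin d → ℝ) → ℝ) (f g : Cfg d N → ℝ) : ℝ :=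
  TT f g + lam * II fun x => Wf w x * (f x * g x)

lemma n2_nonneg (f : Cfg d N → ℝ) : 0 ≤ n2 f := II_nonneg fun _ => sq_nonneg _

lemma TT_nonneg (f : Cfg d N → ℝ) : 0 ≤ TT f f :=
  Finset.sum_nonneg fun _ _ => Finset.sum_nonneg fun _ _ => II_nonneg fun _ => mul_self_nonneg _

variable {w : (Fin d → ℝ) → ℝ} {B : ℝ}

lemma Wok.B_nonneg (hw : Wok w B) : 0 ≤ B := (abs_nonneg _).trans (hw.bnd 0)

lemma pw_cont (hw : Wok w B) (j k : Fin N) : Continuous (pw w j k) := by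
  unfold pw
  by_cases h : j = k
  · simp only [h, if_true]; exact continuous_const
  · simp only [h, if_false]
    exact hw.cont.comp (by fun_prop)

lemma Wf_cont (hw : Wok w B) : Continuous (Wf w : Cfg d N → ℝ) := by
  unfold Wf
  have := fun j k => pw_cont (N := N) hw j k
  fun_prop

lemma pw_bnd (hw : Wok w B) (j k : Fin N) (x : Cfg d N) : |pw w j k x| ≤ B := by
  unfold pw
  split_ifs
  · simpa using hw.B_nonneg
  · exact hw.bnd _

lemma pw_comm (hw : Wok w B) (j k : Fin N) : pw w j k = (pw w k j : Cfg d N → ℝ) := by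
  funext x
  unfold pw
  by_cases h : j = k
  · simp [h]
  · rw [if_neg h, if_neg (Ne.symm h), ← hw.even, neg_sub]

lemma pw_self (k : Fin N) (x : Cfg d N) : pw w k k x = 0 := by simp [pw]

lemma Wf_lower (hw : Wok w B) (x : Cfg d N) : -(N * B / 2) ≤ Wf w x := by
  have h1 := hw.psd N x
  have h2 : ∑ j, ∑ k, pw w j k x = ∑ a, ∑ b, w (x a - x b) - N * w 0 := by
    have : ∀ j, ∑ k, pw w j k x = ∑ b, w (x j - x b) - w 0 := by
      intro j
      have e : ∀ k, pw w j k x = w (x j - x k) - (if j = k then w 0 else 0) := by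
        intro k
        unfold pw
        by_cases h : j = k
        · subst h; simp
        · simp [h]
      simp [e, Finset.sum_sub_distrib]
    simp [this, Finset.sum_sub_distrib]
  have h3 : w 0 ≤ B := (le_abs_self _).trans (hw.bnd 0)
  unfold Wf
  rw [h2]
  have : (N : ℝ) * w 0 ≤ N * B := by gcongr
  linarith

lemma cs0 {f g : Cfg d N → ℝ} (hf : Continuous f) (hg : Continuous g) :
    (II fun x => f x * g x) ^ 2 ≤ n2 f * n2 g := by
  have key : ∀ t : ℝ, 0 ≤ n2 g * (t * t) + (2 * II fun x => f x * g x) * t + n2 f := by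
    intro t
    have h0 : 0 ≤ II fun x => (f x + t * g x) ^ 2 := II_nonneg fun _ => sq_nonneg _
    have h1 : (II fun x => (f x + t * g x) ^ 2) =
        n2 f + (2 * t) * (II fun x => f x * g x) + t ^ 2 * n2 g := by
      unfold n2
      rw [← II_cmul, ← II_cmul, ← II_add (by fun_prop) (by fun_prop),
        ← II_add (by fun_prop) (by fun_prop)]
      exact II_congr fun x => by ring
    nlinarith
  have := discrim_le_zero key
  unfold discrim at this
  nlinarith

lemma cs {f g : Cfg d N → ℝ} (hf : Continuous f) (hg : Continuous g) :
    (II fun x => |f x * g x|) ≤ √(n2 f) * √(n2 g) := by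
  have := cs0 (f := fun x => |f x|) (g := fun x => |g x|) hf.abs hg.abs
  rw [← Real.sqrt_mul (n2_nonneg f)]
  apply Real.le_sqrt_of_sq_le
  simpa [n2, abs_mul] using this

lemma cs_v {f g v : Cfg d N → ℝ} {B : ℝ} (hB : 0 ≤ B) (hf : Continuous f) (hg : Continuous g)
    (hv : Continuous v) (hvB : ∀ x, |v x| ≤ B) :
    |II fun x => v x * (f x * g x)| ≤ B * (√(n2 f) * √(n2 g)) := by
  refine II_abs.trans ?_
  refine le_trans ?_ (mul_le_mul_of_nonneg_left (cs hf hg) hB)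
  rw [← II_cmul]
  refine II_mono (by fun_prop) (by fun_prop) fun x => ?_
  rw [abs_mul]
  exact mul_le_mul_of_nonneg_right (hvB x) (abs_nonneg _)

lemma orth (k : Fin N) {f g : Cfg d N → ℝ} (hf : Continuous f) (hgc : Continuous g)
    (hg : ∀ x z, g (Function.update x k z) = g x) : II (fun x => g x * Qp k f x) = 0 := by
  have := II_indep k hf hgc hg
  have c := Pop_cont k hf
  have e : (II fun x => g x * Qp k f x) = II fun x => g x * f x - g x * Pop k f x :=
    II_congr fun x => by unfold Qp; ring
  rw [e, II_sub (by fun_prop) (by fun_prop), this]; ring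

lemma pyth (k : Fin N) {f : Cfg d N → ℝ} (hf : Continuous f) :
    n2 f = n2 (Pop k f) + n2 (Qp k f) := by
  have c := Pop_cont k hf
  have c' := Qp_cont k hf
  have h := orth k hf c (fun x z => Pop_upd k f x z)
  have e : n2 f = II fun x => Pop k f x ^ 2 + (2 * (Pop k f x * Qp k f x) + Qp k f x ^ 2) :=
    II_congr fun x => by unfold Qp; ring
  rw [e, II_add (by fun_prop) (by fun_prop), II_add (by fun_prop) (by fun_prop), II_cmul, h]
  unfold n2; ring

lemma II_f_Pop (k : Fin N) {f : Cfg d N → ℝ} (hf : Continuous f) :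
    (II fun x => f x * Pop k f x) = n2 (Pop k f) := by
  have := II_indep k hf (Pop_cont k hf) (fun x z => Pop_upd k f x z)
  rw [II_congr (fun x => mul_comm (f x) _), this]
  exact II_congr fun x => by ring

lemma pw_mean (hw : Wok w B) {k j : Fin N} {g : Cfg d N → ℝ} (hgc : Continuous g)
    (hg : ∀ x z, g (Function.update x k z) = g x) : (II fun x => pw w k j x * g x) = 0 := by
  by_cases h : k = j
  · subst h; simp [pw_self, II_const]
  have h1 := II_indep k (pw_cont hw k j) hgc hg
  have h2 : ∀ x : Cfg d N, Pop k (pw w k j) x = 0 := by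
    intro x
    unfold Pop pw
    simp only [h, if_false, Function.update_self, Function.update_of_ne (Ne.symm h)]
    exact hw.mean _
  rw [II_congr (fun x => mul_comm _ _), h1]
  simp [h2, II_const]

lemma n2_Qp_le (k : Fin N) {f : Cfg d N → ℝ} (hf : Continuous f) : n2 (Qp k f) ≤ n2 f := by
  have := pyth k hf
  have := n2_nonneg (Pop k f)
  linarith

lemma n2_Pop_le (k : Fin N) {f : Cfg d N → ℝ} (hf : Continuous f) : n2 (Pop k f) ≤ n2 f := by
  have := pyth k hf
  have := n2_nonneg (Qp k f)
  linarith

/-- general mean-zero multiplier bound -/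
lemma mz_bound (k : Fin N) {f v : Cfg d N → ℝ} {B : ℝ} (hB : 0 ≤ B) (hf : Continuous f)
    (hv : Continuous v) (hvB : ∀ x, |v x| ≤ B)
    (hm : II (fun x => v x * (Pop k f x * Pop k f x)) = 0) :
    |II fun x => v x * (f x * f x)| ≤ 2 * B * (√(n2 f) * √(n2 (Qp k f))) := by
  have c := Pop_cont k hf
  have c' := Qp_cont k hf
  have e : (II fun x => v x * (f x * f x)) = (II fun x => v x * (f x * Qp k f x)) +
      (II fun x => v x * (Pop k f x * Qp k f x)) := by
    rw [← II_add (by fun_prop) (by fun_prop)]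
    rw [← add_zero (II fun x => v x * (f x * Qp k f x) + v x * (Pop k f x * Qp k f x)), ← hm,
      ← II_add (by fun_prop) (by fun_prop)]
    exact II_congr fun x => by unfold Qp; ring
  rw [e]
  have h1 := cs_v hB hf c' hv hvB
  have h2 := cs_v hB c c' hv hvB
  have h3 : √(n2 (Pop k f)) ≤ √(n2 f) := Real.sqrt_le_sqrt (n2_Pop_le k hf)
  have h4 : √(n2 (Pop k f)) * √(n2 (Qp k f)) ≤ √(n2 f) * √(n2 (Qp k f)) := by gcongr
  have h5 := abs_add_le (II fun x => v x * (f x * Qp k f x))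
    (II fun x => v x * (Pop k f x * Qp k f x))
  nlinarith

lemma pw_bound (hw : Wok w B) (k j : Fin N) {f : Cfg d N → ℝ} (hf : Continuous f) :
    |II fun x => pw w k j x * (f x * f x)| ≤ 2 * B * (√(n2 f) * √(n2 (Qp k f))) := by
  have c := Pop_cont k hf
  refine mz_bound k hw.B_nonneg hf (pw_cont hw k j) (pw_bnd hw k j) ?_
  exact pw_mean hw (by fun_prop) (fun x z => by simp [Pop_upd])

lemma sum_cross (k : Fin N) (a : Fin N → Fin N → ℝ) (hs : ∀ j l, a j l = a l j)
    (h0 : ∀ j l, j ≠ k → l ≠ k → a j l = 0) (hk : a k k = 0) :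
    (1 / 2) * ∑ j, ∑ l, a j l = ∑ l, a k l := by
  have h1 : ∀ j, j ≠ k → ∑ l, a j l = a k j := by
    intro j hj
    rw [Finset.sum_eq_single k (fun l _ hl => h0 j l hj hl) (by simp), hs]
  have h2 : ∑ j, ∑ l, a j l = ∑ l, a k l + ∑ j ∈ Finset.univ.erase k, a k j := by
    rw [← Finset.add_sum_erase _ _ (Finset.mem_univ k)]
    congr 1
    exact Finset.sum_congr rfl fun j hj => h1 j (Finset.ne_of_mem_erase hj)
  have h3 : ∑ l, a k l = a k k + ∑ j ∈ Finset.univ.erase k, a k j :=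
    (Finset.add_sum_erase _ _ (Finset.mem_univ k)).symm
  rw [h2, h3, hk]; ring

lemma II_Wf (hw : Wok w B) {g : Cfg d N → ℝ} (hg : Continuous g) :
    (II fun x => Wf w x * g x) = (1 / 2) * ∑ j, ∑ k, II fun x => pw w j k x * g x := by
  have hc := fun j k => pw_cont (N := N) hw j k
  have : ∀ j, ∑ k, (II fun x => pw w j k x * g x) = II fun x => ∑ k, pw w j k x * g x :=
    fun j => (II_sum fun k _ => by have := hc j k; fun_prop).symm
  simp only [this]
  rw [← II_sum (fun j _ => by have := hc j; fun_prop), ← II_cmul]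
  refine II_congr fun x => ?_
  unfold Wf
  simp only [Finset.sum_mul, mul_assoc]

lemma Per.pd_upd {f : Cfg d N → ℝ} (hf : Per f) {k : Fin N}
    (h : ∀ x z, f (Function.update x k z) = f x) (j : Fin N) (i : Fin d) (x : Cfg d N)
    (z : Fin d → ℝ) : _root_.pd j i f (Function.update x k z) = _root_.pd j i f x := by
  by_cases hj : j = k
  · subst hj
    rw [pd_indep i hf h, pd_indep i hf h]
  · have e : f = _root_.Pop k f := by
      funext y; simp [_root_.Pop, h]
    rw [e, pd_Pop_ne hj i hf, pd_Pop_ne hj i hf, Pop_upd]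

lemma TT_Pop (k : Fin N) {f g : Cfg d N → ℝ} (hf : Per f) (hg : Per g)
    (h : ∀ x z, g (Function.update x k z) = g x) : TT f g = TT (Pop k f) g := by
  unfold TT
  refine Finset.sum_congr rfl fun j _ => Finset.sum_congr rfl fun i _ => ?_
  by_cases hj : j = k
  · subst hj
    simp [pd_indep i hg h, II_const]
  · rw [II_congr (fun x => mul_comm _ _), II_indep k (hf.pdc j i) (hg.pdc j i)
      (hg.pd_upd h j i)]
    exact II_congr fun x => by rw [pd_Pop_ne hj i hf]; ring

/-- Key lemma -/
lemma qq_Pop (hw : Wok w B) (lam : ℝ) (k : Fin N) {f g : Cfg d N → ℝ} (hf : Per f) (hg : Per g)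
    (h : ∀ x z, g (Function.update x k z) = g x) :
    qq lam w f g = qq lam w (Pop k f) g + lam * ∑ l, II fun x => pw w k l x * (f x * g x) := by
  have cf := hf.cont
  have cg := hg.cont
  have cP := Pop_cont k cf
  have cQ := Qp_cont k cf
  unfold qq
  rw [TT_Pop k hf hg h]
  have hc := fun j k => pw_cont (N := N) hw j k
  have cW := Wf_cont (N := N) hw
  have e1 : (II fun x => Wf w x * (f x * g x)) = (II fun x => Wf w x * (Pop k f x * g x)) +
      II fun x => Wf w x * (Qp k f x * g x) := by
    rw [← II_add (by fun_prop) (by fun_prop)]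
    exact II_congr fun x => by unfold Qp; ring
  have e2 : (II fun x => Wf w x * (Qp k f x * g x)) =
      ∑ l, II fun x => pw w k l x * (Qp k f x * g x) := by
    rw [II_Wf hw (by fun_prop)]
    refine sum_cross k _ (fun j l => by rw [pw_comm hw]) (fun j l hj hl => ?_)
      (by simp [pw_self, II_const])
    have := orth k cf (g := fun x => pw w j l x * g x) (by have := hc j l; fun_prop)
      (fun x z => by simp [pw, Function.update_of_ne hj, Function.update_of_ne hl, h])
    rw [← this]
    exact II_congr fun x => by ring
  have e3 : ∀ l, (II fun x => pw w k l x * (Qp k f x * g x)) =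
      II fun x => pw w k l x * (f x * g x) := by
    intro l
    have h1 := pw_mean hw (k := k) (j := l) (g := fun x => Pop k f x * g x) (by fun_prop)
      (fun x z => by simp [Pop_upd, h])
    have hcl := hc k l
    rw [← add_zero (II fun x => pw w k l x * (Qp k f x * g x)), ← h1,
      ← II_add (by fun_prop) (by fun_prop)]
    exact II_congr fun x => by unfold Qp; ring
  rw [e1, e2, Finset.sum_congr rfl fun l _ => e3 l]
  ring

/-! bilinearity -/

lemma TT_comm (f g : Cfg d N → ℝ) : TT f g = TT g f := by
  unfold TT
  refine Finset.sum_congr rfl fun j _ => Finset.sum_congr rfl fun i _ => ?_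
  exact II_congr fun x => mul_comm _ _

lemma qq_comm (lam : ℝ) (f g : Cfg d N → ℝ) : qq lam w f g = qq lam w g f := by
  unfold qq
  rw [TT_comm]
  congr 2
  exact II_congr fun x => by ring

lemma TT_add_left {f g h : Cfg d N → ℝ} (hf : Per f) (hg : Per g) (hh : Per h) :
    TT (fun x => f x + g x) h = TT f h + TT g h := by
  unfold TT
  rw [← Finset.sum_add_distrib]
  refine Finset.sum_congr rfl fun j _ => ?_
  rw [← Finset.sum_add_distrib]
  refine Finset.sum_congr rfl fun i _ => ?_
  have := hf.pdc j i
  have := hg.pdc j i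
  have := hh.pdc j i
  rw [← II_add (by fun_prop) (by fun_prop)]
  exact II_congr fun x => by rw [pd_add hf hg]; ring

lemma TT_cmul_left {f h : Cfg d N → ℝ} (c : ℝ) (hf : Per f) :
    TT (fun x => c * f x) h = c * TT f h := by
  unfold TT
  rw [Finset.mul_sum]
  refine Finset.sum_congr rfl fun j _ => ?_
  rw [Finset.mul_sum]
  refine Finset.sum_congr rfl fun i _ => ?_
  rw [← II_cmul]
  exact II_congr fun x => by rw [pd_cmul c hf]; ring

lemma qq_add_left (hw : Wok w B) (lam : ℝ) {f g h : Cfg d N → ℝ} (hf : Per f) (hg : Per g)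
    (hh : Per h) : qq lam w (fun x => f x + g x) h = qq lam w f h + qq lam w g h := by
  unfold qq
  have := hf.cont
  have := hg.cont
  have := hh.cont
  have := Wf_cont (N := N) hw
  have e : (II fun x => Wf w x * ((f x + g x) * h x)) = (II fun x => Wf w x * (f x * h x)) +
      II fun x => Wf w x * (g x * h x) := by
    rw [← II_add (by fun_prop) (by fun_prop)]
    exact II_congr fun x => by ring
  rw [TT_add_left hf hg hh, e]; ring

lemma qq_cmul_left (lam : ℝ) {f h : Cfg d N → ℝ} (c : ℝ) (hf : Per f) :
    qq lam w (fun x => c * f x) h = c * qq lam w f h := by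
  unfold qq
  have e : (II fun x => Wf w x * (c * f x * h x)) = c * (II fun x => Wf w x * (f x * h x)) := by
    rw [← II_cmul]
    exact II_congr fun x => by ring
  rw [TT_cmul_left c hf, e]; ring

lemma qq_zero_left (lam : ℝ) {h : Cfg d N → ℝ} : qq lam w (fun _ => 0) h = 0 := by
  simp [qq, TT, pd_const, II_const]

lemma qq_sum_left (hw : Wok w B) (lam : ℝ) {ι : Type} (s : Finset ι) {f : ι → Cfg d N → ℝ}
    {h : Cfg d N → ℝ} (hf : ∀ i, Per (f i)) (hh : Per h) :
    qq lam w (fun x => ∑ i ∈ s, f i x) h = ∑ i ∈ s, qq lam w (f i) h := by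
  classical
  induction s using Finset.induction_on with
  | empty => simp [qq_zero_left]
  | insert a s ha ih =>
    simp only [Finset.sum_insert ha]
    rw [qq_add_left hw lam (hf a) (Per.sum fun i _ => hf i) hh, ih]

lemma qq_sub_left (hw : Wok w B) (lam : ℝ) {f g h : Cfg d N → ℝ} (hf : Per f) (hg : Per g)
    (hh : Per h) : qq lam w (fun x => f x - g x) h = qq lam w f h - qq lam w g h := by
  have e : (fun x => f x - g x) = fun x => f x + (-1) * g x := by funext x; ring
  rw [e, qq_add_left hw lam hf (hg.cmul _) hh, qq_cmul_left lam _ hg]; ring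

lemma qq_lower (hw : Wok w B) {lam : ℝ} (hl : 0 ≤ lam) {f : Cfg d N → ℝ} (hf : Continuous f) :
    TT f f - lam * (N * B / 2) * n2 f ≤ qq lam w f f := by
  unfold qq
  have := Wf_cont (N := N) hw
  have h1 : -(N * B / 2) * n2 f ≤ II fun x => Wf w x * (f x * f x) := by
    unfold n2
    rw [← II_cmul]
    refine II_mono (by fun_prop) (by fun_prop) fun x => ?_
    have := Wf_lower hw x
    nlinarith [sq_nonneg (f x)]
  nlinarith

/-- number of excitations -/
def M1 (f : Cfg d N → ℝ) : ℝ := ∑ k, n2 (Qp k f)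

lemma M1_nonneg (f : Cfg d N → ℝ) : 0 ≤ M1 f := Finset.sum_nonneg fun _ _ => n2_nonneg _

lemma M1_le_TT {f : Cfg d N → ℝ} (hf : Per f) : M1 f ≤ TT f f := by
  unfold M1 TT
  refine Finset.sum_le_sum fun k _ => ?_
  have := poincare_k k hf
  simpa [n2, pow_two] using this

/-! symmetric functions -/

/-- smooth periodic symmetric functions -/
structure Sm (f : Cfg d N → ℝ) : Prop where
  toPer : Per f
  symm : ∀ (σ : Equiv.Perm (Fin N)) (x : Cfg d N), f (x ∘ σ) = f x

lemma Sm.const (c : ℝ) : Sm (fun _ : Cfg d N => c) := ⟨Per.const c, fun _ _ => rfl⟩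

lemma Sm.add {f g : Cfg d N → ℝ} (hf : Sm f) (hg : Sm g) : Sm (fun x => f x + g x) :=
  ⟨hf.toPer.add hg.toPer, fun σ x => by rw [hf.symm, hg.symm]⟩

lemma Sm.sub {f g : Cfg d N → ℝ} (hf : Sm f) (hg : Sm g) : Sm (fun x => f x - g x) :=
  ⟨hf.toPer.sub hg.toPer, fun σ x => by rw [hf.symm, hg.symm]⟩

lemma Sm.mul {f g : Cfg d N → ℝ} (hf : Sm f) (hg : Sm g) : Sm (fun x => f x * g x) :=
  ⟨hf.toPer.mul hg.toPer, fun σ x => by rw [hf.symm, hg.symm]⟩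

lemma Sm.cmul {f : Cfg d N → ℝ} (c : ℝ) (hf : Sm f) : Sm (fun x => c * f x) :=
  (Sm.const c).mul hf

lemma Sm.exp {f : Cfg d N → ℝ} (hf : Sm f) : Sm (fun x => Real.exp (f x)) :=
  ⟨hf.toPer.exp, fun σ x => by rw [hf.symm]⟩

lemma Sm.sum {ι : Type} {s : Finset ι} {f : ι → Cfg d N → ℝ} (hf : ∀ i ∈ s, Sm (f i)) :
    Sm (fun x => ∑ i ∈ s, f i x) :=
  ⟨Per.sum fun i hi => (hf i hi).toPer, fun σ x =>
    Finset.sum_congr rfl fun i hi => (hf i hi).symm σ x⟩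

lemma Sm.Pop_perm {f : Cfg d N → ℝ} (hf : Sm f) (k : Fin N) (σ : Equiv.Perm (Fin N))
    (x : Cfg d N) : Pop k f (x ∘ σ) = Pop (σ k) f x := by
  unfold Pop
  congr 1; funext z
  rw [← hf.symm σ (Function.update x (σ k) z)]
  congr 1
  funext j
  by_cases h : j = k
  · subst h; simp
  · have : σ j ≠ σ k := fun h' => h (σ.injective h')
    simp [h, this]

lemma Sm.n0 {f : Cfg d N → ℝ} (hf : Sm f) : Sm (fun x => ∑ k, Pop k f x) :=
  ⟨Per.sum fun k _ => hf.toPer.Pop k, fun σ x => by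
    simp only [hf.Pop_perm]
    exact Equiv.sum_comp σ fun k => Pop k f x⟩

end forms

/-! ## Part E: adding and removing a particle -/

section addrem
variable {d n : ℕ} {w : (Fin d → ℝ) → ℝ} {B : ℝ}

/-- `rem` as a continuous linear map. -/
def remL (k : Fin (n + 1)) : Cfg d (n + 1) →L[ℝ] Cfg d n where
  toFun := rem k
  map_add' := fun _ _ => rfl
  map_smul' := fun _ _ => rfl
  cont := continuous_rem k

lemma remL_apply (k : Fin (n + 1)) (x : Cfg d (n + 1)) : remL k x = rem k x := rfl

lemma rem_upd_same (k : Fin (n + 1)) (x : Cfg d (n + 1)) (z : Fin d → ℝ) :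
    rem k (Function.update x k z) = rem k x := by
  funext j; simp [rem, Fin.succAbove_ne]

lemma rem_upd_succAbove (k : Fin (n + 1)) (j : Fin n) (x : Cfg d (n + 1)) (z : Fin d → ℝ) :
    rem k (Function.update x (k.succAbove j) z) = Function.update (rem k x) j z := by
  funext l
  unfold rem
  by_cases h : l = j
  · subst h; simp
  · rw [Function.update_of_ne h, Function.update_of_ne]
    exact fun h' => h (Fin.succAbove_right_injective h')

lemma Per.rem {g : Cfg d n → ℝ} (hg : Per g) (k : Fin (n + 1)) : Per (fun x => g (rem k x)) := by
  refine ⟨hg.smooth.comp (remL k).contDiff, fun x j v => ?_⟩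
  rcases Fin.eq_self_or_eq_succAbove k j with rfl | ⟨i, rfl⟩
  · rw [rem_upd_same]
  · rw [rem_upd_succAbove]
    exact hg.per (_root_.rem k x) i v

lemma pd_rem {g : Cfg d n → ℝ} (hg : Per g) (k : Fin (n + 1)) (j : Fin n) (i : Fin d)
    (x : Cfg d (n + 1)) :
    pd (k.succAbove j) i (fun x => g (rem k x)) x = pd j i g (rem k x) := by
  have hi : HasFDerivAt (fun x : Cfg d (n + 1) => rem k x) (remL k) x := (remL k).hasFDerivAt
  have := HasFDerivAt.comp x (hg.diff (rem k x)).hasFDerivAt hi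
  unfold pd
  rw [show (fun x => g (rem k x)) = g ∘ fun x => rem k x from rfl, this.fderiv]
  simp only [ContinuousLinearMap.comp_apply, remL_apply]
  congr 1
  funext l
  unfold rem
  by_cases h : l = j
  · subst h; simp
  · rw [Pi.single_eq_of_ne h, Pi.single_eq_of_ne]
    exact fun h' => h (Fin.succAbove_right_injective h')

lemma pd_rem_self {g : Cfg d n → ℝ} (hg : Per g) (k : Fin (n + 1)) (i : Fin d)
    (x : Cfg d (n + 1)) : pd k i (fun x => g (rem k x)) x = 0 :=
  pd_indep i (hg.rem k) (fun x z => by rw [rem_upd_same]) x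

lemma II_rem {g : Cfg d n → ℝ} (hg : Continuous g) (k : Fin (n + 1)) :
    (II fun x => g (rem k x)) = II g := by
  rw [fubini_cfg k (f := fun x => g (rem k x)) (hg.comp (continuous_rem k))]
  simp [II]

lemma n2_rem {g : Cfg d n → ℝ} (hg : Continuous g) (k : Fin (n + 1)) :
    (n2 fun x => g (rem k x)) = n2 g := II_rem (g := fun y => g y ^ 2) (by fun_prop) k

lemma TT_rem {g h : Cfg d n → ℝ} (hg : Per g) (hh : Per h) (k : Fin (n + 1)) :
    TT (fun x => g (rem k x)) (fun x => h (rem k x)) = TT g h := by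
  unfold TT
  rw [Fin.sum_univ_succAbove _ k]
  have e0 : (∑ i, II fun x => pd k i (fun x => g (rem k x)) x * pd k i (fun x => h (rem k x)) x)
      = 0 := by simp [pd_rem_self hg, II_const]
  rw [e0, zero_add]
  refine Finset.sum_congr rfl fun j _ => Finset.sum_congr rfl fun i _ => ?_
  have := hg.pdc j i
  have := hh.pdc j i
  rw [← II_rem (by fun_prop) k]
  exact II_congr fun x => by rw [pd_rem hg, pd_rem hh]

lemma IIW_rem (hw : Wok w B) {g : Cfg d n → ℝ} (hg : Continuous g) (k : Fin (n + 1)) :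
    (II fun x => Wf w x * g (rem k x)) = II fun x => Wf w x * g x := by
  have c : Continuous fun x : Cfg d (n + 1) => g (rem k x) := hg.comp (continuous_rem k)
  rw [II_Wf hw c, II_Wf hw hg]
  congr 1
  have hk : ∀ l, (II fun x => pw w k l x * g (rem k x)) = 0 := fun l =>
    pw_mean hw c fun x z => by rw [rem_upd_same]
  have hk' : ∀ l, (II fun x => pw w l k x * g (rem k x)) = 0 := fun l => by
    rw [pw_comm hw]; exact hk l
  rw [Fin.sum_univ_succAbove _ k]
  simp only [hk, Finset.sum_const_zero, zero_add]
  refine Finset.sum_congr rfl fun j _ => ?_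
  rw [Fin.sum_univ_succAbove _ k, hk', zero_add]
  refine Finset.sum_congr rfl fun l _ => ?_
  have := pw_cont hw j l
  rw [← II_rem (by fun_prop) k]
  refine II_congr fun x => ?_
  congr 1
  unfold pw rem
  simp

lemma qq_rem (hw : Wok w B) (lam : ℝ) {g h : Cfg d n → ℝ} (hg : Per g) (hh : Per h)
    (k : Fin (n + 1)) :
    qq lam w (fun x => g (rem k x)) (fun x => h (rem k x)) = qq lam w g h := by
  unfold qq
  have := hg.cont
  have := hh.cont
  rw [TT_rem hg hh, ← IIW_rem hw (g := fun x => g x * h x) (by fun_prop) k]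

lemma exists_perm {M : ℕ} (k : Fin (M + 1)) (e : Fin M → Fin (M + 1))
    (he : Function.Injective e) (hk : ∀ j, e j ≠ k) :
    ∃ τ : Equiv.Perm (Fin M), ∀ j, e j = k.succAbove (τ j) := by
  choose t ht using fun j => Fin.exists_succAbove_eq (hk j)
  have hinj : Function.Injective t := by
    intro a b hab
    apply he
    rw [← ht a, ← ht b, hab]
  exact ⟨Equiv.ofBijective t (Finite.injective_iff_bijective.1 hinj), fun j => (ht j).symm⟩

lemma Per.Rop {f : Cfg d (n + 1) → ℝ} (hf : Per f) (k : Fin (n + 1)) : Per (Rop (nu d) k f) := by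
  refine ⟨Rop_contDiff k hf.smooth, fun y j v => ?_⟩
  unfold _root_.Rop
  congr 1; funext z
  rw [← hf.per (ins k z y) (k.succAbove j) v]
  congr 1
  funext l
  rcases Fin.eq_self_or_eq_succAbove k l with rfl | ⟨i, rfl⟩
  · simp [(Fin.succAbove_ne _ _).symm]
  · by_cases h : i = j
    · subst h; simp
    · have : k.succAbove i ≠ k.succAbove j := fun h' => h (Fin.succAbove_right_injective h')
      simp [h, this]

lemma Sm.Rop {f : Cfg d (n + 1) → ℝ} (hf : Sm f) (k : Fin (n + 1)) : Sm (Rop (nu d) k f) := by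
  refine ⟨hf.toPer.Rop k, fun σ y => ?_⟩
  unfold _root_.Rop
  congr 1; funext z
  let σ' : Equiv.Perm (Fin (n + 1)) :=
    (finSuccEquiv' k).trans ((Equiv.optionCongr σ).trans (finSuccEquiv' k).symm)
  rw [← hf.symm σ' (ins k z y)]
  congr 1
  funext l
  rcases Fin.eq_self_or_eq_succAbove k l with rfl | ⟨i, rfl⟩
  · simp [σ']
  · simp [σ']

lemma Rop_rem (f : Cfg d (n + 1) → ℝ) (k : Fin (n + 1)) (x : Cfg d (n + 1)) :
    Rop (nu d) k f (rem k x) = Pop k f x := by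
  unfold Rop Pop
  simp only [ins_rem]

lemma Rop_ins (f : Cfg d (n + 1) → ℝ) (k : Fin (n + 1)) (x : Fin d → ℝ) (y : Cfg d n) :
    Pop k f (ins k x y) = Rop (nu d) k f y := by
  rw [← Rop_rem, rem_ins]

/-- the trial state with one particle added in the condensate -/
def Phi (g : Cfg d n → ℝ) : Cfg d (n + 1) → ℝ := fun x => ∑ k, g (rem k x)

lemma Sm.Phi {g : Cfg d n → ℝ} (hg : Sm g) : Sm (Phi g) := by
  refine ⟨Per.sum fun k _ => hg.toPer.rem k, fun σ x => ?_⟩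
  unfold _root_.Phi
  rw [← Equiv.sum_comp σ fun k => g (rem k x)]
  refine Finset.sum_congr rfl fun k _ => ?_
  obtain ⟨τ, hτ⟩ := exists_perm (σ k) (fun j => σ (k.succAbove j))
    (σ.injective.comp Fin.succAbove_right_injective)
    (fun j h => Fin.succAbove_ne k j (σ.injective h))
  rw [← hg.symm τ (rem (σ k) x)]
  congr 1
  funext j
  simp [rem, hτ]

lemma Phi_ins {g : Cfg d n → ℝ} (hg : Sm g) (k : Fin (n + 1)) (x : Fin d → ℝ) (y : Cfg d n) :
    Phi g (ins k x y) = g y + ∑ j, g (Function.update y j x) := by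
  unfold Phi
  rw [Fin.sum_univ_succAbove _ k, rem_ins]
  congr 1
  refine Finset.sum_congr rfl fun j _ => ?_
  obtain ⟨τ, hτ⟩ := exists_perm (k.succAbove j) (fun i => if i = j then k else k.succAbove i)
    (by
      intro a b hab
      simp only at hab
      split_ifs at hab with h1 h2 h2
      · rw [h1, h2]
      · exact absurd hab.symm (Fin.succAbove_ne k b)
      · exact absurd hab (Fin.succAbove_ne k a)
      · exact Fin.succAbove_right_injective hab)
    (by
      intro i h
      split_ifs at h with h1
      · exact (Fin.succAbove_ne k j) h.symm
      · exact h1 (Fin.succAbove_right_injective h))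
  rw [← hg.symm τ]
  congr 1
  funext i
  simp only [Function.comp, rem]
  rw [← hτ]
  by_cases h : i = j
  · subst h; simp
  · simp [h]

lemma Rop_Phi {g : Cfg d n → ℝ} (hg : Sm g) (k : Fin (n + 1)) (y : Cfg d n) :
    Rop (nu d) k (Phi g) y = g y + ∑ j, Pop j g y := by
  unfold Rop
  simp only [Phi_ins hg]
  have c := hg.toPer.cont
  rw [integral_add (integrable_const _) (CSM.integrable (by fun_prop)), integral_finsetSum]
  · simp [Pop]
  · intro i _
    exact CSM.integrable (by fun_prop)

end addrem

/-! ## Part F: ground state energy -/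

section gse
variable {d N : ℕ} {w : (Fin d → ℝ) → ℝ} {B : ℝ}

lemma Wf_eq (hev : ∀ x, w (-x) = w x) (x : Cfg d N) :
    (∑ j : Fin N, ∑ k : Fin N, if j < k then w (x j - x k) else 0) = Wf w x := by
  unfold Wf
  have h1 : ∑ j, ∑ k, pw w j k x =
      (∑ j : Fin N, ∑ k : Fin N, if j < k then w (x j - x k) else 0) +
      ∑ j : Fin N, ∑ k : Fin N, if k < j then w (x j - x k) else 0 := by
    rw [← Finset.sum_add_distrib]
    refine Finset.sum_congr rfl fun j _ => ?_
    rw [← Finset.sum_add_distrib]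
    refine Finset.sum_congr rfl fun k _ => ?_
    unfold pw
    rcases lt_trichotomy j k with h | h | h
    · simp [h, h.ne, not_lt.2 h.le]
    · simp [h]
    · simp [h, h.ne', not_lt.2 h.le]
  have h2 : (∑ j : Fin N, ∑ k : Fin N, if k < j then w (x j - x k) else 0) =
      ∑ j : Fin N, ∑ k : Fin N, if j < k then w (x j - x k) else 0 := by
    rw [Finset.sum_comm]
    refine Finset.sum_congr rfl fun j _ => Finset.sum_congr rfl fun k _ => ?_
    rw [← hev (x j - x k), neg_sub]
  rw [h1, h2]; ring

/-- `n2` of complex functions -/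
lemma re_Per {Ψ : Cfg d N → ℂ} (hs : ContDiff ℝ (⊤ : ℕ∞) Ψ)
    (hp : ∀ (x : Cfg d N) (j : Fin N) (v : Fin d → ℤ),
      Ψ (Function.update x j (x j + fun i => (v i : ℝ))) = Ψ x) :
    Per (fun x => (Ψ x).re) :=
  ⟨Complex.reCLM.contDiff.comp hs, fun x j v => by rw [hp]⟩

lemma im_Per {Ψ : Cfg d N → ℂ} (hs : ContDiff ℝ (⊤ : ℕ∞) Ψ)
    (hp : ∀ (x : Cfg d N) (j : Fin N) (v : Fin d → ℤ),
      Ψ (Function.update x j (x j + fun i => (v i : ℝ))) = Ψ x) :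
    Per (fun x => (Ψ x).im) :=
  ⟨Complex.imCLM.contDiff.comp hs, fun x j v => by rw [hp]⟩

lemma pd_re {Ψ : Cfg d N → ℂ} (hs : ContDiff ℝ (⊤ : ℕ∞) Ψ) (j : Fin N) (i : Fin d) (x : Cfg d N) :
    pd j i (fun x => (Ψ x).re) x = (fderiv ℝ Ψ x (Pi.single j (Pi.single i 1))).re := by
  have h1 := (hs.differentiable (by simp) x).hasFDerivAt
  have h2 := (Complex.reCLM.hasFDerivAt (x := Ψ x)).comp x h1
  unfold pd
  rw [show (fun x => (Ψ x).re) = Complex.reCLM ∘ Ψ from rfl, h2.fderiv]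
  rfl

lemma pd_im {Ψ : Cfg d N → ℂ} (hs : ContDiff ℝ (⊤ : ℕ∞) Ψ) (j : Fin N) (i : Fin d) (x : Cfg d N) :
    pd j i (fun x => (Ψ x).im) x = (fderiv ℝ Ψ x (Pi.single j (Pi.single i 1))).im := by
  have h1 := (hs.differentiable (by simp) x).hasFDerivAt
  have h2 := (Complex.imCLM.hasFDerivAt (x := Ψ x)).comp x h1
  unfold pd
  rw [show (fun x => (Ψ x).im) = Complex.imCLM ∘ Ψ from rfl, h2.fderiv]
  rfl

lemma normSq_re_im (z : ℂ) : ‖z‖ ^ 2 = z.re ^ 2 + z.im ^ 2 := by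
  rw [← Complex.normSq_eq_norm_sq, Complex.normSq_apply]; ring

lemma TT_II {f g : Cfg d N → ℝ} (hf : Per f) (hg : Per g) :
    TT f g = II fun x => ∑ j, ∑ i, pd j i f x * pd j i g x := by
  have c1 := fun j i => hf.pdc j i
  have c2 := fun j i => hg.pdc j i
  unfold TT
  rw [II_sum fun j _ => by fun_prop]
  refine Finset.sum_congr rfl fun j _ => ?_
  rw [II_sum fun i _ => by fun_prop]

lemma energy_split (hw : Wok w B) (lam : ℝ) {Ψ : Cfg d N → ℂ} (hs : ContDiff ℝ (⊤ : ℕ∞) Ψ)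
    (hp : ∀ (x : Cfg d N) (j : Fin N) (v : Fin d → ℤ),
      Ψ (Function.update x j (x j + fun i => (v i : ℝ))) = Ψ x) :
    energy d N lam w Ψ = qq lam w (fun x => (Ψ x).re) (fun x => (Ψ x).re) +
      qq lam w (fun x => (Ψ x).im) (fun x => (Ψ x).im) := by
  have hr := re_Per hs hp
  have hi := im_Per hs hp
  have c1 := fun j i => hr.pdc j i
  have c2 := fun j i => hi.pdc j i
  have c3 := hr.cont
  have c4 := hi.cont
  have cW := Wf_cont (N := N) hw
  unfold energy qq
  rw [mu_eq, TT_II hr hr, TT_II hi hi, ← II_cmul, ← II_cmul,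
    ← II_add (by fun_prop) (by fun_prop), ← II_add (by fun_prop) (by fun_prop),
    ← II_add (by fun_prop) (by fun_prop)]
  refine II_congr fun x => ?_
  rw [Wf_eq hw.even, normSq_re_im]
  have : (∑ j : Fin N, ∑ i : Fin d, ‖fderiv ℝ Ψ x (Pi.single j (Pi.single i 1))‖ ^ 2) =
      (∑ j, ∑ i, pd j i (fun x => (Ψ x).re) x * pd j i (fun x => (Ψ x).re) x) +
      ∑ j, ∑ i, pd j i (fun x => (Ψ x).im) x * pd j i (fun x => (Ψ x).im) x := by
    simp only [← Finset.sum_add_distrib]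
    refine Finset.sum_congr rfl fun j _ => Finset.sum_congr rfl fun i _ => ?_
    rw [normSq_re_im, pd_re hs, pd_im hs]; ring
  rw [this]; ring

lemma norm_split {Ψ : Cfg d N → ℂ} (hs : ContDiff ℝ (⊤ : ℕ∞) Ψ) :
    (∫ x in cube d N, ‖Ψ x‖ ^ 2) = n2 (fun x => (Ψ x).re) + n2 (fun x => (Ψ x).im) := by
  have c1 : Continuous fun x => (Ψ x).re := Complex.continuous_re.comp hs.continuous
  have c2 : Continuous fun x => (Ψ x).im := Complex.continuous_im.comp hs.continuous
  unfold n2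
  rw [mu_eq, ← II_add (by fun_prop) (by fun_prop)]
  exact II_congr fun x => normSq_re_im _

lemma energy_lower (hw : Wok w B) {lam : ℝ} (hl : 0 ≤ lam) {Ψ : Cfg d N → ℂ}
    (h : IsAdmissible d N Ψ) : -(lam * (N * B / 2)) ≤ energy d N lam w Ψ := by
  obtain ⟨hs, hp, _, hn⟩ := h
  rw [energy_split hw lam hs hp]
  rw [norm_split hs] at hn
  have h1 := qq_lower hw hl (re_Per hs hp).cont
  have h2 := qq_lower hw hl (im_Per hs hp).cont
  have h3 := TT_nonneg fun x => (Ψ x).re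
  have h4 := TT_nonneg fun x => (Ψ x).im
  have : lam * (N * B / 2) * (n2 (fun x => (Ψ x).re) + n2 (fun x => (Ψ x).im)) =
    lam * (N * B / 2) := by rw [hn]; ring
  nlinarith

lemma GSE_bdd (hw : Wok w B) {lam : ℝ} (hl : 0 ≤ lam) :
    BddBelow {e | ∃ Ψ, IsAdmissible d N Ψ ∧ energy d N lam w Ψ = e} :=
  ⟨-(lam * (N * B / 2)), fun _ ⟨_, h, he⟩ => he ▸ energy_lower hw hl h⟩

lemma n2_cmul (c : ℝ) (f : Cfg d N → ℝ) : n2 (fun x => c * f x) = c ^ 2 * n2 f := by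
  unfold n2
  rw [← II_cmul]
  exact II_congr fun x => by ring

lemma qq_cmul (lam : ℝ) {f : Cfg d N → ℝ} (c : ℝ) (hf : Per f) :
    qq lam w (fun x => c * f x) (fun x => c * f x) = c ^ 2 * qq lam w f f := by
  rw [qq_cmul_left lam c hf, qq_comm, qq_cmul_left lam c hf]; ring

lemma ofReal_adm {f : Cfg d N → ℝ} (hf : Sm f) (h1 : n2 f = 1) :
    IsAdmissible d N fun x => (f x : ℂ) := by
  have hs : ContDiff ℝ (⊤ : ℕ∞) fun x => (f x : ℂ) :=
    Complex.ofRealCLM.contDiff.comp hf.toPer.smooth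
  refine ⟨hs, fun x j v => by simp only [hf.toPer.per], fun σ x => by simp only [hf.symm], ?_⟩
  rw [norm_split hs]
  have : n2 (fun _ : Cfg d N => (0 : ℝ)) = 0 := by simp [n2, II_const]
  simp [h1, this]

lemma ofReal_energy (hw : Wok w B) (lam : ℝ) {f : Cfg d N → ℝ} (hf : Sm f) :
    energy d N lam w (fun x => (f x : ℂ)) = qq lam w f f := by
  have hs : ContDiff ℝ (⊤ : ℕ∞) fun x => (f x : ℂ) :=
    Complex.ofRealCLM.contDiff.comp hf.toPer.smooth
  rw [energy_split hw lam hs (fun x j v => by rw [hf.toPer.per])]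
  simp [qq_zero_left]

lemma GSE_le1 (hw : Wok w B) {lam : ℝ} (hl : 0 ≤ lam) {f : Cfg d N → ℝ} (hf : Sm f)
    (h1 : n2 f = 1) : GSE d N lam w ≤ qq lam w f f :=
  csInf_le (GSE_bdd hw hl) ⟨_, ofReal_adm hf h1, ofReal_energy hw lam hf⟩

lemma GSE_le (hw : Wok w B) {lam : ℝ} (hl : 0 ≤ lam) {f : Cfg d N → ℝ} (hf : Sm f) :
    GSE d N lam w * n2 f ≤ qq lam w f f := by
  rcases (n2_nonneg f).eq_or_lt with h0 | h0
  · have := qq_lower hw hl hf.toPer.cont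
    have := TT_nonneg f
    rw [← h0] at *
    linarith
  · have hs : √(n2 f) ≠ 0 := (Real.sqrt_pos.2 h0).ne'
    have e : (√(n2 f))⁻¹ ^ 2 = (n2 f)⁻¹ := by rw [inv_pow, Real.sq_sqrt h0.le]
    have := GSE_le1 hw hl (hf.cmul (√(n2 f))⁻¹) (by
      rw [n2_cmul, e, inv_mul_cancel₀ h0.ne'])
    rw [qq_cmul lam _ hf.toPer, e] at this
    rwa [inv_mul_eq_div, le_div_iff₀ h0] at this

lemma n2_one : n2 (fun _ : Cfg d N => (1 : ℝ)) = 1 := by simp [n2, II_const]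

lemma GSE_nonempty (w : (Fin d → ℝ) → ℝ) (lam : ℝ) :
    {e | ∃ Ψ, IsAdmissible d N Ψ ∧ energy d N lam w Ψ = e}.Nonempty :=
  ⟨_, _, ofReal_adm (Sm.const 1) n2_one, rfl⟩

lemma IIW_zero (hw : Wok w B) : (II fun x : Cfg d N => Wf w x) = 0 := by
  have h1 := II_Wf (N := N) hw (g := fun _ => 1) continuous_const
  simp only [mul_one] at h1
  have h2 : ∀ j k : Fin N, (II fun x => pw w j k x) = 0 := by
    intro j k
    have := pw_mean (N := N) hw (k := j) (j := k) (g := fun _ => 1) continuous_const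
      (fun _ _ => rfl)
    simpa using this
  rw [h1]
  have : ∀ j k : Fin N, II (pw w j k) = 0 := h2
  simp [this]

lemma GSE_nonpos (hw : Wok w B) {lam : ℝ} (hl : 0 ≤ lam) : GSE d N lam w ≤ 0 := by
  have := GSE_le1 (N := N) hw hl (Sm.const 1) n2_one
  refine this.trans (le_of_eq ?_)
  simp [qq, TT, pd_const, II_const, IIW_zero hw]

lemma exists_min (hw : Wok w B) {lam : ℝ} (hl : 0 ≤ lam) {ε : ℝ} (hε : 0 < ε) :
    ∃ f : Cfg d N → ℝ, Sm f ∧ n2 f = 1 ∧ qq lam w f f ≤ GSE d N lam w + ε := by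
  set E := GSE d N lam w with hE
  have key : ∃ f : Cfg d N → ℝ, Sm f ∧ 0 < n2 f ∧ qq lam w f f ≤ (E + ε) * n2 f := by
    obtain ⟨e, ⟨Ψ, ⟨hs, hp, hsy, hn⟩, rfl⟩, hlt⟩ :=
      exists_lt_of_csInf_lt (GSE_nonempty (N := N) w lam)
        (lt_add_of_pos_right (GSE d N lam w) hε)
    rw [energy_split hw lam hs hp] at hlt
    rw [norm_split hs] at hn
    have hr : Sm fun x => (Ψ x).re := ⟨re_Per hs hp, fun σ x => by rw [hsy]⟩
    have hi : Sm fun x => (Ψ x).im := ⟨im_Per hs hp, fun σ x => by rw [hsy]⟩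
    set f := fun x => (Ψ x).re with hf
    set g := fun x => (Ψ x).im with hg
    have hfE := GSE_le hw hl hr
    have hgE := GSE_le hw hl hi
    by_cases h1 : 0 < n2 f ∧ qq lam w f f ≤ (E + ε) * n2 f
    · exact ⟨f, hr, h1⟩
    by_cases h2 : 0 < n2 g ∧ qq lam w g g ≤ (E + ε) * n2 g
    · exact ⟨g, hi, h2⟩
    exfalso
    have p1 := n2_nonneg f
    have p2 := n2_nonneg g
    have a1 : (E + ε) * n2 f ≤ qq lam w f f := by
      rcases p1.eq_or_lt with h0 | h0
      · rw [← h0] at hfE ⊢; linarith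
      · exact (not_le.1 fun h => h1 ⟨h0, h⟩).le
    have a2 : (E + ε) * n2 g ≤ qq lam w g g := by
      rcases p2.eq_or_lt with h0 | h0
      · rw [← h0] at hgE ⊢; linarith
      · exact (not_le.1 fun h => h2 ⟨h0, h⟩).le
    have : (E + ε) * (n2 f + n2 g) = E + ε := by rw [hn]; ring
    nlinarith
  obtain ⟨f, hf, h0, hq⟩ := key
  have e : (√(n2 f))⁻¹ ^ 2 = (n2 f)⁻¹ := by rw [inv_pow, Real.sq_sqrt h0.le]
  refine ⟨fun x => (√(n2 f))⁻¹ * f x, hf.cmul _, ?_, ?_⟩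
  · rw [n2_cmul, e, inv_mul_cancel₀ h0.ne']
  · rw [qq_cmul lam _ hf.toPer, e]
    rwa [inv_mul_eq_div, div_le_iff₀ h0]

/-- near minimizers -/
structure NM (lam : ℝ) (w : (Fin d → ℝ) → ℝ) (ε : ℝ) (f : Cfg d N → ℝ) : Prop where
  sm : Sm f
  nrm : n2 f = 1
  le : qq lam w f f ≤ GSE d N lam w + ε

lemma eps_lemma (hw : Wok w B) {lam : ℝ} (hl : 0 ≤ lam) {ε : ℝ} {f : Cfg d N → ℝ}
    (hf : NM lam w ε f) {χ : Cfg d N → ℝ} (hχ : Sm χ) :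
    (qq lam w χ f - GSE d N lam w * II fun x => χ x * f x) ^ 2 ≤
      ε * (qq lam w χ χ - GSE d N lam w * n2 χ) := by
  set E := GSE d N lam w with hE
  have c1 := hf.sm.toPer.cont
  have c2 := hχ.toPer.cont
  have key : ∀ t : ℝ, 0 ≤ (qq lam w χ χ - E * n2 χ) * (t * t) +
      (2 * (qq lam w χ f - E * II fun x => χ x * f x)) * t + (qq lam w f f - E * n2 f) := by
    intro t
    have hg : Sm fun x => t * χ x + f x := (hχ.cmul t).add hf.sm
    have h1 := GSE_le hw hl hg
    have h2 : n2 (fun x => t * χ x + f x) =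
        t ^ 2 * n2 χ + (2 * t) * (II fun x => χ x * f x) + n2 f := by
      unfold n2
      rw [← II_cmul, ← II_cmul, ← II_add (by fun_prop) (by fun_prop),
        ← II_add (by fun_prop) (by fun_prop)]
      exact II_congr fun x => by ring
    have h3 : qq lam w (fun x => t * χ x + f x) (fun x => t * χ x + f x) =
        t ^ 2 * qq lam w χ χ + 2 * t * qq lam w χ f + qq lam w f f := by
      rw [qq_add_left hw lam (hχ.cmul t).toPer hf.sm.toPer hg.toPer,
        qq_comm lam _ (fun x => t * χ x + f x), qq_comm lam _ (fun x => t * χ x + f x),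
        qq_add_left hw lam (hχ.cmul t).toPer hf.sm.toPer (hχ.cmul t).toPer,
        qq_add_left hw lam (hχ.cmul t).toPer hf.sm.toPer hf.sm.toPer,
        qq_cmul lam t hχ.toPer, qq_cmul_left lam t hχ.toPer,
        qq_comm lam f (fun x => t * χ x), qq_cmul_left lam t hχ.toPer]
      ring
    rw [h2, h3] at h1
    nlinarith
  have h := discrim_le_zero key
  unfold discrim at h
  have h0 := hf.le
  have h1 := hf.nrm
  have h2 : 0 ≤ qq lam w χ χ - E * n2 χ := by
    have := GSE_le hw hl hχ
    linarith
  rw [h1] at h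
  have h4 : qq lam w f f - E * 1 ≤ ε := by linarith
  nlinarith [mul_le_mul_of_nonneg_left h4 h2]

end gse

/-! ## Part G: estimates for near minimizers -/

section nm
variable {d N : ℕ} {w : (Fin d → ℝ) → ℝ} {B : ℝ}

/-- condensate-depletion interaction term -/
def DD (w : (Fin d → ℝ) → ℝ) (f : Cfg d N → ℝ) : ℝ :=
  ∑ k, ∑ l, II fun x => pw w k l x * (f x * Pop k f x)

/-- potential energy -/
def VV (w : (Fin d → ℝ) → ℝ) (f : Cfg d N → ℝ) : ℝ := II fun x => Wf w x * (f x * f x)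

/-- second moment of the number of excitations -/
def M2 (f : Cfg d N → ℝ) : ℝ := ∑ k, M1 (Qp k f)

lemma NM.TT_le (hw : Wok w B) {lam : ℝ} (hl : 0 ≤ lam) {ε : ℝ} {f : Cfg d N → ℝ}
    (hf : NM lam w ε f) : TT f f ≤ lam * (N * B / 2) + ε := by
  have h1 := qq_lower hw hl hf.sm.toPer.cont
  have h2 := hf.le
  have h3 := GSE_nonpos (N := N) hw hl
  rw [hf.nrm] at h1
  linarith

lemma GSE_lower (hw : Wok w B) {lam : ℝ} (hl : 0 ≤ lam) :
    -(lam * (N * B / 2)) ≤ GSE d N lam w :=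
  le_csInf (GSE_nonempty w lam) fun _ ⟨_, h, he⟩ => he ▸ energy_lower hw hl h

lemma Wf_upper (hw : Wok w B) (x : Cfg d N) : |Wf w x| ≤ N ^ 2 * B := by
  unfold Wf
  rw [abs_mul]
  have h : |∑ j, ∑ k, pw w j k x| ≤ ∑ _j : Fin N, ∑ _k : Fin N, B :=
    (Finset.abs_sum_le_sum_abs _ _).trans (Finset.sum_le_sum fun j _ =>
      (Finset.abs_sum_le_sum_abs _ _).trans (Finset.sum_le_sum fun k _ => pw_bnd hw j k x))
  simp only [Finset.sum_const, Finset.card_univ, Fintype.card_fin, nsmul_eq_mul] at h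
  have h2 : |(1 / 2 : ℝ)| = 1 / 2 := by norm_num
  rw [h2]
  have := abs_nonneg (∑ j, ∑ k, pw w j k x)
  nlinarith

/-- crude upper bound on the shifted form -/
lemma b_upper (hw : Wok w B) {lam : ℝ} (hl : 0 ≤ lam) {χ : Cfg d N → ℝ} (hχ : Per χ) :
    qq lam w χ χ - GSE d N lam w * n2 χ ≤
      TT χ χ + (lam * (N ^ 2 * B) + lam * (N * B / 2)) * n2 χ := by
  have h1 := GSE_lower (N := N) hw hl
  have c := hχ.cont
  have cW := Wf_cont (N := N) hw
  have h2 : (II fun x => Wf w x * (χ x * χ x)) ≤ (N ^ 2 * B) * n2 χ := by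
    unfold n2
    rw [← II_cmul]
    refine II_mono (by fun_prop) (by fun_prop) fun x => ?_
    have := (abs_le.1 (Wf_upper hw x)).2
    nlinarith [sq_nonneg (χ x)]
  unfold qq
  have h3 := n2_nonneg χ
  nlinarith [mul_le_mul_of_nonneg_left h2 hl, mul_le_mul_of_nonneg_right h1 h3]

lemma TT_pyth (k : Fin N) {f : Cfg d N → ℝ} (hf : Per f) :
    TT f f = TT (Pop k f) (Pop k f) + TT (Qp k f) (Qp k f) := by
  have h1 := TT_Pop k hf (hf.Pop k) (fun x z => Pop_upd k f x z)
  have e : f = fun x => Pop k f x + Qp k f x := by funext x; unfold Qp; ring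
  have h2 : TT f f = TT (Pop k f) f + TT (Qp k f) f := by
    conv_lhs => rw [e]
    rw [TT_add_left (hf.Pop k) (hf.Qp k) ((hf.Pop k).add (hf.Qp k)), ← e]
  have h3 : TT f (Qp k f) = TT (Pop k f) (Qp k f) + TT (Qp k f) (Qp k f) := by
    have := TT_add_left (hf.Pop k) (hf.Qp k) (hf.Qp k)
    rw [← e] at this; exact this
  have h4 : TT f (Pop k f) = TT (Pop k f) (Pop k f) + TT (Qp k f) (Pop k f) := by
    have := TT_add_left (hf.Pop k) (hf.Qp k) (hf.Pop k)
    rw [← e] at this; exact this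
  rw [TT_comm (Pop k f) f, TT_comm (Qp k f) f] at h2
  rw [TT_comm (Pop k f) (Qp k f)] at h3
  linarith

lemma sq_sum_le_card {N : ℕ} (a : Fin N → ℝ) : (∑ k, a k) ^ 2 ≤ N * ∑ k, a k ^ 2 := by
  have := sq_sum_le_card_mul_sum_sq (s := Finset.univ) (f := a)
  simpa using this

lemma n0_TT {f : Cfg d N → ℝ} (hf : Per f) :
    TT (fun x => ∑ k, Pop k f x) (fun x => ∑ k, Pop k f x) ≤ N ^ 2 * TT f f := by
  have hP := fun k => hf.Pop k
  have hS : Per (fun x => ∑ k, Pop k f x) := Per.sum fun k _ => hP k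
  have h1 : ∀ j i, (II fun x => pd j i (fun x => ∑ k, Pop k f x) x *
      pd j i (fun x => ∑ k, Pop k f x) x) ≤
      N * ∑ k, II fun x => pd j i (Pop k f) x * pd j i (Pop k f) x := by
    intro j i
    have c1 := fun k => (hP k).pdc j i
    have c2 := hS.pdc j i
    rw [← II_sum (fun k _ => by have := c1 k; fun_prop), ← II_cmul]
    refine II_mono (by fun_prop) (by fun_prop) fun x => ?_
    rw [pd_sum (fun k _ => hP k)]
    have := sq_sum_le_card fun k => pd j i (Pop k f) x
    simpa [pow_two] using this
  have h2 : TT (fun x => ∑ k, Pop k f x) (fun x => ∑ k, Pop k f x) ≤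
      N * ∑ k, TT (Pop k f) (Pop k f) := by
    unfold TT
    calc _ ≤ ∑ j, ∑ i, (N : ℝ) * ∑ k, II fun x => pd j i (Pop k f) x * pd j i (Pop k f) x :=
          Finset.sum_le_sum fun j _ => Finset.sum_le_sum fun i _ => h1 j i
      _ = _ := by
          simp only [← Finset.mul_sum]
          congr 1
          rw [Finset.sum_comm' (s := Finset.univ) (t := fun _ => Finset.univ)
            (s' := fun _ => Finset.univ) (t' := Finset.univ) (by simp)]
          rw [Finset.sum_congr rfl fun i _ => Finset.sum_comm, Finset.sum_comm]
          refine Finset.sum_congr rfl fun k _ => Finset.sum_comm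
  have h3 : ∑ k, TT (Pop k f) (Pop k f) ≤ ∑ _k : Fin N, TT f f :=
    Finset.sum_le_sum fun k _ => by
      have := TT_pyth k hf
      have := TT_nonneg (Qp k f)
      linarith
  simp only [Finset.sum_const, Finset.card_univ, Fintype.card_fin, nsmul_eq_mul] at h3
  calc _ ≤ _ := h2
    _ ≤ N * (N * TT f f) := by gcongr
    _ = _ := by ring

lemma n0_n2 {f : Cfg d N → ℝ} (hf : Continuous f) :
    n2 (fun x => ∑ k, Pop k f x) ≤ N ^ 2 * n2 f := by
  have c := fun k => Pop_cont k hf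
  have h1 : n2 (fun x => ∑ k, Pop k f x) ≤ N * ∑ k, n2 (Pop k f) := by
    unfold n2
    rw [← II_sum (fun k _ => by have := c k; fun_prop), ← II_cmul]
    exact II_mono (by fun_prop) (by fun_prop) fun x => sq_sum_le_card _
  have h3 : ∑ k, n2 (Pop k f) ≤ ∑ _k : Fin N, n2 f :=
    Finset.sum_le_sum fun k _ => n2_Pop_le k hf
  simp only [Finset.sum_const, Finset.card_univ, Fintype.card_fin, nsmul_eq_mul] at h3
  calc _ ≤ _ := h1
    _ ≤ N * (N * n2 f) := by gcongr
    _ = _ := by ring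

lemma n0_inner {f : Cfg d N → ℝ} (hf : Continuous f) (h1 : n2 f = 1) :
    (II fun x => (∑ k, Pop k f x) * f x) = N - M1 f := by
  have c := fun k => Pop_cont k hf
  have e : (II fun x => (∑ k, Pop k f x) * f x) = ∑ k, II fun x => f x * Pop k f x := by
    rw [← II_sum (fun k _ => by have := c k; fun_prop)]
    exact II_congr fun x => by rw [Finset.sum_mul]; exact Finset.sum_congr rfl fun k _ => by ring
  rw [e]
  have : ∀ k, (II fun x => f x * Pop k f x) = 1 - n2 (Qp k f) := by
    intro k
    rw [II_f_Pop k hf]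
    have := pyth k hf
    linarith
  simp [this, M1, Finset.sum_sub_distrib]

/-- test function `n0 f` -/
lemma n0_trial_bound (hw : Wok w B) {lam : ℝ} (hl : 0 ≤ lam) :
    ∃ C : ℝ, ∀ ε, 0 < ε → ε ≤ 1 → ∀ f : Cfg d N → ℝ, NM lam w ε f →
      |qq lam w (fun x => ∑ k, Pop k f x) f - GSE d N lam w * (N - M1 f)| ≤ √(ε * C) := by
  refine ⟨N ^ 2 * (lam * (N * B / 2) + 1) + (lam * (N ^ 2 * B) + lam * (N * B / 2)) * N ^ 2, ?_⟩
  intro ε hε hε1 f hf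
  have h1 := eps_lemma hw hl hf hf.sm.n0
  rw [n0_inner hf.sm.toPer.cont hf.nrm] at h1
  rw [← Real.sqrt_sq_eq_abs]
  refine Real.sqrt_le_sqrt (h1.trans ?_)
  refine mul_le_mul_of_nonneg_left ?_ hε.le
  refine (b_upper hw hl hf.sm.n0.toPer).trans ?_
  have h2 := n0_TT hf.sm.toPer
  have h3 := n0_n2 hf.sm.toPer.cont
  have h4 := hf.TT_le hw hl
  rw [hf.nrm] at h3
  have hB := hw.B_nonneg
  have h5 : (0:ℝ) ≤ lam * (N ^ 2 * B) + lam * (N * B / 2) := by positivity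
  have h6 : (N : ℝ) ^ 2 * TT f f ≤ N ^ 2 * (lam * (N * B / 2) + 1) := by
    gcongr; linarith
  nlinarith [mul_le_mul_of_nonneg_left h3 h5]

/-- one term of DD -/
lemma DD_term (hw : Wok w B) (k l : Fin N) {f : Cfg d N → ℝ} (hf : Continuous f) :
    (II fun x => pw w k l x * (f x * Pop k f x)) =
      (1 / 2) * (II fun x => pw w k l x * (f x * f x)) -
      (1 / 2) * II fun x => pw w k l x * (Qp k f x * Qp k f x) := by
  have c := Pop_cont k hf
  have c' := Qp_cont k hf
  have cp := pw_cont hw k l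
  have h0 := pw_mean hw (k := k) (j := l) (g := fun x => Pop k f x * Pop k f x) (by fun_prop)
    (fun x z => by simp [Pop_upd])
  have e : (II fun x => pw w k l x * (Qp k f x * Qp k f x)) =
      (II fun x => pw w k l x * (f x * f x)) - 2 * (II fun x => pw w k l x * (f x * Pop k f x))
      + II fun x => pw w k l x * (Pop k f x * Pop k f x) := by
    rw [← II_cmul, ← II_sub (by fun_prop) (by fun_prop), ← II_add (by fun_prop) (by fun_prop)]
    exact II_congr fun x => by unfold Qp; ring
  rw [e, h0]; ring

lemma DD_eq (hw : Wok w B) {f : Cfg d N → ℝ} (hf : Continuous f) :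
    DD w f = VV w f -
      (1 / 2) * ∑ k, ∑ l, II fun x => pw w k l x * (Qp k f x * Qp k f x) := by
  unfold DD VV
  rw [II_Wf hw (by fun_prop)]
  simp only [DD_term hw _ _ hf, Finset.sum_sub_distrib, ← Finset.mul_sum]

lemma qq_Q (hw : Wok w B) (lam : ℝ) (k : Fin N) {f : Cfg d N → ℝ} (hf : Per f) :
    qq lam w (Qp k f) (Qp k f) = qq lam w f f - qq lam w (Pop k f) f -
      lam * ∑ l, II fun x => pw w k l x * (f x * Pop k f x) := by
  have h := qq_Pop hw lam k hf (hf.Pop k) (fun x z => Pop_upd k f x z)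
  have e1 : qq lam w (Qp k f) (Qp k f) = qq lam w f (Qp k f) - qq lam w (Pop k f) (Qp k f) :=
    qq_sub_left hw lam hf (hf.Pop k) (hf.Qp k)
  have e2 : qq lam w (Qp k f) f = qq lam w f f - qq lam w (Pop k f) f :=
    qq_sub_left hw lam hf (hf.Pop k) hf
  have e3 : qq lam w (Qp k f) (Pop k f) = qq lam w f (Pop k f) - qq lam w (Pop k f) (Pop k f) :=
    qq_sub_left hw lam hf (hf.Pop k) (hf.Pop k)
  rw [e1, qq_comm lam f (Qp k f), qq_comm lam (Pop k f) (Qp k f), e2, e3]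
  linarith

lemma M2_bound (hw : Wok w B) {lam : ℝ} (hl : 0 ≤ lam) {ε δ : ℝ} {f : Cfg d N → ℝ}
    (hf : NM lam w ε f)
    (hδ : |qq lam w (fun x => ∑ k, Pop k f x) f - GSE d N lam w * (N - M1 f)| ≤ δ) :
    M2 f ≤ N * ε + δ + lam * (N * B / 2) * (1 + 2 * M1 f) := by
  have hp := hf.sm.toPer
  have hc := hp.cont
  have h1 : ∑ k, qq lam w (Qp k f) (Qp k f) = N * qq lam w f f -
      qq lam w (fun x => ∑ k, Pop k f x) f - lam * DD w f := by
    rw [qq_sum_left hw lam Finset.univ (fun k => hp.Pop k) hp]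
    simp only [qq_Q hw lam _ hp, Finset.sum_sub_distrib, DD, ← Finset.mul_sum]
    simp
  have h2 : M2 f - lam * (N * B / 2) * M1 f ≤ ∑ k, qq lam w (Qp k f) (Qp k f) := by
    unfold M2
    rw [M1, Finset.mul_sum, ← Finset.sum_sub_distrib]
    refine Finset.sum_le_sum fun k _ => ?_
    have a1 := qq_lower hw hl (Qp_cont k hc)
    have a2 := M1_le_TT (hp.Qp k)
    linarith
  have h3 := (abs_le.1 hδ).1
  have h4 := hf.le
  have h5 := GSE_nonpos (N := N) hw hl
  have h6 := M1_nonneg f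
  have hB := hw.B_nonneg
  have hV : -(N * B / 2) ≤ VV w f := by
    have cW := Wf_cont (N := N) hw
    have : -(N * B / 2) * n2 f ≤ VV w f := by
      unfold n2 VV
      rw [← II_cmul]
      refine II_mono (by fun_prop) (by fun_prop) fun x => ?_
      have := Wf_lower hw x
      nlinarith [sq_nonneg (f x)]
    rw [hf.nrm] at this
    linarith
  have h7 : (∑ k, ∑ l, II fun x => pw w k l x * (Qp k f x * Qp k f x)) ≤ N * B * M1 f := by
    have : ∀ k l, (II fun x => pw w k l x * (Qp k f x * Qp k f x)) ≤ B * n2 (Qp k f) := by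
      intro k l
      have c' := Qp_cont k hc
      have cp := pw_cont hw k l
      unfold n2
      rw [← II_cmul]
      refine II_mono (by fun_prop) (by fun_prop) fun x => ?_
      have := (abs_le.1 (pw_bnd hw k l x)).2
      nlinarith [sq_nonneg (Qp k f x)]
    calc _ ≤ ∑ k, ∑ _l : Fin N, B * n2 (Qp k f) :=
          Finset.sum_le_sum fun k _ => Finset.sum_le_sum fun l _ => this k l
      _ = _ := by
        simp only [Finset.sum_const, Finset.card_univ, Fintype.card_fin, nsmul_eq_mul, M1,
          Finset.mul_sum]
        exact Finset.sum_congr rfl fun k _ => by ring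
  have h8 := DD_eq hw hc
  have h9 : -(lam * DD w f) ≤ lam * (N * B / 2) + lam * (N * B / 2) * M1 f := by
    rw [h8]
    nlinarith [mul_le_mul_of_nonneg_left hV hl, mul_le_mul_of_nonneg_left h7 hl]
  have h10 : (N : ℝ) * qq lam w f f ≤ N * (GSE d N lam w + ε) := by gcongr
  have h11 : GSE d N lam w * M1 f ≤ 0 := mul_nonpos_of_nonpos_of_nonneg h5 h6
  nlinarith

lemma DD_VV (hw : Wok w B) {f : Cfg d N → ℝ} (hf : Continuous f) :
    |DD w f - VV w f| ≤ B * (√(N * M1 f) * √(M2 f)) := by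
  rw [DD_eq hw hf]
  have h1 : |∑ k, ∑ l, II fun x => pw w k l x * (Qp k f x * Qp k f x)| ≤
      ∑ k, ∑ l, 2 * B * (√(n2 (Qp k f)) * √(n2 (Qp l (Qp k f)))) := by
    refine (Finset.abs_sum_le_sum_abs _ _).trans (Finset.sum_le_sum fun k _ => ?_)
    refine (Finset.abs_sum_le_sum_abs _ _).trans (Finset.sum_le_sum fun l _ => ?_)
    rw [pw_comm hw]
    exact pw_bound hw l k (Qp_cont k hf)
  have h2 : ∑ k, ∑ l, (√(n2 (Qp k f)) * √(n2 (Qp l (Qp k f)))) ≤ √(N * M1 f) * √(M2 f) := by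
    have := Real.sum_mul_le_sqrt_mul_sqrt (Finset.univ : Finset (Fin N × Fin N))
      (fun p => √(n2 (Qp p.1 f))) (fun p => √(n2 (Qp p.2 (Qp p.1 f))))
    rw [Fintype.sum_prod_type, Fintype.sum_prod_type, Fintype.sum_prod_type] at this
    simp only [Real.sq_sqrt (n2_nonneg _)] at this
    simpa [M1, M2, Finset.mul_sum] using this
  simp only [← Finset.mul_sum] at h1 h2
  have e : ∀ V S : ℝ, V - 1 / 2 * S - V = -(1 / 2 * S) := fun V S => by ring
  rw [e, abs_neg, abs_mul]
  have hB := hw.B_nonneg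
  have h3 : |(1 / 2 : ℝ)| = 1 / 2 := by norm_num
  rw [h3]
  nlinarith [mul_le_mul_of_nonneg_left h2 hB]

end nm

section trial
variable {d n : ℕ} {w : (Fin d → ℝ) → ℝ} {B : ℝ}

/-- removal of a particle -/
lemma lower_trial (hw : Wok w B) {lam : ℝ} (hl : 0 ≤ lam) {ε δ : ℝ} {f : Cfg d (n + 1) → ℝ}
    (hf : NM lam w ε f)
    (hδ : |qq lam w (fun x => ∑ k, Pop k f x) f -
      GSE d (n + 1) lam w * (((n + 1 : ℕ) : ℝ) - M1 f)| ≤ δ) :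
    lam * DD w f - δ ≤ (GSE d (n + 1) lam w - GSE d n lam w) * ((n + 1 : ℕ) - M1 f) := by
  have hp := hf.sm.toPer
  have hc := hp.cont
  have h1 : ∀ k, GSE d n lam w * n2 (Pop k f) ≤ qq lam w (Pop k f) f -
      lam * ∑ l, II fun x => pw w k l x * (f x * Pop k f x) := by
    intro k
    have a1 := GSE_le hw hl (hf.sm.Rop k)
    have e : Pop k f = fun x => Rop (nu d) k f (rem k x) := by
      funext x; rw [Rop_rem]
    have a2 : n2 (Pop k f) = n2 (Rop (nu d) k f) := by
      rw [e, n2_rem (hp.Rop k).cont]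
    have a3 : qq lam w (Pop k f) (Pop k f) = qq lam w (Rop (nu d) k f) (Rop (nu d) k f) := by
      rw [e, qq_rem hw lam (hp.Rop k) (hp.Rop k)]
    have a4 := qq_Pop hw lam k hp (hp.Pop k) (fun x z => Pop_upd k f x z)
    rw [qq_comm lam (Pop k f) f, a2]
    linarith
  have h2 := Finset.sum_le_sum fun k (_ : k ∈ Finset.univ) => h1 k
  rw [← Finset.mul_sum, Finset.sum_sub_distrib, ← Finset.mul_sum] at h2
  rw [← qq_sum_left hw lam Finset.univ (fun k => hp.Pop k) hp] at h2
  have h3 : ∑ k, n2 (Pop k f) = ((n + 1 : ℕ) : ℝ) - M1 f := by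
    have : ∀ k, n2 (Pop k f) = 1 - n2 (Qp k f) := fun k => by
      have := pyth k hc
      have := hf.nrm
      linarith
    simp [this, M1, Finset.sum_sub_distrib]
  rw [h3] at h2
  have h4 := (abs_le.1 hδ).2
  have h5 : ∑ k, ∑ l, (II fun x => pw w k l x * (f x * Pop k f x)) = DD w f := rfl
  rw [h5] at h2
  linarith

/-- exchange term -/
def Cx (w : (Fin d → ℝ) → ℝ) (f : Cfg d n → ℝ) (j : Fin n) (y : Cfg d n) : ℝ :=
  ∫ x, w (x - y j) * f (Function.update y j x) ∂(nu d)

lemma Cx_cont (hw : Wok w B) {f : Cfg d n → ℝ} (hf : Continuous f) (j : Fin n) :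
    Continuous (Cx w f j) := by
  have := hw.cont
  refine CSM.continuous_integral (ν := nu d)
    (F := fun (y : Cfg d n) x => w (x - y j) * f (Function.update y j x)) ?_
  unfold Function.uncurry
  fun_prop

lemma Cx_bound (hw : Wok w B) {f : Cfg d n → ℝ} (hf : Continuous f) (j : Fin n) (y : Cfg d n) :
    |Cx w f j y| ≤ B * Pop j (fun x => |Qp j f x|) y := by
  have cw := hw.cont
  have c' := Qp_cont j hf
  have e : Cx w f j y = ∫ x, w (x - y j) * Qp j f (Function.update y j x) ∂(nu d) := by
    have : ∀ x, w (x - y j) * Qp j f (Function.update y j x) =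
        w (x - y j) * f (Function.update y j x) - Pop j f y * w (x - y j) := by
      intro x
      unfold Qp
      rw [Pop_upd]; ring
    simp only [this]
    rw [integral_sub (CSM.integrable (by fun_prop)) (CSM.integrable (by fun_prop)),
      integral_const_mul, hw.mean]
    simp [Cx]
  rw [e]
  refine abs_integral_le_integral_abs.trans ?_
  unfold Pop
  rw [← integral_const_mul]
  refine integral_mono (CSM.integrable (by fun_prop)) (CSM.integrable (by fun_prop)) fun x => ?_
  simp only [abs_mul]
  exact mul_le_mul_of_nonneg_right (hw.bnd _) (abs_nonneg _)

lemma Cx_sum (hw : Wok w B) {f : Cfg d n → ℝ} (hf : Continuous f) (h1 : n2 f = 1) :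
    ∑ j, (II fun y => f y * Cx w f j y) ≤ B * √(n * M1 f) := by
  have hB := hw.B_nonneg
  have h2 : ∀ j, (II fun y => f y * Cx w f j y) ≤ B * √(n2 (Qp j f)) := by
    intro j
    have c1 := Cx_cont hw hf j
    have cQ := Qp_cont j hf
    have c2 := Pop_cont j cQ.abs
    calc (II fun y => f y * Cx w f j y)
        ≤ II fun y => B * |f y * Pop j (fun x => |Qp j f x|) y| := by
          refine II_mono (by fun_prop) (by fun_prop) fun y => ?_
          have a := Cx_bound hw hf j y
          have b := le_abs_self (f y * Cx w f j y)
          rw [abs_mul] at b ⊢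
          have a3 := mul_le_mul_of_nonneg_left a (abs_nonneg (f y))
          have a4 := mul_le_mul_of_nonneg_left (le_abs_self (Pop j (fun x => |Qp j f x|) y))
            (mul_nonneg hB (abs_nonneg (f y)))
          nlinarith
      _ ≤ B * (√(n2 f) * √(n2 (Pop j fun x => |Qp j f x|))) := by
          rw [II_cmul]
          exact mul_le_mul_of_nonneg_left (cs hf c2) hB
      _ ≤ B * (1 * √(n2 (Qp j f))) := by
          rw [h1, Real.sqrt_one]
          have : n2 (Pop j fun x => |Qp j f x|) ≤ n2 (Qp j f) := by
            refine (n2_Pop_le j cQ.abs).trans (le_of_eq ?_)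
            simp [n2]
          gcongr
      _ = _ := by ring
  refine (Finset.sum_le_sum fun j _ => h2 j).trans ?_
  rw [← Finset.mul_sum]
  refine mul_le_mul_of_nonneg_left ?_ hB
  have := Real.sum_mul_le_sqrt_mul_sqrt (Finset.univ : Finset (Fin n))
    (fun _ => (1 : ℝ)) (fun p => √(n2 (Qp p f)))
  simp only [Real.sq_sqrt (n2_nonneg _)] at this
  rw [Real.sqrt_mul (by positivity)]
  simpa [M1] using this

lemma DD_swap (hw : Wok w B) {f : Cfg d n → ℝ} (hf : Continuous f) (m j : Fin n) :
    (II fun y => f y * Pop m (fun y => pw w m j y * f y) y) =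
      II fun y => pw w m j y * (f y * Pop m f y) := by
  have cp := pw_cont hw m j
  have h1 := II_indep m hf (Pop_cont m (f := fun y => pw w m j y * f y) (by fun_prop))
    (fun x z => Pop_upd m _ x z)
  have h2 := II_indep m (f := fun y => pw w m j y * f y) (by fun_prop) (Pop_cont m hf)
    (fun x z => Pop_upd m _ x z)
  rw [II_congr (fun y => mul_comm (f y) _), h1, II_congr (fun y => mul_comm _ (Pop m f y)), ← h2]
  exact II_congr fun y => by ring

lemma Phi_pair (hw : Wok w B) {f : Cfg d n → ℝ} (hf : Sm f) (k : Fin (n + 1)) (j : Fin n) :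
    (II fun x => pw w k (k.succAbove j) x * (Phi f x * f (rem k x))) =
      (∑ m, II fun y => pw w m j y * (f y * Pop m f y)) + II fun y => f y * Cx w f j y := by
  have hc := hf.toPer.cont
  have cw := hw.cont
  have cPhi := hf.Phi.toPer.cont
  have cp := pw_cont hw k (k.succAbove j)
  have cr : Continuous fun x : Cfg d (n + 1) => f (rem k x) := hc.comp (continuous_rem k)
  have cC := Cx_cont hw hc
  have cP : ∀ m, Continuous (Pop m fun y => pw w m j y * f y) := fun m =>
    Pop_cont m (by have := pw_cont hw m j; fun_prop)
  rw [fubini_cfg (f := fun x => pw w k (k.succAbove j) x * (Phi f x * f (rem k x))) k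
    (cp.mul (cPhi.mul cr))]
  have h1 : ∀ y : Cfg d n, (∫ x, pw w k (k.succAbove j) (ins k x y) *
      (Phi f (ins k x y) * f (rem k (ins k x y))) ∂(nu d)) =
      (∑ m, f y * Pop m (fun y => pw w m j y * f y) y) + f y * Cx w f j y := by
    intro y
    have e : ∀ x : Fin d → ℝ, pw w k (k.succAbove j) (ins k x y) *
        (Phi f (ins k x y) * f (rem k (ins k x y))) =
        (f y * f y) * w (x - y j) +
        ∑ m, f y * (w (x - y j) * f (Function.update y m x)) := by
      intro x
      rw [Phi_ins hf, rem_ins]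
      unfold pw
      rw [if_neg (Fin.succAbove_ne k j).symm, ins_same, ins_succAbove, ← Finset.mul_sum,
        ← Finset.mul_sum]
      ring
    simp only [e]
    rw [integral_add (CSM.integrable (by fun_prop)) (CSM.integrable (by fun_prop)),
      integral_const_mul, hw.mean, integral_finsetSum _
        (fun m _ => CSM.integrable (by fun_prop))]
    simp only [integral_const_mul]
    rw [mul_zero, zero_add]
    have e2 : ∀ m, m ≠ j → Pop m (fun y => pw w m j y * f y) y =
        ∫ x, w (x - y j) * f (Function.update y m x) ∂(nu d) := by
      intro m hm
      unfold Pop pw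
      simp [hm, hm.symm]
    have e3 : Pop j (fun y => pw w j j y * f y) y = 0 := by
      simp [Pop, pw]
    rw [← Finset.add_sum_erase _ _ (Finset.mem_univ j),
      ← Finset.add_sum_erase (a := j) _ _ (Finset.mem_univ j), e3]
    have hs : ∑ m ∈ Finset.univ.erase j, f y * Pop m (fun y => pw w m j y * f y) y =
        ∑ m ∈ Finset.univ.erase j, f y * ∫ x, w (x - y j) * f (Function.update y m x) ∂(nu d) :=
      Finset.sum_congr rfl (fun m hm => by rw [e2 m (Finset.ne_of_mem_erase hm)])
    rw [hs]
    unfold Cx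
    ring
  simp only [h1]
  change (II fun y => (∑ m, f y * Pop m (fun y => pw w m j y * f y) y) + f y * Cx w f j y) = _
  rw [II_add (by fun_prop) (by fun_prop), II_sum (fun m _ => by fun_prop)]
  simp only [DD_swap hw hc]

/-- addition of a particle -/
lemma upper_trial (hw : Wok w B) {lam : ℝ} (hl : 0 ≤ lam) {ε δ : ℝ} {f : Cfg d n → ℝ}
    (hf : NM lam w ε f)
    (hδ : |qq lam w (fun x => ∑ k, Pop k f x) f - GSE d n lam w * ((n : ℝ) - M1 f)| ≤ δ) :
    (GSE d (n + 1) lam w - GSE d n lam w) * (n + 1 - M1 f) ≤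
      ε + δ + lam * DD w f + lam * (B * √(n * M1 f)) := by
  have hp := hf.sm.toPer
  have hc := hp.cont
  have hΦ := hf.sm.Phi
  have hr := fun k : Fin (n + 1) => hp.rem k
  have hn0 := hf.sm.n0.toPer
  have cPhi := hΦ.toPer.cont
  have hPop : ∀ k : Fin (n + 1), Pop k (Phi f) = fun x => (fun y => f y + ∑ j, Pop j f y) (rem k x) := by
    intro k
    funext x
    rw [← Rop_rem, Rop_Phi hf.sm]
  -- the norm
  have hnorm : n2 (Phi f) = (n + 1) * (n + 1 - M1 f) := by
    have e1 : n2 (Phi f) = ∑ k : Fin (n + 1), II fun x => f (rem k x) * Phi f x := by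
      rw [← II_sum (f := fun k x => f (rem k x) * Phi f x) (fun k _ => (hr k).cont.mul cPhi)]
      refine II_congr fun x => ?_
      rw [← Finset.sum_mul, pow_two]; rfl
    have e2 : ∀ k : Fin (n + 1), (II fun x => f (rem k x) * Phi f x) = n + 1 - M1 f := by
      intro k
      rw [II_indep k cPhi (hr k).cont (fun x z => by rw [rem_upd_same]), hPop k]
      have c2 := hn0.cont
      rw [II_rem (g := fun y => f y * (f y + ∑ j, Pop j f y)) (by fun_prop) k]
      have e3 : (II fun y => f y * (f y + ∑ j, Pop j f y)) =
          n2 f + II fun x => (∑ k, Pop k f x) * f x := by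
        unfold n2
        rw [← II_add (by fun_prop) (by fun_prop)]
        exact II_congr fun x => by ring
      rw [e3, n0_inner hc hf.nrm, hf.nrm]; ring
    rw [e1, Finset.sum_congr rfl fun k _ => e2 k]
    simp
    try ring
  have hen : qq lam w (Phi f) (Phi f) ≤ (n + 1) * (qq lam w f f +
      qq lam w (fun x => ∑ k, Pop k f x) f + lam * (DD w f + B * √(n * M1 f))) := by
    have e1 : qq lam w (Phi f) (Phi f) =
        ∑ k : Fin (n + 1), qq lam w (Phi f) (fun x => f (rem k x)) := by
      have := qq_sum_left hw lam Finset.univ (fun k => hr k) hΦ.toPer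
      rw [show (fun x => ∑ k : Fin (n + 1), f (rem k x)) = Phi f from rfl] at this
      rw [this]
      exact Finset.sum_congr rfl fun k _ => qq_comm _ _ _
    have e2 : ∀ k : Fin (n + 1), qq lam w (Phi f) (fun x => f (rem k x)) ≤ qq lam w f f +
      qq lam w (fun x => ∑ k, Pop k f x) f + lam * (DD w f + B * √(n * M1 f)) := by
      intro k
      rw [qq_Pop hw lam k hΦ.toPer (hr k) (fun x z => by rw [rem_upd_same]), hPop k,
        qq_rem hw lam (hp.add hn0) hp k, qq_add_left hw lam hp hn0 hp]
      have e3 : (∑ l, II fun x => pw w k l x * (Phi f x * f (rem k x))) =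
          DD w f + ∑ j, II fun y => f y * Cx w f j y := by
        rw [Fin.sum_univ_succAbove _ k]
        simp only [pw_self, zero_mul, II_const, zero_add, Phi_pair hw hf.sm]
        rw [Finset.sum_add_distrib, Finset.sum_comm]
        rfl
      rw [e3]
      have e4 := Cx_sum hw hc hf.nrm
      nlinarith [mul_le_mul_of_nonneg_left e4 hl]
    rw [e1]
    refine (Finset.sum_le_sum fun k _ => e2 k).trans (le_of_eq ?_)
    simp
    try ring
  have h1 := GSE_le hw hl hΦ
  rw [hnorm] at h1
  have h2 := (abs_le.1 hδ).2
  have h3 := hf.le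
  have hpos : (0:ℝ) < n + 1 := by positivity
  have h4 : (n + 1 : ℝ) * (GSE d (n + 1) lam w * (n + 1 - M1 f)) ≤
      (n + 1) * (qq lam w f f +
      qq lam w (fun x => ∑ k, Pop k f x) f + lam * (DD w f + B * √(n * M1 f))) := by
    linarith
  have h5 := le_of_mul_le_mul_left h4 hpos
  nlinarith

end trial

section waves
variable {d N : ℕ}

/-- phase -/
def th (k : Fin d → ℤ) (y : Fin d → ℝ) : ℝ := ∑ i, (2 * π * (k i : ℝ)) * y i

/-- cosine wave -/
def cw (k : Fin d → ℤ) (y : Fin d → ℝ) : ℝ := Real.cos (th k y)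

lemma th_cont (k : Fin d → ℤ) : Continuous (th k) := by unfold th; fun_prop

lemma cw_cont (k : Fin d → ℤ) : Continuous (cw k) := Real.continuous_cos.comp (th_cont k)

lemma th_sub (k : Fin d → ℤ) (y z : Fin d → ℝ) : th k (y - z) = th k y - th k z := by
  unfold th; rw [← Finset.sum_sub_distrib]; exact Finset.sum_congr rfl fun i _ => by simp; ring

lemma th_add (k : Fin d → ℤ) (y z : Fin d → ℝ) : th k (y + z) = th k y + th k z := by
  unfold th; rw [← Finset.sum_add_distrib]; exact Finset.sum_congr rfl fun i _ => by simp; ring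

lemma th_neg (k : Fin d → ℤ) (y : Fin d → ℝ) : th k (-y) = -th k y := by
  unfold th; rw [← Finset.sum_neg_distrib]; exact Finset.sum_congr rfl fun i _ => by simp

lemma th_negk (k : Fin d → ℤ) (y : Fin d → ℝ) : th (-k) y = -th k y := by
  unfold th; rw [← Finset.sum_neg_distrib]; exact Finset.sum_congr rfl fun i _ => by simp

lemma th_subk (k l : Fin d → ℤ) (y : Fin d → ℝ) : th (k - l) y = th k y - th l y := by
  unfold th; rw [← Finset.sum_sub_distrib]; exact Finset.sum_congr rfl fun i _ => by simp; ring

lemma cw_abs (k : Fin d → ℤ) (y : Fin d → ℝ) : |cw k y| ≤ 1 := Real.abs_cos_le_one _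

lemma th_int (k v : Fin d → ℤ) :
    th k (fun i => (v i : ℝ)) = ((∑ i, k i * v i : ℤ) : ℝ) * (2 * π) := by
  unfold th; push_cast; rw [Finset.sum_mul]; exact Finset.sum_congr rfl fun i _ => by ring

lemma wOf_eq {hw : (Fin d → ℤ) → ℝ} (hs : Summable hw) (h0 : ∀ k, 0 ≤ hw k) (y : Fin d → ℝ) :
    wOf d hw y = ∑' k, hw k * cw k y := by
  unfold wOf
  have hsum : Summable fun k : Fin d → ℤ =>
      (hw k : ℂ) * Complex.exp (Complex.I * ((∑ i, (2 * π * (k i : ℝ)) * y i : ℝ) : ℂ)) := by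
    refine Summable.of_norm_bounded hs fun k => ?_
    rw [norm_mul, mul_comm Complex.I, Complex.norm_exp_ofReal_mul_I, mul_one,
      Complex.norm_real, Real.norm_eq_abs, abs_of_nonneg (h0 k)]
  rw [Complex.re_tsum hsum]
  refine tsum_congr fun k => ?_
  rw [Complex.re_ofReal_mul, mul_comm Complex.I, Complex.exp_ofReal_mul_I_re]
  rfl

lemma hwcw_summable {hw : (Fin d → ℤ) → ℝ} (hs : Summable hw) (h0 : ∀ k, 0 ≤ hw k)
    (y : Fin d → ℝ) : Summable fun k => hw k * cw k y := by
  refine Summable.of_norm_bounded hs fun k => ?_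
  rw [norm_mul, Real.norm_eq_abs, abs_of_nonneg (h0 k)]
  exact mul_le_of_le_one_right (h0 k) (cw_abs k y)

/-- total cosine -/
def CC (k : Fin d → ℤ) (x : Cfg d N) : ℝ := ∑ a, Real.cos (th k (x a))
/-- total sine -/
def SS (k : Fin d → ℤ) (x : Cfg d N) : ℝ := ∑ a, Real.sin (th k (x a))
/-- structure factor -/
def AA (k : Fin d → ℤ) (x : Cfg d N) : ℝ := CC k x * CC k x + SS k x * SS k x

lemma AA_nonneg (k : Fin d → ℤ) (x : Cfg d N) : 0 ≤ AA k x := by exact add_nonneg (mul_self_nonneg _) (mul_self_nonneg _)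

lemma AA_double (k : Fin d → ℤ) (x : Cfg d N) : AA k x = ∑ a, ∑ b, cw k (x a - x b) := by
  unfold AA CC SS cw
  rw [Finset.sum_mul_sum, Finset.sum_mul_sum, ← Finset.sum_add_distrib]
  refine Finset.sum_congr rfl fun a _ => ?_
  rw [← Finset.sum_add_distrib]
  exact Finset.sum_congr rfl fun b _ => by rw [th_sub, Real.cos_sub]

lemma AA_Wf (k : Fin d → ℤ) (x : Cfg d N) : AA k x = N + 2 * Wf (cw k) x := by
  rw [AA_double]
  unfold Wf pw
  have h : ∀ a b : Fin N, cw k (x a - x b) =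
      (if a = b then 1 else 0) + (if a = b then 0 else cw k (x a - x b)) := by
    intro a b
    by_cases h : a = b
    · subst h; simp [cw, th]
    · simp [h]
  rw [Finset.sum_congr rfl fun a _ => Finset.sum_congr rfl fun b _ => h a b]
  simp only [Finset.sum_add_distrib, Finset.sum_ite_eq, Finset.mem_univ, if_true]
  simp only [Finset.sum_const, Finset.card_univ, Fintype.card_fin, nsmul_eq_mul, mul_one]
  ring

lemma cw_mean {k : Fin d → ℤ} (hk : k ≠ 0) (y : Fin d → ℝ) : ∫ z, cw k (z - y) ∂(nu d) = 0 := by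
  obtain ⟨i, hi⟩ : ∃ i, k i ≠ 0 := by
    by_contra h; push Not at h; exact hk (funext h)
  obtain ⟨e, rfl⟩ : ∃ e, d = e + 1 := ⟨d - 1, by have := i.pos; omega⟩
  have hc : Continuous fun z => cw k (z - y) := (cw_cont k).comp (by fun_prop)
  rw [nu, fubini i hc]
  have h1 : ∀ z : Fin e → ℝ, ∫ t, cw k (ins i t z - y) ∂u0 = 0 := by
    intro z
    have h2 : ∀ t, cw k (ins i t z - y) =
        Real.cos ((2 * π * k i) * t + (th k (ins i 0 z - y))) := by
      intro t
      unfold cw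
      congr 1
      rw [th_sub, th_sub]
      unfold th
      rw [Fin.sum_univ_succAbove _ i, Fin.sum_univ_succAbove (fun j => _ * (ins i 0 z) j) i]
      simp only [ins_same, ins_succAbove]
      ring
    simp only [h2]
    have hm : (2 * π * (k i : ℝ)) ≠ 0 := by
      have : (k i : ℝ) ≠ 0 := by exact_mod_cast hi
      positivity
    rw [u0_eq, intervalIntegral.integral_comp_mul_add _ hm, integral_cos]
    have : Real.sin (2 * π * k i * 1 + th k (ins i 0 z - y)) = Real.sin (th k (ins i 0 z - y)) := by
      rw [show 2 * π * k i * 1 + th k (ins i 0 z - y) = th k (ins i 0 z - y) + (k i : ℤ) * (2 * π) by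
        ring, Real.sin_add_int_mul_two_pi]
    rw [this]
    simp
  simp only [h1, integral_zero]

lemma cw_Wok {k : Fin d → ℤ} (hk : k ≠ 0) : Wok (cw k) 1 where
  cont := cw_cont k
  even y := by unfold cw; rw [th_neg, Real.cos_neg]
  mean := cw_mean hk
  bnd := cw_abs k
  psd N x := by rw [← AA_double]; exact AA_nonneg k x

/-- admissible Fourier coefficients -/
structure HW (hw : (Fin d → ℤ) → ℝ) : Prop where
  nn : ∀ k, 0 ≤ hw k
  sm : Summable hw
  zero : hw 0 = 0

lemma wOf_Wok {hw : (Fin d → ℤ) → ℝ} (h : HW hw) : Wok (wOf d hw) (∑' k, hw k) := by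
  have e : wOf d hw = fun y => ∑' k, hw k * cw k y := funext fun y => wOf_eq h.sm h.nn y
  have hb : ∀ k y, ‖hw k * cw k y‖ ≤ hw k := fun k y => by
    rw [norm_mul, Real.norm_eq_abs, abs_of_nonneg (h.nn k)]
    exact mul_le_of_le_one_right (h.nn k) (cw_abs k y)
  rw [e]
  refine ⟨continuous_tsum (fun k => continuous_const.mul (cw_cont k)) h.sm hb, fun y => ?_,
    fun y => ?_, fun y => ?_, fun N x => ?_⟩
  · exact tsum_congr fun k => by unfold cw; rw [th_neg, Real.cos_neg]
  · have := hasSum_integral_of_summable_integral_norm (μ := nu d)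
      (F := fun k z => hw k * cw k (z - y))
      (fun k => CSM.integrable (by have := cw_cont k; fun_prop)) ?_
    · rw [← this.tsum_eq]
      rw [← tsum_zero (β := Fin d → ℤ)]
      refine tsum_congr fun k => ?_
      rw [integral_const_mul]
      by_cases hk : k = 0
      · simp [hk, h.zero]
      · rw [cw_mean hk, mul_zero]
    · refine Summable.of_nonneg_of_le (fun k => integral_nonneg fun z => norm_nonneg _)
        (fun k => ?_) h.sm
      have : ∫ z, ‖hw k * cw k (z - y)‖ ∂(nu d) ≤ ∫ z, hw k ∂(nu d) :=
        integral_mono (CSM.integrable (by have := cw_cont k; fun_prop))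
          (integrable_const _) fun z => hb k _
      simpa using this
  · exact tsum_of_norm_bounded h.sm.hasSum fun k => hb k y
  · have e2 : ∑ a, ∑ b, ∑' k, hw k * cw k (x a - x b) = ∑' k, hw k * AA k x := by
      rw [Finset.sum_congr rfl fun a _ =>
        (Summable.tsum_finsetSum fun b _ => hwcw_summable h.sm h.nn (x a - x b)).symm]
      rw [← Summable.tsum_finsetSum fun a _ => summable_sum fun b _ =>
        hwcw_summable h.sm h.nn (x a - x b)]
      refine tsum_congr fun k => ?_
      rw [AA_double, Finset.mul_sum]
      exact Finset.sum_congr rfl fun a _ => by rw [Finset.mul_sum]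
    rw [e2]
    exact tsum_nonneg fun k => mul_nonneg (h.nn k) (AA_nonneg k x)

/-- coefficients off a finite set -/
def tl (S : Finset (Fin d → ℤ)) (hw : (Fin d → ℤ) → ℝ) (k : Fin d → ℤ) : ℝ :=
  if k ∈ S then 0 else hw k

lemma HW.tl {hw : (Fin d → ℤ) → ℝ} (h : HW hw) (S : Finset (Fin d → ℤ)) : HW (tl S hw) where
  nn k := by unfold _root_.tl; split_ifs; exacts [le_rfl, h.nn k]
  sm := Summable.of_nonneg_of_le (fun k => by unfold _root_.tl; split_ifs; exacts [le_rfl, h.nn k])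
    (fun k => by unfold _root_.tl; split_ifs; exacts [h.nn k, le_rfl]) h.sm
  zero := by unfold _root_.tl; split_ifs; exacts [rfl, h.zero]

lemma tl_tsum {hw : (Fin d → ℤ) → ℝ} (h : HW hw) (S : Finset (Fin d → ℤ)) :
    ∑' k, hw k = ∑ k ∈ S, hw k + ∑' k, tl S hw k := by
  have h1 := (h.tl S).sm
  have h2 : ∀ k, hw k = (if k ∈ S then hw k else 0) + tl S hw k := by
    intro k; unfold tl; split_ifs <;> simp
  have h3 : HasSum (fun k => if k ∈ S then hw k else 0) (∑ k ∈ S, if k ∈ S then hw k else 0) :=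
    hasSum_sum_of_ne_finset_zero fun k hk => by simp [hk]
  have h4 := (h3.add h1.hasSum).tsum_eq
  rw [Finset.sum_congr rfl fun k (hk : k ∈ S) => if_pos hk] at h4
  rw [← h4]
  exact tsum_congr h2

lemma wOf_split {hw : (Fin d → ℤ) → ℝ} (h : HW hw) (S : Finset (Fin d → ℤ)) (y : Fin d → ℝ) :
    wOf d hw y = ∑ k ∈ S, hw k * cw k y + wOf d (tl S hw) y := by
  rw [wOf_eq h.sm h.nn, wOf_eq (h.tl S).sm (h.tl S).nn]
  have h1 := hwcw_summable (h.tl S).sm (h.tl S).nn y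
  have h2 : ∀ k, hw k * cw k y = (if k ∈ S then hw k * cw k y else 0) + tl S hw k * cw k y := by
    intro k; unfold tl; split_ifs <;> simp
  have h3 : HasSum (fun k => if k ∈ S then hw k * cw k y else 0)
      (∑ k ∈ S, if k ∈ S then hw k * cw k y else 0) :=
    hasSum_sum_of_ne_finset_zero fun k hk => by simp [hk]
  have h4 := (h3.add h1.hasSum).tsum_eq
  rw [Finset.sum_congr rfl fun k (hk : k ∈ S) => if_pos hk] at h4
  rw [← h4]
  exact tsum_congr h2

lemma Wf_split {hw : (Fin d → ℤ) → ℝ} (h : HW hw) (S : Finset (Fin d → ℤ)) (x : Cfg d N) :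
    Wf (wOf d hw) x = ∑ k ∈ S, hw k * ((AA k x - N) / 2) + Wf (wOf d (tl S hw)) x := by
  have e : ∀ k, (AA k x - N) / 2 = Wf (cw k) x := fun k => by rw [AA_Wf]; ring
  simp only [e]
  unfold Wf
  have e2 : ∀ a b : Fin N, pw (wOf d hw) a b x =
      ∑ k ∈ S, hw k * pw (cw k) a b x + pw (wOf d (tl S hw)) a b x := by
    intro a b
    unfold pw
    split_ifs
    · simp
    · exact wOf_split h S _
  simp only [e2, Finset.sum_add_distrib]
  rw [mul_add]
  congr 1
  rw [Finset.sum_congr rfl fun a _ => Finset.sum_comm, Finset.sum_comm, Finset.mul_sum]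
  refine Finset.sum_congr rfl fun k _ => ?_
  simp only [← Finset.mul_sum]
  ring

end waves

section waves2
variable {d N : ℕ}

lemma th_upd_int (k v : Fin d → ℤ) (y : Fin d → ℝ) :
    th k (y + fun i => (v i : ℝ)) = th k y + ((∑ i, k i * v i : ℤ) : ℝ) * (2 * π) := by
  rw [th_add, th_int]

lemma th_smooth (k : Fin d → ℤ) (a : Fin N) :
    ContDiff ℝ (⊤ : ℕ∞) fun x : Cfg d N => th k (x a) := by unfold th; fun_prop

lemma Per_cos (k : Fin d → ℤ) (a : Fin N) : Per fun x : Cfg d N => Real.cos (th k (x a)) := by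
  refine ⟨Real.contDiff_cos.comp (th_smooth k a), fun x j v => ?_⟩
  by_cases h : a = j
  · subst h
    rw [Function.update_self, th_upd_int, Real.cos_add_int_mul_two_pi]
  · rw [Function.update_of_ne h]

lemma Per_sin (k : Fin d → ℤ) (a : Fin N) : Per fun x : Cfg d N => Real.sin (th k (x a)) := by
  refine ⟨Real.contDiff_sin.comp (th_smooth k a), fun x j v => ?_⟩
  by_cases h : a = j
  · subst h
    rw [Function.update_self, th_upd_int, Real.sin_add_int_mul_two_pi]
  · rw [Function.update_of_ne h]

lemma fderiv_th (k : Fin d → ℤ) (a j : Fin N) (i : Fin d) (x : Cfg d N) :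
    fderiv ℝ (fun x : Cfg d N => th k (x a)) x (Pi.single j (Pi.single i 1)) =
      if a = j then 2 * π * k i else 0 := by
  let L : Cfg d N →L[ℝ] ℝ := ∑ i, (2 * π * (k i : ℝ)) •
    ((ContinuousLinearMap.proj (R := ℝ) (φ := fun _ : Fin d => ℝ) i).comp
      (ContinuousLinearMap.proj (R := ℝ) (φ := fun _ : Fin N => Fin d → ℝ) a))
  have hL : (fun x : Cfg d N => th k (x a)) = L := by
    funext x
    simp [L, th]
  rw [hL, L.fderiv, ← hL]
  unfold th
  by_cases h : a = j
  · subst h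
    simp [Pi.single_apply]
  · simp [h]

lemma pd_cos (k : Fin d → ℤ) (a j : Fin N) (i : Fin d) (x : Cfg d N) :
    pd j i (fun x => Real.cos (th k (x a))) x =
      if a = j then -(2 * π * k i) * Real.sin (th k (x a)) else 0 := by
  unfold pd
  rw [fderiv_cos ((th_smooth k a).differentiable (by simp) x)]
  simp only [_root_.smul_apply, fderiv_th, smul_eq_mul]
  split_ifs <;> ring

lemma pd_sin (k : Fin d → ℤ) (a j : Fin N) (i : Fin d) (x : Cfg d N) :
    pd j i (fun x => Real.sin (th k (x a))) x =
      if a = j then (2 * π * k i) * Real.cos (th k (x a)) else 0 := by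
  unfold pd
  rw [fderiv_sin ((th_smooth k a).differentiable (by simp) x)]
  simp only [_root_.smul_apply, fderiv_th, smul_eq_mul]
  split_ifs <;> ring

lemma Per_CC (k : Fin d → ℤ) : Per (CC k : Cfg d N → ℝ) := Per.sum fun a _ => Per_cos k a
lemma Per_SS (k : Fin d → ℤ) : Per (SS k : Cfg d N → ℝ) := Per.sum fun a _ => Per_sin k a
lemma Per_AA (k : Fin d → ℤ) : Per (AA k : Cfg d N → ℝ) :=
  ((Per_CC k).mul (Per_CC k)).add ((Per_SS k).mul (Per_SS k))

lemma Sm_AA (k : Fin d → ℤ) : Sm (AA k : Cfg d N → ℝ) := by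
  refine ⟨Per_AA k, fun σ x => ?_⟩
  have h1 : CC k (x ∘ σ) = CC k x := Equiv.sum_comp σ fun a => Real.cos (th k (x a))
  have h2 : SS k (x ∘ σ) = SS k x := Equiv.sum_comp σ fun a => Real.sin (th k (x a))
  unfold AA
  rw [h1, h2]

lemma pd_CC (k : Fin d → ℤ) (j : Fin N) (i : Fin d) (x : Cfg d N) :
    pd j i (CC k) x = -(2 * π * k i) * Real.sin (th k (x j)) := by
  have := pd_sum (s := Finset.univ) (fun a _ => Per_cos k a) j i x
  simp only [pd_cos, Finset.sum_ite_eq', Finset.mem_univ, if_true] at this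
  exact this

lemma pd_SS (k : Fin d → ℤ) (j : Fin N) (i : Fin d) (x : Cfg d N) :
    pd j i (SS k) x = (2 * π * k i) * Real.cos (th k (x j)) := by
  have := pd_sum (s := Finset.univ) (fun a _ => Per_sin k a) j i x
  simp only [pd_sin, Finset.sum_ite_eq', Finset.mem_univ, if_true] at this
  exact this

/-- imaginary part -/
def sk (k : Fin d → ℤ) (a : Fin N) (x : Cfg d N) : ℝ :=
  Real.sin (th k (x a)) * CC k x - Real.cos (th k (x a)) * SS k x
/-- real part -/
def rk (k : Fin d → ℤ) (a : Fin N) (x : Cfg d N) : ℝ :=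
  Real.cos (th k (x a)) * CC k x + Real.sin (th k (x a)) * SS k x

lemma Per_sk (k : Fin d → ℤ) (a : Fin N) : Per (sk k a) :=
  ((Per_sin k a).mul (Per_CC k)).sub ((Per_cos k a).mul (Per_SS k))

lemma pd_AA (k : Fin d → ℤ) (j : Fin N) (i : Fin d) (x : Cfg d N) :
    pd j i (AA k) x = -2 * (2 * π * k i) * sk k j x := by
  have := pd_add ((Per_CC k).mul (Per_CC k)) ((Per_SS k).mul (Per_SS k)) j i x
  rw [pd_mul (Per_CC k) (Per_CC k), pd_mul (Per_SS k) (Per_SS k), pd_CC, pd_SS] at this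
  refine this.trans ?_
  unfold sk
  ring

lemma pd_sk (k : Fin d → ℤ) (j : Fin N) (i : Fin d) (x : Cfg d N) :
    pd j i (sk k j) x = (2 * π * k i) * (rk k j x - 1) := by
  have := pd_sub ((Per_sin k j).mul (Per_CC k)) ((Per_cos k j).mul (Per_SS k)) j i x
  rw [pd_mul (Per_sin k j) (Per_CC k), pd_mul (Per_cos k j) (Per_SS k), pd_CC, pd_SS,
    pd_cos, pd_sin, if_pos rfl, if_pos rfl] at this
  refine this.trans ?_
  unfold rk
  linear_combination (-(2 * π * k i)) * Real.sin_sq_add_cos_sq (th k (x j))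

lemma sum_rk (k : Fin d → ℤ) (x : Cfg d N) : ∑ a, rk k a x = AA k x := by
  unfold rk
  rw [Finset.sum_add_distrib, ← Finset.sum_mul, ← Finset.sum_mul]; rfl

/-- Laplacian -/
def LL (U : Cfg d N → ℝ) (x : Cfg d N) : ℝ := ∑ j, ∑ i, pd j i (pd j i U) x
/-- squared gradient -/
def GG (U : Cfg d N → ℝ) (x : Cfg d N) : ℝ := ∑ j, ∑ i, pd j i U x ^ 2

lemma LL_AA (k : Fin d → ℤ) (x : Cfg d N) : LL (AA k) x = -2 * pSq d k * (AA k x - N) := by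
  unfold LL
  have h : ∀ j i, pd j i (pd j i (AA k)) x = (2 * π * k i) ^ 2 * (-2 * (rk k j x - 1)) := by
    intro j i
    have e : pd j i (AA k) = fun x : Cfg d N => -2 * (2 * π * k i) * sk k j x :=
      funext fun x => pd_AA k j i x
    rw [e, pd_cmul _ (Per_sk k j), pd_sk]; ring
  simp only [h, ← Finset.sum_mul]
  rw [← Finset.mul_sum, ← Finset.mul_sum, Finset.sum_sub_distrib, sum_rk]
  simp [pSq]
  ring

lemma LL_cont {U : Cfg d N → ℝ} (hU : Per U) : Continuous (LL U) := by
  unfold LL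
  have : ∀ j i, Continuous (pd j i (pd j i U)) := fun j i => (hU.pd j i).pdc j i
  fun_prop

lemma GG_cont {U : Cfg d N → ℝ} (hU : Per U) : Continuous (GG U) := by
  unfold GG
  have : ∀ j i, Continuous (pd j i U) := fun j i => hU.pdc j i
  fun_prop

lemma GG_nonneg (U : Cfg d N → ℝ) (x : Cfg d N) : 0 ≤ GG U x :=
  Finset.sum_nonneg fun _ _ => Finset.sum_nonneg fun _ _ => sq_nonneg _

lemma II_sum2 {F : Fin N → Fin d → Cfg d N → ℝ} (h : ∀ j i, Continuous (F j i)) :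
    (II fun x => ∑ j, ∑ i, F j i x) = ∑ j, ∑ i, II (F j i) := by
  rw [II_sum fun j _ => by have := h j; fun_prop]
  exact Finset.sum_congr rfl fun j _ => II_sum fun i _ => h j i

/-- Laplacian by parts -/
lemma LL_parts {U g : Cfg d N → ℝ} (hU : Per U) (hg : Per g) :
    (II fun x => LL U x * g x) = - ∑ j, ∑ i, II fun x => pd j i U x * pd j i g x := by
  have c1 : ∀ j i, Continuous (pd j i (pd j i U)) := fun j i => (hU.pd j i).pdc j i
  have cg := hg.cont
  have : (II fun x => LL U x * g x) = II fun x => ∑ j, ∑ i, pd j i (pd j i U) x * g x :=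
    II_congr fun x => by unfold LL; rw [Finset.sum_mul]; simp only [Finset.sum_mul]
  rw [this, II_sum2 fun j i => by have := c1 j i; fun_prop, ← Finset.sum_neg_distrib]
  refine Finset.sum_congr rfl fun j _ => ?_
  rw [← Finset.sum_neg_distrib]
  exact Finset.sum_congr rfl fun i _ => ibp2 (hU.pd j i) hg j i

lemma jastrow {U f : Cfg d N → ℝ} (hU : Per U) (hf : Per f) :
    TT f f = (II fun x => ∑ j, ∑ i, (pd j i f x + pd j i U x * f x) ^ 2) +
      II fun x => (LL U x - GG U x) * f x ^ 2 := by
  have cU := hU.cont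
  have cf := hf.cont
  have cpU : ∀ j i, Continuous (pd j i U) := fun j i => hU.pdc j i
  have cpf : ∀ j i, Continuous (pd j i f) := fun j i => hf.pdc j i
  have cL := LL_cont hU
  have cG := GG_cont hU
  have h1 := LL_parts hU (hf.mul hf)
  have h2 : (II fun x => (LL U x - GG U x) * f x ^ 2) =
      (II fun x => LL U x * (f x * f x)) - II fun x => ∑ j, ∑ i, (pd j i U x * f x) ^ 2 := by
    rw [← II_sub (by fun_prop) (by fun_prop)]
    refine II_congr fun x => ?_
    have : GG U x * f x ^ 2 = ∑ j, ∑ i, (pd j i U x * f x) ^ 2 := by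
      unfold GG; rw [Finset.sum_mul]; simp only [Finset.sum_mul, mul_pow]
    rw [← this]; ring
  rw [h2, h1, TT_II hf hf, ← II_sum2 (F := fun j i x => pd j i U x * pd j i (fun x => f x * f x) x)
      fun j i => (hU.pdc j i).mul ((hf.mul hf).pdc j i),
    ← II_neg]
  have cff : ∀ j i, Continuous (pd j i fun x => f x * f x) := fun j i => (hf.mul hf).pdc j i
  rw [← II_sub (by fun_prop) (by fun_prop), ← II_add (by fun_prop) (by fun_prop)]
  refine II_congr fun x => ?_
  simp only [pd_mul hf hf]
  simp only [← Finset.sum_neg_distrib, ← Finset.sum_sub_distrib, ← Finset.sum_add_distrib]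
  exact Finset.sum_congr rfl fun j _ => Finset.sum_congr rfl fun i _ => by ring

lemma jastrow_le {U f : Cfg d N → ℝ} (hU : Per U) (hf : Per f) :
    (II fun x => (LL U x - GG U x) * f x ^ 2) ≤ TT f f := by
  rw [jastrow hU hf]
  have : 0 ≤ II fun x => ∑ j, ∑ i, (pd j i f x + pd j i U x * f x) ^ 2 :=
    II_nonneg fun x => Finset.sum_nonneg fun _ _ => Finset.sum_nonneg fun _ _ => sq_nonneg _
  linarith

lemma jastrow_eq {U : Cfg d N → ℝ} (hU : Per U) :
    TT (fun x => Real.exp (-1 * U x)) (fun x => Real.exp (-1 * U x)) =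
      II fun x => (LL U x - GG U x) * Real.exp (-1 * U x) ^ 2 := by
  rw [jastrow hU (hU.cmul (-1)).exp]
  have : (II fun x => ∑ j, ∑ i, (pd j i (fun x => Real.exp (-1 * U x)) x +
      pd j i U x * Real.exp (-1 * U x)) ^ 2) = II fun _ : Cfg d N => (0:ℝ) := by
    refine II_congr fun x => ?_
    refine Finset.sum_eq_zero fun j _ => Finset.sum_eq_zero fun i _ => ?_
    rw [pd_exp (hU.cmul (-1)), pd_cmul _ hU]; ring
  rw [this, II_const, zero_add]

/-- cross term -/
def XX (k l : Fin d → ℤ) (x : Cfg d N) : ℝ := ∑ a, (sk k a x * sk l a x + rk k a x * rk l a x)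

lemma XX_eq (k l : Fin d → ℤ) (x : Cfg d N) :
    XX k l x = (CC k x * CC l x + SS k x * SS l x) * CC (k - l) x -
      (CC k x * SS l x - SS k x * CC l x) * SS (k - l) x := by
  have h : ∀ a, sk k a x * sk l a x + rk k a x * rk l a x =
      (CC k x * CC l x + SS k x * SS l x) * Real.cos (th (k - l) (x a)) -
      (CC k x * SS l x - SS k x * CC l x) * Real.sin (th (k - l) (x a)) := by
    intro a
    unfold sk rk
    rw [th_subk, Real.cos_sub, Real.sin_sub]
    ring
  unfold XX
  rw [Finset.sum_congr rfl fun a _ => h a, Finset.sum_sub_distrib, ← Finset.mul_sum,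
    ← Finset.mul_sum]
  rfl

lemma XX_sq (k l : Fin d → ℤ) (x : Cfg d N) :
    XX k l x ^ 2 ≤ AA k x * AA l x * AA (k - l) x := by
  rw [XX_eq]
  unfold AA
  nlinarith [sq_nonneg ((CC k x * CC l x + SS k x * SS l x) * SS (k - l) x +
      (CC k x * SS l x - SS k x * CC l x) * CC (k - l) x)]

lemma XX_diag (k : Fin d → ℤ) (x : Cfg d N) : XX k k x = N * AA k x := by
  have h0 : ∀ y : Fin d → ℝ, th (0 : Fin d → ℤ) y = 0 := fun y => by simp [th]
  rw [XX_eq, sub_self]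
  have e1 : CC (0 : Fin d → ℤ) x = N := by simp [CC, h0]
  rw [e1]
  unfold AA
  ring

lemma XX_abs (k l : Fin d → ℤ) (x : Cfg d N) {κ : ℝ} (hκ : 0 < κ) :
    |XX k l x| ≤ κ * (AA k x ^ 2 + AA l x ^ 2) + AA (k - l) x / κ := by
  refine abs_le_of_sq_le_sq ?_ ?_
  · have h1 := AA_nonneg k x
    have h2 := AA_nonneg l x
    have h3 := AA_nonneg (k - l) x
    have e : (κ * (AA k x ^ 2 + AA l x ^ 2) + AA (k - l) x / κ) ^ 2 =
        (κ * (AA k x ^ 2 + AA l x ^ 2) - AA (k - l) x / κ) ^ 2 +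
        4 * (AA k x ^ 2 + AA l x ^ 2) * AA (k - l) x := by field_simp; ring
    rw [e]
    refine (XX_sq k l x).trans ?_
    have : AA k x * AA l x ≤ 4 * (AA k x ^ 2 + AA l x ^ 2) := by
      nlinarith [sq_nonneg (AA k x - AA l x), sq_nonneg (AA k x + AA l x)]
    nlinarith [mul_le_mul_of_nonneg_right this h3,
      sq_nonneg (κ * (AA k x ^ 2 + AA l x ^ 2) - AA (k - l) x / κ)]
  · have h3 := AA_nonneg (k - l) x
    positivity

lemma sum_sk_sq (k : Fin d → ℤ) (x : Cfg d N) : ∑ a, sk k a x ^ 2 ≤ N * AA k x := by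
  rw [← XX_diag]
  unfold XX
  refine Finset.sum_le_sum fun a _ => ?_
  nlinarith [mul_self_nonneg (rk k a x)]

lemma GG_AA (k : Fin d → ℤ) (x : Cfg d N) : GG (AA k) x ≤ 4 * pSq d k * (N * AA k x) := by
  unfold GG
  have h : ∀ j i, pd j i (AA k) x ^ 2 = (2 * π * k i) ^ 2 * (4 * sk k j x ^ 2) := by
    intro j i; rw [pd_AA]; ring
  simp only [h, ← Finset.sum_mul]
  rw [← Finset.mul_sum, ← Finset.mul_sum]
  have h1 : (0:ℝ) ≤ pSq d k := Finset.sum_nonneg fun i _ => sq_nonneg _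
  have h2 := mul_le_mul_of_nonneg_left (sum_sk_sq k x) h1
  change pSq d k * _ ≤ _
  nlinarith

lemma AA_le (k : Fin d → ℤ) (x : Cfg d N) : AA k x ≤ N ^ 2 := by
  rw [AA_double]
  have : ∑ a : Fin N, ∑ b : Fin N, cw k (x a - x b) ≤ ∑ a : Fin N, ∑ b : Fin N, (1:ℝ) :=
    Finset.sum_le_sum fun a _ => Finset.sum_le_sum fun b _ => Real.cos_le_one _
  simpa [pow_two] using this

lemma pSq_nonneg (k : Fin d → ℤ) : 0 ≤ pSq d k := Finset.sum_nonneg fun i _ => sq_nonneg _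

lemma pSq_ge {k : Fin d → ℤ} (hk : k ≠ 0) : 1 ≤ pSq d k := by
  obtain ⟨i, hi⟩ : ∃ i, k i ≠ 0 := by
    by_contra h; push Not at h; exact hk (funext h)
  have h1 : (2 * π * (k i : ℝ)) ^ 2 ≤ pSq d k :=
    Finset.single_le_sum (f := fun i => (2 * π * (k i : ℝ)) ^ 2) (fun i _ => sq_nonneg _)
      (Finset.mem_univ i)
  have h2 : (1:ℝ) ≤ (k i : ℝ) ^ 2 := by
    have : 1 ≤ (k i) ^ 2 := by
      have := sq_pos_of_ne_zero hi
      omega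
    exact_mod_cast this
  have h3 := Real.pi_gt_three
  have h4 : (1:ℝ) ≤ (2 * π) ^ 2 := by nlinarith
  rw [mul_pow] at h1
  nlinarith [mul_le_mul h4 h2 zero_le_one (by positivity)]

end waves2

section jas
variable {d N : ℕ}

/-- Jastrow exponent -/
def UU (S : Finset (Fin d → ℤ)) (c : (Fin d → ℤ) → ℝ) (x : Cfg d N) : ℝ :=
  ∑ k ∈ S, (c k / (2 * N)) * AA k x

lemma Sm_UU (S : Finset (Fin d → ℤ)) (c : (Fin d → ℤ) → ℝ) : Sm (UU S c : Cfg d N → ℝ) :=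
  Sm.sum fun k _ => (Sm_AA k).cmul _

/-- inner product of momenta -/
def dt (k l : Fin d → ℤ) : ℝ := ∑ i, (2 * π * (k i : ℝ)) * (2 * π * (l i : ℝ))

lemma dt_self (k : Fin d → ℤ) : dt k k = pSq d k :=
  Finset.sum_congr rfl fun i _ => by ring

lemma pd_UU (S : Finset (Fin d → ℤ)) (c : (Fin d → ℤ) → ℝ) (j : Fin N) (i : Fin d) (x : Cfg d N) :
    pd j i (UU S c) x = -(1 / N) * ∑ k ∈ S, c k * (2 * π * k i) * sk k j x := by
  have := pd_sum (s := S) (fun k _ => (Per_AA k).cmul (c k / (2 * N))) j i x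
  refine this.trans ?_
  rw [Finset.mul_sum]
  refine Finset.sum_congr rfl fun k _ => ?_
  rw [pd_cmul _ (Per_AA k), pd_AA]
  by_cases hN : (N : ℝ) = 0
  · simp [hN]
  · field_simp

lemma LL_UU (hN : 0 < N) (S : Finset (Fin d → ℤ)) (c : (Fin d → ℤ) → ℝ) (x : Cfg d N) :
    LL (UU S c) x = ∑ k ∈ S, c k * pSq d k * (1 - AA k x / N) := by
  have hN' : (N : ℝ) ≠ 0 := by positivity
  have h : ∀ j i, pd j i (pd j i (UU S c)) x =
      ∑ k ∈ S, (c k / (2 * N)) * pd j i (pd j i (AA k)) x := by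
    intro j i
    have e : pd j i (UU S c) = fun x : Cfg d N => ∑ k ∈ S, (c k / (2 * N)) * pd j i (AA k) x := by
      funext x
      refine (pd_sum (s := S) (fun k _ => (Per_AA k).cmul (c k / (2 * N))) j i x).trans ?_
      exact Finset.sum_congr rfl fun k _ => pd_cmul _ (Per_AA k) _ _ _
    rw [e]
    refine (pd_sum (s := S) (fun k _ => ((Per_AA k).pd j i).cmul (c k / (2 * N))) j i x).trans ?_
    exact Finset.sum_congr rfl fun k _ => pd_cmul _ ((Per_AA k).pd j i) _ _ _
  unfold LL
  simp only [h]
  rw [Finset.sum_congr rfl fun j _ => Finset.sum_comm, Finset.sum_comm]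
  refine Finset.sum_congr rfl fun k _ => ?_
  simp only [← Finset.mul_sum]
  have := LL_AA k x
  unfold LL at this
  rw [this]
  field_simp
  ring

/-- off-diagonal part -/
def Off (S : Finset (Fin d → ℤ)) (c : (Fin d → ℤ) → ℝ) (x : Cfg d N) : ℝ :=
  ∑ k ∈ S, ∑ l ∈ S.erase k, c k * c l * dt k l * XX k l x

lemma GG_UU {S : Finset (Fin d → ℤ)} (hS : ∀ k ∈ S, -k ∈ S) {c : (Fin d → ℤ) → ℝ}
    (hc : ∀ k, c (-k) = c k) (x : Cfg d N) :
    GG (UU S c) x = (1 / N ^ 2) * ∑ k ∈ S, ∑ l ∈ S, c k * c l * dt k l * XX k l x := by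
  have hodd : ∀ (j : Fin N) (i : Fin d), ∑ k ∈ S, c k * (2 * π * k i) * rk k j x = 0 := by
    intro j i
    have h1 : ∑ k ∈ S, c k * (2 * π * k i) * rk k j x =
        ∑ k ∈ S, -(c k * (2 * π * k i) * rk k j x) := by
      refine Finset.sum_nbij' (fun k => -k) (fun k => -k) hS hS (fun k _ => neg_neg k)
        (fun k _ => neg_neg k) fun k _ => ?_
      have h2 : rk (-k) j x = rk k j x := by
        unfold rk CC SS
        simp only [th_negk, Real.cos_neg, Real.sin_neg, Finset.sum_neg_distrib]
        ring
      rw [hc, h2]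
      simp
    rw [Finset.sum_neg_distrib] at h1
    linarith
  have h3 : ∀ (j : Fin N) (i : Fin d), pd j i (UU S c) x ^ 2 = (1 / N ^ 2) *
      ∑ k ∈ S, ∑ l ∈ S, c k * c l * ((2 * π * k i) * (2 * π * l i)) *
        (sk k j x * sk l j x + rk k j x * rk l j x) := by
    intro j i
    rw [pd_UU]
    have h4 : (∑ k ∈ S, c k * (2 * π * k i) * sk k j x) ^ 2 =
        (∑ k ∈ S, c k * (2 * π * k i) * sk k j x) * (∑ k ∈ S, c k * (2 * π * k i) * sk k j x) +
        (∑ k ∈ S, c k * (2 * π * k i) * rk k j x) * (∑ k ∈ S, c k * (2 * π * k i) * rk k j x) := by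
      rw [hodd]; ring
    rw [mul_pow, h4, Finset.sum_mul_sum, Finset.sum_mul_sum, ← Finset.sum_add_distrib]
    have h5 : (-(1 / (N:ℝ))) ^ 2 = 1 / N ^ 2 := by rw [neg_sq, div_pow, one_pow]
    rw [h5]
    congr 1
    refine Finset.sum_congr rfl fun k _ => ?_
    rw [← Finset.sum_add_distrib]
    exact Finset.sum_congr rfl fun l _ => by ring
  unfold GG
  simp only [h3, ← Finset.mul_sum]
  congr 1
  rw [Finset.sum_congr rfl fun j _ => Finset.sum_comm]
  rw [Finset.sum_comm]
  refine Finset.sum_congr rfl fun k _ => ?_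
  rw [Finset.sum_congr rfl fun j _ => Finset.sum_comm]
  rw [Finset.sum_comm]
  refine Finset.sum_congr rfl fun l _ => ?_
  unfold dt XX
  rw [Finset.mul_sum]
  refine Finset.sum_congr rfl fun j _ => ?_
  rw [Finset.mul_sum, Finset.sum_mul]

lemma GG_UU' (hN : 0 < N) {S : Finset (Fin d → ℤ)} (hS : ∀ k ∈ S, -k ∈ S) {c : (Fin d → ℤ) → ℝ}
    (hc : ∀ k, c (-k) = c k) (x : Cfg d N) :
    GG (UU S c) x = (∑ k ∈ S, c k ^ 2 * pSq d k * (AA k x / N)) + (1 / N ^ 2) * Off S c x := by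
  have hN' : (N : ℝ) ≠ 0 := by positivity
  rw [GG_UU hS hc]
  have : ∀ k ∈ S, ∑ l ∈ S, c k * c l * dt k l * XX k l x =
      N ^ 2 * (c k ^ 2 * pSq d k * (AA k x / N)) +
        ∑ l ∈ S.erase k, c k * c l * dt k l * XX k l x := by
    intro k hk
    rw [← Finset.add_sum_erase _ _ hk, dt_self, XX_diag]
    congr 1
    field_simp
  rw [Finset.sum_congr rfl this, Finset.sum_add_distrib, ← Finset.mul_sum]
  unfold Off
  field_simp

lemma G_ident (hN : 0 < N) {hw : (Fin d → ℤ) → ℝ} (h : HW hw) {S : Finset (Fin d → ℤ)}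
    (hS : ∀ k ∈ S, -k ∈ S) {c : (Fin d → ℤ) → ℝ} (hc : ∀ k, c (-k) = c k)
    (hq : ∀ k ∈ S, c k * pSq d k + c k ^ 2 * pSq d k = hw k / 2) (x : Cfg d N) :
    LL (UU S c) x - GG (UU S c) x + (1 / N) * Wf (wOf d hw) x =
      ∑ k ∈ S, (c k * pSq d k - hw k / 2) + (1 / N) * Wf (wOf d (tl S hw)) x -
        (1 / N ^ 2) * Off S c x := by
  have hN' : (N : ℝ) ≠ 0 := by positivity
  rw [LL_UU hN, GG_UU' hN hS hc, Wf_split h S, mul_add, Finset.mul_sum]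
  have : ∑ k ∈ S, (c k * pSq d k - hw k / 2) = ∑ k ∈ S, c k * pSq d k * (1 - AA k x / N) -
      ∑ k ∈ S, c k ^ 2 * pSq d k * (AA k x / N) + ∑ k ∈ S, 1 / N * (hw k * ((AA k x - N) / 2)) := by
    rw [← Finset.sum_sub_distrib, ← Finset.sum_add_distrib]
    refine Finset.sum_congr rfl fun k hk => ?_
    have e := hq k hk
    field_simp
    linear_combination (2 * AA k x) * e
  rw [this]
  ring

lemma XX_cont (k l : Fin d → ℤ) : Continuous (XX k l : Cfg d N → ℝ) := by
  have h1 := fun k => (Per_CC (N := N) (d := d) k).cont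
  have h2 := fun k => (Per_SS (N := N) (d := d) k).cont
  have : (XX k l : Cfg d N → ℝ) = fun x => (CC k x * CC l x + SS k x * SS l x) * CC (k - l) x -
      (CC k x * SS l x - SS k x * CC l x) * SS (k - l) x := funext fun x => XX_eq k l x
  rw [this]
  have a1 := h1 k
  have a2 := h1 l
  have a3 := h1 (k - l)
  have a4 := h2 k
  have a5 := h2 l
  have a6 := h2 (k - l)
  fun_prop

lemma Off_cont (S : Finset (Fin d → ℤ)) (c : (Fin d → ℤ) → ℝ) :
    Continuous (Off S c : Cfg d N → ℝ) := by
  unfold Off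
  have := fun k l => XX_cont (N := N) (d := d) k l
  fun_prop

/-- prefactor -/
def K0 (S : Finset (Fin d → ℤ)) (c : (Fin d → ℤ) → ℝ) : ℝ :=
  ∑ k ∈ S, ∑ l ∈ S.erase k, |c k * c l * dt k l|

lemma K0_nonneg (S : Finset (Fin d → ℤ)) (c : (Fin d → ℤ) → ℝ) : 0 ≤ K0 S c :=
  Finset.sum_nonneg fun _ _ => Finset.sum_nonneg fun _ _ => abs_nonneg _

lemma off_bound (hN : 0 < N) {S : Finset (Fin d → ℤ)} {c : (Fin d → ℤ) → ℝ} {ρ : Cfg d N → ℝ}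
    (hρc : Continuous ρ) (hρ : ∀ x, 0 ≤ ρ x) {D κ : ℝ} (hκ : 0 < κ)
    (h2 : ∀ k ∈ S, (II fun x => AA k x ^ 2 * ρ x) ≤ D * N ^ 2)
    (h1 : ∀ r : Fin d → ℤ, r ≠ 0 → (II fun x => AA r x * ρ x) ≤ D * (N * √N)) :
    (1 / N ^ 2) * |II fun x => Off S c x * ρ x| ≤ K0 S c * (D * (2 * κ + 1 / (κ * √N))) := by
  have cA := fun k => (Per_AA (N := N) (d := d) k).cont
  have cX := fun k l => XX_cont (N := N) (d := d) k l
  have hN' : (0:ℝ) < N := by exact_mod_cast hN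
  have key : ∀ k ∈ S, ∀ l ∈ S.erase k, |II fun x => XX k l x * ρ x| ≤
      N ^ 2 * (D * (2 * κ + 1 / (κ * √N))) := by
    intro k hk l hl
    have hne : k - l ≠ 0 := sub_ne_zero.2 (Finset.ne_of_mem_erase hl).symm
    have a1 := cA k
    have a2 := cA l
    have a3 := cA (k - l)
    have a4 := cX k l
    have b1 := h2 k hk
    have b2 := h2 l (Finset.mem_of_mem_erase hl)
    have b3 := h1 _ hne
    have e1 : (II fun x => |XX k l x * ρ x|) ≤ II fun x => κ * (AA k x ^ 2 * ρ x) +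
        (κ * (AA l x ^ 2 * ρ x) + (1 / κ) * (AA (k - l) x * ρ x)) := by
      refine II_mono (by fun_prop) (by fun_prop) fun x => ?_
      rw [abs_mul, abs_of_nonneg (hρ x)]
      refine (mul_le_mul_of_nonneg_right (XX_abs k l x hκ) (hρ x)).trans (le_of_eq ?_)
      ring
    rw [II_add (by fun_prop) (by fun_prop), II_add (by fun_prop) (by fun_prop), II_cmul, II_cmul,
      II_cmul] at e1
    refine II_abs.trans (e1.trans ?_)
    have hs : 0 < √(N:ℝ) := Real.sqrt_pos.2 hN'
    have hs2 : √(N:ℝ) * √N = N := Real.mul_self_sqrt hN'.le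
    have e2 : (1 / κ) * (D * (N * √N)) = N ^ 2 * (D * (1 / (κ * √N))) := by
      field_simp
      rw [pow_two, hs2]
    have e3 := mul_le_mul_of_nonneg_left b3 (one_div_pos.2 hκ).le
    rw [e2] at e3
    nlinarith [mul_le_mul_of_nonneg_left b1 hκ.le, mul_le_mul_of_nonneg_left b2 hκ.le]
  have e : (II fun x => Off S c x * ρ x) =
      ∑ k ∈ S, ∑ l ∈ S.erase k, (c k * c l * dt k l) * II fun x => XX k l x * ρ x := by
    have : (II fun x => Off S c x * ρ x) = II fun x =>
        ∑ k ∈ S, ∑ l ∈ S.erase k, (c k * c l * dt k l) * (XX k l x * ρ x) := by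
      refine II_congr fun x => ?_
      unfold Off
      rw [Finset.sum_mul]
      refine Finset.sum_congr rfl fun k _ => ?_
      rw [Finset.sum_mul]
      exact Finset.sum_congr rfl fun l _ => by ring
    rw [this, II_sum fun k _ => by have := cX k; fun_prop]
    refine Finset.sum_congr rfl fun k _ => ?_
    rw [II_sum fun l _ => by have := cX k l; fun_prop]
    exact Finset.sum_congr rfl fun l _ => II_cmul _
  rw [e]
  have : |∑ k ∈ S, ∑ l ∈ S.erase k, (c k * c l * dt k l) * II fun x => XX k l x * ρ x| ≤
      K0 S c * (N ^ 2 * (D * (2 * κ + 1 / (κ * √N)))) := by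
    unfold K0
    rw [Finset.sum_mul]
    refine (Finset.abs_sum_le_sum_abs _ _).trans (Finset.sum_le_sum fun k hk => ?_)
    rw [Finset.sum_mul]
    refine (Finset.abs_sum_le_sum_abs _ _).trans (Finset.sum_le_sum fun l hl => ?_)
    rw [abs_mul]
    exact mul_le_mul_of_nonneg_left (key k hk l hl) (abs_nonneg _)
  rw [div_mul_eq_mul_div, one_mul, div_le_iff₀ (by positivity)]
  refine this.trans (le_of_eq (by ring))

end jas

section conv
variable {d N : ℕ}

lemma II_AA {k : Fin d → ℤ} (hk : k ≠ 0) : (II fun x : Cfg d N => AA k x) = N := by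
  have cW := Wf_cont (N := N) (cw_Wok hk)
  rw [II_congr fun x => AA_Wf k x, II_add (by fun_prop) (by fun_prop), II_const, II_cmul,
    IIW_zero (cw_Wok hk)]
  ring

lemma II_AA_sq {k : Fin d → ℤ} (hk : k ≠ 0) : (II fun x : Cfg d N => AA k x ^ 2) ≤ 3 * N ^ 2 := by
  have h1 := LL_parts (N := N) (Per_AA k) (Per_AA k)
  have cA := (Per_AA (N := N) k).cont
  have cG := GG_cont (Per_AA (N := N) k)
  have hp := pSq_ge hk
  rw [← II_sum2 (F := fun j i x => pd j i (AA k) x * pd j i (AA k) x)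
    fun j i => ((Per_AA k).pdc j i).mul ((Per_AA k).pdc j i)] at h1
  have h2 : (II fun x : Cfg d N => ∑ j, ∑ i, pd j i (AA k) x * pd j i (AA k) x) ≤
      II fun x : Cfg d N => (4 * pSq d k * N) * AA k x := by
    rw [II_congr (g := fun x : Cfg d N => GG (AA k) x) fun x => by unfold GG; simp only [pow_two]]
    exact II_mono cG (by fun_prop) fun x => (GG_AA k x).trans (le_of_eq (by ring))
  rw [II_cmul, II_AA hk] at h2
  have h3 : (II fun x : Cfg d N => LL (AA k) x * AA k x) =
      (-2 * pSq d k) * ((II fun x : Cfg d N => AA k x ^ 2) - N * N) := by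
    rw [II_congr (g := fun x : Cfg d N => (-2 * pSq d k) * (AA k x ^ 2 - N * AA k x))
      fun x => by rw [LL_AA]; ring]
    rw [II_cmul, II_sub (by fun_prop) (by fun_prop), II_cmul, II_AA hk]
  rw [h3] at h1
  have h4 : pSq d k * (II fun x : Cfg d N => AA k x ^ 2) ≤ pSq d k * (3 * N ^ 2) := by nlinarith
  exact le_of_mul_le_mul_left h4 (by linarith)

lemma II_AA_f {k : Fin d → ℤ} (hk : k ≠ 0) {f : Cfg d N → ℝ} (hf : Continuous f) (h1 : n2 f = 1) :
    (II fun x => AA k x * f x ^ 2) ≤ (1 + 2 * √(M1 f)) * (N * √N) := by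
  have hw := cw_Wok (d := d) hk
  have cW := Wf_cont (N := N) hw
  have e : (II fun x => AA k x * f x ^ 2) = N * n2 f + 2 * II fun x => Wf (cw k) x * (f x * f x) := by
    unfold n2
    rw [← II_cmul, ← II_cmul, ← II_add (by fun_prop) (by fun_prop)]
    exact II_congr fun x => by rw [AA_Wf]; ring
  have h2 : (II fun x => Wf (cw k) x * (f x * f x)) ≤ N * √(N * M1 f) := by
    rw [II_Wf hw (by fun_prop)]
    have h3 : ∑ j, ∑ l, (II fun x => pw (cw k) j l x * (f x * f x)) ≤
        ∑ j, ∑ l : Fin N, 2 * √(n2 (Qp j f)) := by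
      refine Finset.sum_le_sum fun j _ => Finset.sum_le_sum fun l _ => ?_
      have := (abs_le.1 (pw_bound hw j l hf)).2
      rw [h1, Real.sqrt_one] at this
      linarith
    have h4 := sq_sum_le_card fun j => √(n2 (Qp j f))
    simp only [Real.sq_sqrt (n2_nonneg _)] at h4
    have h5 : ∑ j, √(n2 (Qp j f)) ≤ √(N * M1 f) := Real.le_sqrt_of_sq_le h4
    simp only [Finset.sum_const, Finset.card_univ, Fintype.card_fin, nsmul_eq_mul] at h3
    rw [← Finset.mul_sum, ← Finset.mul_sum] at h3
    have hN : (0:ℝ) ≤ N := Nat.cast_nonneg N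
    nlinarith [mul_le_mul_of_nonneg_left h5 hN]
  rw [e, h1]
  rw [Real.sqrt_mul (Nat.cast_nonneg N)] at h2
  have h6 : (N:ℝ) ≤ N * √N := by
    rcases Nat.eq_zero_or_pos N with h | h
    · simp [h]
    · have : (1:ℝ) ≤ √N := Real.one_le_sqrt.2 (by exact_mod_cast h)
      nlinarith [(Nat.cast_nonneg N : (0:ℝ) ≤ N)]
  nlinarith

lemma TT_mul_le {g f : Cfg d N → ℝ} (hg : Per g) (hf : Per f) {b1 b2 : ℝ} 
    (h1 : ∀ x, GG g x ≤ b1) (h2 : ∀ x, g x ^ 2 ≤ b2) :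
    TT (fun x => g x * f x) (fun x => g x * f x) ≤ 2 * b1 * n2 f + 2 * b2 * TT f f := by
  have cg := hg.cont
  have cf := hf.cont
  have cG := GG_cont hf
  have cp : ∀ j i, Continuous (pd j i fun x => g x * f x) := fun j i => (hg.mul hf).pdc j i
  rw [TT_II (hg.mul hf) (hg.mul hf), TT_II hf hf]
  have e : (II fun x => ∑ j, ∑ i, pd j i f x * pd j i f x) = II (GG f) :=
    II_congr fun x => by unfold GG; simp only [pow_two]
  rw [e]
  unfold n2
  rw [← II_cmul, ← II_cmul, ← II_add (by fun_prop) (by fun_prop)]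
  refine II_mono (by fun_prop) (by fun_prop) fun x => ?_
  have h3 : ∑ j, ∑ i, pd j i (fun x => g x * f x) x * pd j i (fun x => g x * f x) x ≤
      ∑ j, ∑ i, (pd j i g x ^ 2 * (2 * f x ^ 2) + pd j i f x ^ 2 * (2 * g x ^ 2)) := by
    refine Finset.sum_le_sum fun j _ => Finset.sum_le_sum fun i _ => ?_
    rw [pd_mul hg hf]
    nlinarith [sq_nonneg (pd j i g x * f x - g x * pd j i f x)]
  refine h3.trans ?_
  simp only [Finset.sum_add_distrib, ← Finset.sum_mul]
  change GG g x * _ + GG f x * _ ≤ _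
  have := GG_nonneg f x
  nlinarith [mul_le_mul_of_nonneg_right (h1 x) (sq_nonneg (f x)),
    mul_le_mul_of_nonneg_right (h2 x) this]

/-- lower bound of the kinetic form against `g f` -/
lemma TT_gf_lower {g f : Cfg d N → ℝ} (hg : Per g) (hf : Per f) (h0 : ∀ x, 0 ≤ g x) :
    -(1 / 2) * (II fun x => LL g x * (f x * f x)) ≤ TT (fun x => g x * f x) f := by
  rw [LL_parts hg (hf.mul hf)]
  have cg := hg.cont
  have cf := hf.cont
  have cp : ∀ j i, Continuous (pd j i fun x => g x * f x) := fun j i => (hg.mul hf).pdc j i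
  have cp2 : ∀ j i, Continuous (pd j i fun x => f x * f x) := fun j i => (hf.mul hf).pdc j i
  have cp1 : ∀ j i, Continuous (pd j i f) := fun j i => hf.pdc j i
  have cp3 : ∀ j i, Continuous (pd j i g) := fun j i => hg.pdc j i
  unfold TT
  have e : ∀ S : ℝ, -(1 / 2) * -S = (1 / 2) * S := fun S => by ring
  rw [e, Finset.mul_sum]
  refine Finset.sum_le_sum fun j _ => ?_
  rw [Finset.mul_sum]
  refine Finset.sum_le_sum fun i _ => ?_
  have a1 := cp j i
  have a2 := cp2 j i
  have a3 := cp3 j i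
  have a4 := cp1 j i
  rw [← II_cmul]
  refine II_mono (by fun_prop) (by fun_prop) fun x => ?_
  rw [pd_mul hf hf, pd_mul hg hf]
  nlinarith [mul_nonneg (h0 x) (mul_self_nonneg (pd j i f x))]

lemma Wf_ge {hw : (Fin d → ℤ) → ℝ} (h : HW hw) (k : Fin d → ℤ) (hN : 0 < N) (x : Cfg d N) :
    hw k * AA k x / (2 * N) - (∑' k, hw k) / 2 ≤ (1 / N) * Wf (wOf d hw) x := by
  have h1 := Wf_split h {k} x
  have h2 := Wf_lower (wOf_Wok (h.tl {k})) x
  have h3 := tl_tsum h {k}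
  rw [Finset.sum_singleton] at h1 h3
  have hN' : (0:ℝ) < N := by exact_mod_cast hN
  rw [h3, h1, one_div, ← div_eq_inv_mul, le_div_iff₀ hN']
  have : (hw k * AA k x / (2 * N) - (hw k + ∑' k_1, tl {k} hw k_1) / 2) * N =
    hw k * ((AA k x - N) / 2) + -(N * (∑' k_1, tl {k} hw k_1) / 2) := by field_simp; ring
  rw [this]
  linarith

set_option maxHeartbeats 1000000 in
lemma second_moment {hw : (Fin d → ℤ) → ℝ} (h : HW hw) {k : Fin d → ℤ} (hk : 0 < hw k) :
    ∃ D : ℝ, 0 ≤ D ∧ ∀ N : ℕ, 0 < N → ∃ ε0 : ℝ, 0 < ε0 ∧ ε0 ≤ 1 ∧ ∀ ε, 0 < ε → ε ≤ ε0 →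
      ∀ f : Cfg d N → ℝ, NM (1 / N) (wOf d hw) ε f → (II fun x => AA k x ^ 2 * f x ^ 2) ≤ D * N ^ 2 := by
  set B := ∑' k, hw k with hB
  have hB0 : 0 ≤ B := tsum_nonneg h.nn
  have hp := pSq_nonneg k
  refine ⟨2 / hw k * (1 + B * (B + 2) / (2 * hw k) + pSq d k), by positivity, fun N hN => ?_⟩
  have hN' : (0:ℝ) < N := by exact_mod_cast hN
  have hN1 : (1:ℝ) ≤ N := by exact_mod_cast hN
  have hW := wOf_Wok h
  rw [← hB] at hW
  set lam : ℝ := 1 / N with hlam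
  have hl : 0 ≤ lam := by positivity
  set Cc : ℝ := 2 * (4 * pSq d k * N ^ 3) * 1 + 2 * N ^ 4 * (lam * (N * B / 2) + 1) +
    (lam * (N ^ 2 * B) + lam * (N * B / 2)) * N ^ 4 with hCc
  have hC0 : 0 ≤ Cc := by positivity
  refine ⟨1 / (1 + Cc), by positivity, by rw [div_le_one (by positivity)]; linarith,
    fun ε hε hε0 f hf => ?_⟩
  have hε1 : ε ≤ 1 := hε0.trans (by rw [div_le_one (by positivity)]; linarith)
  have hεC : ε * Cc ≤ 1 := by
    have := mul_le_mul_of_nonneg_right hε0 hC0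
    refine this.trans ?_
    rw [div_mul_eq_mul_div, one_mul, div_le_one (by positivity)]; linarith
  have hP := hf.sm.toPer
  have cf := hP.cont
  have cA := (Per_AA (N := N) k).cont
  have cW := Wf_cont (N := N) hW
  have hχ := (Sm_AA k).mul hf.sm
  have h1 := eps_lemma hW hl hf hχ
  have h2 := b_upper (N := N) hW hl hχ.toPer
  have h3 : TT (fun x => AA k x * f x) (fun x => AA k x * f x) ≤
      2 * (4 * pSq d k * N ^ 3) * n2 f + 2 * N ^ 4 * TT f f := by
    refine TT_mul_le (Per_AA k) hP (fun x => (GG_AA k x).trans ?_) fun x => ?_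
    · have := mul_le_mul_of_nonneg_left (AA_le k x) (by positivity : (0:ℝ) ≤ 4 * pSq d k * N)
      nlinarith
    · have := AA_le k x
      have h0 := AA_nonneg k x
      nlinarith
  have h4 : n2 (fun x => AA k x * f x) ≤ N ^ 4 := by
    have : n2 (fun x => AA k x * f x) ≤ (N ^ 4) * n2 f := by
      unfold n2
      rw [← II_cmul]
      refine II_mono (by fun_prop) (by fun_prop) fun x => ?_
      have := AA_le k x
      have h0 := AA_nonneg k x
      rw [mul_pow]
      refine mul_le_mul_of_nonneg_right ?_ (sq_nonneg _)
      nlinarith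
    rwa [hf.nrm, mul_one] at this
  have h5 := hf.TT_le hW hl
  have h6 : (qq lam (wOf d hw) (fun x => AA k x * f x) f -
      GSE d N lam (wOf d hw) * II fun x => AA k x * f x * f x) ^ 2 ≤ 1 := by
    refine h1.trans (le_trans (mul_le_mul_of_nonneg_left (h2.trans ?_) hε.le) hεC)
    rw [hf.nrm] at h3
    have h7 : 2 * (N:ℝ) ^ 4 * TT f f ≤ 2 * N ^ 4 * (lam * (N * B / 2) + 1) :=
      mul_le_mul_of_nonneg_left (by linarith) (by positivity)
    have h8 : (lam * (N ^ 2 * B) + lam * (N * B / 2)) * n2 (fun x => AA k x * f x) ≤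
      (lam * (N ^ 2 * B) + lam * (N * B / 2)) * N ^ 4 :=
      mul_le_mul_of_nonneg_left h4 (by positivity)
    linarith
  have h7 := (abs_le_of_sq_le_sq' (h6.trans (by norm_num : (1:ℝ) ≤ 1 ^ 2)) zero_le_one).2
  have h8 := GSE_nonpos (N := N) hW hl
  set a1 := II fun x => AA k x * f x ^ 2 with ha1
  set a2 := II fun x => AA k x ^ 2 * f x ^ 2 with ha2
  have ea1 : (II fun x => AA k x * f x * f x) = a1 := II_congr fun x => by ring
  have ha10 : 0 ≤ a1 := II_nonneg fun x => mul_nonneg (AA_nonneg k x) (sq_nonneg _)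
  rw [ea1] at h7
  -- first moment
  have h9 : hw k / (2 * N) * a1 - B / 2 ≤ qq lam (wOf d hw) f f := by
    have e1 : hw k / (2 * N) * a1 - B / 2 * n2 f ≤ lam * II fun x => Wf (wOf d hw) x * (f x * f x) := by
      rw [ha1]
      unfold n2
      rw [← II_cmul, ← II_cmul, ← II_cmul, ← II_sub (by fun_prop) (by fun_prop)]
      refine II_mono (by fun_prop) (by fun_prop) fun x => ?_
      have := mul_le_mul_of_nonneg_right (Wf_ge h k hN x) (sq_nonneg (f x))
      rw [← hB, ← hlam] at this
      refine le_trans (le_of_eq ?_) (this.trans (le_of_eq ?_)) <;> ring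
    rw [hf.nrm] at e1
    have := TT_nonneg f
    unfold qq
    linarith
  have h10 : a1 ≤ N * ((B + 2) / hw k) := by
    have := hf.le
    have e1 : hw k / (2 * N) * a1 ≤ B / 2 + 1 := by linarith
    rw [div_mul_eq_mul_div, div_le_iff₀ (by positivity)] at e1
    rw [mul_div_assoc', le_div_iff₀ hk]
    linarith
  -- second moment
  have h11 : hw k / (2 * N) * a2 - B / 2 * a1 - pSq d k * N ≤ qq lam (wOf d hw) (fun x => AA k x * f x) f := by
    have e1 : hw k / (2 * N) * a2 - B / 2 * a1 ≤
        lam * II fun x => Wf (wOf d hw) x * (AA k x * f x * f x) := by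
      rw [ha1, ha2]
      rw [← II_cmul, ← II_cmul, ← II_cmul, ← II_sub (by fun_prop) (by fun_prop)]
      refine II_mono (by fun_prop) (by fun_prop) fun x => ?_
      have := mul_le_mul_of_nonneg_right (Wf_ge h k hN x)
        (mul_nonneg (AA_nonneg k x) (sq_nonneg (f x)))
      rw [← hB, ← hlam] at this
      refine le_trans (le_of_eq ?_) (this.trans (le_of_eq ?_)) <;> ring
    have e2 := TT_gf_lower (Per_AA k) hP (fun x => AA_nonneg k x)
    have e3 : (II fun x => LL (AA k) x * (f x * f x)) ≤ 2 * pSq d k * N := by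
      have : (II fun x => LL (AA k) x * (f x * f x)) ≤ II fun x => (2 * pSq d k * N) * f x ^ 2 := by
        have := LL_cont (Per_AA (N := N) k)
        refine II_mono (by fun_prop) (by fun_prop) fun x => ?_
        rw [LL_AA]
        nlinarith [mul_nonneg (mul_nonneg hp (AA_nonneg k x)) (sq_nonneg (f x))]
      rw [II_cmul] at this
      have e4 := hf.nrm
      unfold n2 at e4
      rwa [e4, mul_one] at this
    have e5 : hw k / (2 * N) * a2 - B / 2 * a1 - pSq d k * N = -(pSq d k * N) + (hw k / (2 * N) * a2 - B / 2 * a1) := by ring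
    rw [e5]
    exact add_le_add (le_trans (by linarith only [e3]) e2) e1
  have h12 : hw k / (2 * N) * a2 ≤ 1 + B / 2 * a1 + pSq d k * N := by
    nlinarith [mul_nonpos_of_nonpos_of_nonneg h8 ha10]
  have h13 : hw k / (2 * N) * a2 ≤ N * (1 + B * (B + 2) / (2 * hw k) + pSq d k) := by
    refine h12.trans ?_
    have := mul_le_mul_of_nonneg_left h10 (by positivity : 0 ≤ B / 2)
    have e : B / 2 * (N * ((B + 2) / hw k)) = N * (B * (B + 2) / (2 * hw k)) := by field_simp
    rw [e] at this
    nlinarith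
  rw [div_mul_eq_mul_div, div_le_iff₀ (by positivity)] at h13
  rw [div_mul_eq_mul_div, div_mul_eq_mul_div, le_div_iff₀ hk]
  nlinarith

end conv

section limA
variable {d N : ℕ}

lemma G_int (hN : 0 < N) {hw : (Fin d → ℤ) → ℝ} (h : HW hw) {S : Finset (Fin d → ℤ)}
    (hS : ∀ k ∈ S, -k ∈ S) {c : (Fin d → ℤ) → ℝ} (hc : ∀ k, c (-k) = c k)
    (hq : ∀ k ∈ S, c k * pSq d k + c k ^ 2 * pSq d k = hw k / 2) {f : Cfg d N → ℝ} (hf : Continuous f) :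
    (II fun x => (LL (UU S c) x - GG (UU S c) x) * f x ^ 2) +
      (1 / N) * (II fun x => Wf (wOf d hw) x * (f x * f x)) =
    (∑ k ∈ S, (c k * pSq d k - hw k / 2)) * n2 f +
      (1 / N) * (II fun x => Wf (wOf d (tl S hw)) x * f x ^ 2) -
      (1 / N ^ 2) * II fun x => Off S c x * f x ^ 2 := by
  have hU := (Sm_UU (N := N) S c).toPer
  have c1 := LL_cont hU
  have c2 := GG_cont hU
  have c3 := Wf_cont (N := N) (wOf_Wok h)
  have c4 := Wf_cont (N := N) (wOf_Wok (h.tl S))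
  have c5 := Off_cont (N := N) S c
  unfold n2
  rw [← II_cmul, ← II_cmul, ← II_cmul, ← II_cmul, ← II_add (by fun_prop) (by fun_prop),
    ← II_add (by fun_prop) (by fun_prop), ← II_sub (by fun_prop) (by fun_prop)]
  refine II_congr fun x => ?_
  have := G_ident hN h hS hc hq x
  linear_combination (f x ^ 2) * this

lemma A_lower (hN : 0 < N) {hw : (Fin d → ℤ) → ℝ} (h : HW hw) {S : Finset (Fin d → ℤ)}
    (hS : ∀ k ∈ S, -k ∈ S) {c : (Fin d → ℤ) → ℝ} (hc : ∀ k, c (-k) = c k)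
    (hq : ∀ k ∈ S, c k * pSq d k + c k ^ 2 * pSq d k = hw k / 2) {f : Cfg d N → ℝ} (hf : Per f)
    (h1 : n2 f = 1) {δ : ℝ} (hδ : (1 / N ^ 2) * |II fun x => Off S c x * f x ^ 2| ≤ δ) :
    ∑ k ∈ S, (c k * pSq d k - hw k / 2) - (∑' k, tl S hw k) / 2 - δ ≤ qq (1 / N) (wOf d hw) f f := by
  have hN' : (0:ℝ) < N := by exact_mod_cast hN
  have cf := hf.cont
  have c4 := Wf_cont (N := N) (wOf_Wok (h.tl S))
  have e1 := G_int hN h hS hc hq cf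
  have e2 := jastrow_le (Sm_UU (N := N) S c).toPer hf
  have e3 : -(N * (∑' k, tl S hw k) / 2) * n2 f ≤ II fun x => Wf (wOf d (tl S hw)) x * f x ^ 2 := by
    unfold n2
    rw [← II_cmul]
    refine II_mono (by fun_prop) (by fun_prop) fun x => ?_
    exact mul_le_mul_of_nonneg_right (Wf_lower (wOf_Wok (h.tl S)) x) (sq_nonneg _)
  rw [h1, mul_one] at e1 e3
  have e4 : -((∑' k, tl S hw k) / 2) ≤ (1 / N) * II fun x => Wf (wOf d (tl S hw)) x * f x ^ 2 := by
    refine le_trans (le_of_eq ?_) (mul_le_mul_of_nonneg_left e3 (by positivity))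
    field_simp
  have e5 : (1 / (N:ℝ) ^ 2) * (II fun x => Off S c x * f x ^ 2) ≤ δ :=
    (mul_le_mul_of_nonneg_left (le_abs_self _) (by positivity)).trans hδ
  unfold qq
  linarith

lemma II_UU (hN : 0 < N) {S : Finset (Fin d → ℤ)} (h0 : (0 : Fin d → ℤ) ∉ S) (c : (Fin d → ℤ) → ℝ) :
    (II fun x : Cfg d N => 2 * UU S c x) = ∑ k ∈ S, c k := by
  have hN' : (0:ℝ) < N := by exact_mod_cast hN
  rw [II_cmul]
  unfold UU
  rw [II_sum (f := fun k x => c k / (2 * N) * AA k x) (fun k _ => by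
    have := (Per_AA (N := N) k).cont
    fun_prop), Finset.mul_sum]
  refine Finset.sum_congr rfl fun k hk => ?_
  rw [II_cmul, II_AA (fun e => h0 (e ▸ hk))]
  field_simp

lemma UU_nonneg {S : Finset (Fin d → ℤ)} {c : (Fin d → ℤ) → ℝ} (hc0 : ∀ k ∈ S, 0 ≤ c k) (x : Cfg d N) :
    0 ≤ UU S c x :=
  Finset.sum_nonneg fun k hk => mul_nonneg (div_nonneg (hc0 k hk) (by positivity)) (AA_nonneg k x)

lemma n2_exp (hN : 0 < N) {S : Finset (Fin d → ℤ)} (h0 : (0 : Fin d → ℤ) ∉ S) (c : (Fin d → ℤ) → ℝ) :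
    Real.exp (-∑ k ∈ S, c k) ≤ n2 fun x : Cfg d N => Real.exp (-1 * UU S c x) := by
  set m := ∑ k ∈ S, c k with hm
  have cU := (Sm_UU (N := N) S c).toPer.cont
  have e : (II fun x : Cfg d N => Real.exp (-m) * ((1 + m) - 2 * UU S c x)) = Real.exp (-m) := by
    rw [II_cmul, II_sub (by fun_prop) (by fun_prop), II_const, II_UU hN h0]; ring
  rw [← e]
  unfold n2
  refine II_mono (by fun_prop) (by fun_prop) fun x => ?_
  have : Real.exp (-1 * UU S c x) ^ 2 = Real.exp (-m) * Real.exp (m - 2 * UU S c x) := by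
    rw [← Real.exp_nat_mul, ← Real.exp_add]; congr 1; push_cast; ring
  simp only [this]
  refine mul_le_mul_of_nonneg_left ?_ (Real.exp_pos _).le
  have := Real.add_one_le_exp (m - 2 * UU S c x)
  linarith

lemma A_upper (hN : 0 < N) {hw : (Fin d → ℤ) → ℝ} (h : HW hw) {S : Finset (Fin d → ℤ)}
    (hS : ∀ k ∈ S, -k ∈ S) (h0 : (0 : Fin d → ℤ) ∉ S) {c : (Fin d → ℤ) → ℝ} (hc : ∀ k, c (-k) = c k)
    (hc0 : ∀ k ∈ S, 0 ≤ c k)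
    (hq : ∀ k ∈ S, c k * pSq d k + c k ^ 2 * pSq d k = hw k / 2) {κ : ℝ} (hκ : 0 < κ) :
    GSE d N (1 / N) (wOf d hw) ≤ ∑ k ∈ S, (c k * pSq d k - hw k / 2) +
      ((∑' k, tl S hw k) / 2 + K0 S c * (3 * (2 * κ + 1 / (κ * √N)))) * Real.exp (∑ k ∈ S, c k) := by
  have hN' : (0:ℝ) < N := by exact_mod_cast hN
  have hN1 : (1:ℝ) ≤ N := by exact_mod_cast hN
  have hU := Sm_UU (N := N) S c
  have cU := hU.toPer.cont
  have c4 := Wf_cont (N := N) (wOf_Wok (h.tl S))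
  have cA := fun k => (Per_AA (N := N) (d := d) k).cont
  set g : Cfg d N → ℝ := fun x => Real.exp (-1 * UU S c x) with hg
  have cg : Continuous g := by fun_prop
  have g1 : ∀ x, g x ^ 2 ≤ 1 := fun x => by
    have : g x ≤ 1 := Real.exp_le_one_iff.2 (by have := UU_nonneg (N := N) hc0 x; linarith)
    have h2 : 0 < g x := Real.exp_pos _
    nlinarith
  have e1 := G_int hN h hS hc hq cg
  have e2 : TT g g = II fun x => (LL (UU S c) x - GG (UU S c) x) * g x ^ 2 := jastrow_eq hU.toPer
  have e3 := n2_exp (N := N) hN h0 c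
  set Bt := ∑' k, tl S hw k with hBt
  have hBt0 : 0 ≤ Bt := tsum_nonneg (h.tl S).nn
  have e4 : (II fun x => Wf (wOf d (tl S hw)) x * g x ^ 2) ≤ N * Bt / 2 := by
    have : (II fun x => Wf (wOf d (tl S hw)) x * g x ^ 2) ≤
        II fun x : Cfg d N => Wf (wOf d (tl S hw)) x + N * Bt / 2 := by
      refine II_mono (by fun_prop) (by fun_prop) fun x => ?_
      have a1 := Wf_lower (wOf_Wok (h.tl S)) x
      rw [← hBt] at a1
      have a2 := mul_nonneg (by linarith : 0 ≤ Wf (wOf d (tl S hw)) x + N * Bt / 2) (sub_nonneg.2 (g1 x))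
      have a3 : 0 ≤ (N * Bt / 2) * g x ^ 2 := by positivity
      linarith
    rwa [II_add c4 (by fun_prop), IIW_zero (wOf_Wok (h.tl S)), II_const, zero_add] at this
  have e4' : (1 / (N:ℝ)) * (II fun x => Wf (wOf d (tl S hw)) x * g x ^ 2) ≤ Bt / 2 := by
    refine (mul_le_mul_of_nonneg_left e4 (by positivity)).trans (le_of_eq ?_)
    field_simp
  set δ := K0 S c * (3 * (2 * κ + 1 / (κ * √N))) with hδ
  have hδ0 : 0 ≤ δ := mul_nonneg (K0_nonneg S c) (by positivity)
  have e5 : (1 / (N:ℝ) ^ 2) * |II fun x => Off S c x * g x ^ 2| ≤ δ := by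
    refine off_bound hN (by fun_prop) (fun x => sq_nonneg _) hκ (fun k hk => ?_) fun r hr => ?_
    · refine le_trans (II_mono (by have := cA k; fun_prop) (g := fun x => AA k x ^ 2) (by have := cA k; fun_prop) fun x => ?_)
        (II_AA_sq (fun e => h0 (e ▸ hk)))
      exact mul_le_of_le_one_right (sq_nonneg _) (g1 x)
    · refine le_trans (II_mono (by have := cA r; fun_prop) (g := fun x => AA r x) (by have := cA r; fun_prop) fun x => ?_)
        ((II_AA (N := N) hr).le.trans ?_)
      · exact mul_le_of_le_one_right (AA_nonneg _ _) (g1 x)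
      · have : 1 ≤ √(N:ℝ) := Real.one_le_sqrt.2 hN1
        nlinarith
  have e5' : -(1 / (N:ℝ) ^ 2 * (II fun x => Off S c x * g x ^ 2)) ≤ δ := by
    refine le_trans ?_ e5
    rw [← mul_neg]
    exact mul_le_mul_of_nonneg_left (neg_le_abs _) (by positivity)
  have e6 := GSE_le (N := N) (lam := 1 / N) (wOf_Wok h) (by positivity) (hU.cmul (-1)).exp
  change _ * n2 g ≤ qq _ _ g g at e6
  unfold qq at e6
  rw [e2, e1] at e6
  set Sg := ∑ k ∈ S, (c k * pSq d k - hw k / 2)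
  have e7 : (GSE d N (1 / N) (wOf d hw) - Sg) * n2 g ≤ Bt / 2 + δ := by linarith
  rcases le_total (GSE d N (1 / N) (wOf d hw) - Sg) 0 with h8 | h8
  · have : 0 ≤ (Bt / 2 + δ) * Real.exp (∑ k ∈ S, c k) := by positivity
    linarith
  · have h9 := (mul_le_mul_of_nonneg_left e3 h8).trans e7
    have h10 := mul_le_mul_of_nonneg_right h9 (Real.exp_pos (∑ k ∈ S, c k)).le
    rw [mul_assoc, ← Real.exp_add, neg_add_cancel, Real.exp_zero, mul_one] at h10
    linarith

end limA

section limA2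
variable {d N : ℕ}

/-- Jastrow coefficient -/
def cB (d : ℕ) (hw : (Fin d → ℤ) → ℝ) (k : Fin d → ℤ) : ℝ := (ePk d hw k - pSq d k) / (2 * pSq d k)

/-- summand of the Bogoliubov energy -/
def tB (d : ℕ) (hw : (Fin d → ℤ) → ℝ) (k : Fin d → ℤ) : ℝ := (ePk d hw k - pSq d k - hw k) / 2

lemma pSq_neg (k : Fin d → ℤ) : pSq d (-k) = pSq d k := by simp [pSq]

lemma pSq_zero : pSq d 0 = 0 := by simp [pSq]

lemma ePk_sq {hw : (Fin d → ℤ) → ℝ} (h : HW hw) (k : Fin d → ℤ) :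
    ePk d hw k ^ 2 = pSq d k ^ 2 + 2 * pSq d k * hw k := by
  unfold ePk
  rw [Real.sq_sqrt]
  have := pSq_nonneg k
  have := h.nn k
  positivity

lemma ePk_ge {hw : (Fin d → ℤ) → ℝ} (h : HW hw) (k : Fin d → ℤ) : pSq d k ≤ ePk d hw k := by
  refine Real.le_sqrt_of_sq_le ?_
  have := mul_nonneg (pSq_nonneg k) (h.nn k)
  linarith

lemma cB_neg {hw : (Fin d → ℤ) → ℝ} (hev : ∀ k, hw (-k) = hw k) (k : Fin d → ℤ) :
    cB d hw (-k) = cB d hw k := by simp [cB, ePk, pSq_neg, hev]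

lemma cB_nonneg {hw : (Fin d → ℤ) → ℝ} (h : HW hw) (k : Fin d → ℤ) : 0 ≤ cB d hw k :=
  div_nonneg (sub_nonneg.2 (ePk_ge h k)) (mul_nonneg zero_le_two (pSq_nonneg k))

lemma cB_quad {hw : (Fin d → ℤ) → ℝ} (h : HW hw) {k : Fin d → ℤ} (hk : k ≠ 0) :
    cB d hw k * pSq d k + cB d hw k ^ 2 * pSq d k = hw k / 2 := by
  have h1 := pSq_ge hk
  have h2 := ePk_sq h k
  unfold cB
  field_simp
  linear_combination h2

lemma cB_tB (hw : (Fin d → ℤ) → ℝ) {k : Fin d → ℤ} (hk : k ≠ 0) :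
    cB d hw k * pSq d k - hw k / 2 = tB d hw k := by
  have h1 := pSq_ge hk
  unfold cB tB
  field_simp

lemma tB_zero {hw : (Fin d → ℤ) → ℝ} (h : HW hw) : tB d hw 0 = 0 := by
  simp [tB, ePk, pSq_zero, h.zero]

lemma tB_le {hw : (Fin d → ℤ) → ℝ} (h : HW hw) (k : Fin d → ℤ) :
    tB d hw k ≤ 0 ∧ -(hw k / 2) ≤ tB d hw k := by
  by_cases hk : k = 0
  · subst hk; rw [tB_zero h, h.zero]; simp
  have h0 := pSq_ge hk
  have h1 := cB_quad h hk
  have h2 := cB_tB hw hk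
  have h3 := cB_nonneg h k
  constructor
  · have : 0 ≤ cB d hw k ^ 2 * pSq d k := by positivity
    linarith
  · have : 0 ≤ cB d hw k * pSq d k := by positivity
    linarith

lemma cB_le {hw : (Fin d → ℤ) → ℝ} (h : HW hw) {k : Fin d → ℤ} (hk : k ≠ 0) : cB d hw k ≤ hw k / 2 := by
  have h0 := pSq_ge hk
  have h1 := cB_quad h hk
  have h3 := cB_nonneg h k
  have : 0 ≤ cB d hw k ^ 2 * pSq d k := by positivity
  nlinarith

lemma HW_tB {hw : (Fin d → ℤ) → ℝ} (h : HW hw) : HW fun k => -tB d hw k where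
  nn k := by have := (tB_le h k).1; linarith
  sm := by
    refine Summable.of_nonneg_of_le (fun k => by have := (tB_le h k).1; linarith)
      (fun k => ?_) (h.sm.div_const 2)
    have := (tB_le h k).2
    linarith
  zero := by rw [tB_zero h, neg_zero]

lemma tsum_ne_zero {F : (Fin d → ℤ) → ℝ} (h0 : F 0 = 0) :
    ∑' k : {k : Fin d → ℤ // k ≠ 0}, F k.1 = ∑' k, F k := by
  refine tsum_subtype_eq_of_support_subset (s := {k : Fin d → ℤ | k ≠ 0}) fun k hk => ?_
  rintro rfl
  exact hk h0

lemma eB_eq {hw : (Fin d → ℤ) → ℝ} (h : HW hw) : eB d hw = -∑' k, -tB d hw k := by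
  unfold eB
  rw [← tsum_ne_zero (F := fun k => -tB d hw k) (by rw [tB_zero h, neg_zero]), neg_mul, ← tsum_mul_left]
  congr 2
  funext k
  unfold tB
  ring

lemma tl_mono {a b : (Fin d → ℤ) → ℝ} (h : ∀ k, a k ≤ b k) (S : Finset (Fin d → ℤ)) (k : Fin d → ℤ) :
    tl S a k ≤ tl S b k := by
  unfold tl; split_ifs; exacts [le_rfl, h k]

lemma eB_S {hw : (Fin d → ℤ) → ℝ} (h : HW hw) (S : Finset (Fin d → ℤ)) :
    eB d hw ≤ ∑ k ∈ S, tB d hw k ∧ ∑ k ∈ S, tB d hw k ≤ eB d hw + (∑' k, tl S hw k) / 2 := by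
  have h1 := tl_tsum (HW_tB h) S
  have h2 : 0 ≤ ∑' k, tl S (fun k => -tB d hw k) k := tsum_nonneg ((HW_tB h).tl S).nn
  have h3 : ∑' k, tl S (fun k => -tB d hw k) k ≤ ∑' k, tl S hw k / 2 := by
    refine Summable.tsum_le_tsum (fun k => ?_) ((HW_tB h).tl S).sm ((h.tl S).sm.div_const 2)
    unfold tl
    split_ifs
    · simp
    · have := (tB_le h k).2; linarith
  rw [tsum_div_const] at h3
  rw [eB_eq h, h1, Finset.sum_neg_distrib]
  constructor <;> linarith

lemma exists_S {hw : (Fin d → ℤ) → ℝ} (h : HW hw) (hev : ∀ k, hw (-k) = hw k) {τ : ℝ} (hτ : 0 < τ) :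
    ∃ S : Finset (Fin d → ℤ), (∀ k ∈ S, -k ∈ S) ∧ (0 : Fin d → ℤ) ∉ S ∧ (∀ k ∈ S, 0 < hw k) ∧
      ∑' k, tl S hw k ≤ τ := by
  classical
  obtain ⟨T, hT⟩ := (h.sm.hasSum.eventually (lt_mem_nhds (sub_lt_self _ hτ))).exists
  refine ⟨(T ∪ T.image (fun k => -k)).filter fun k => 0 < hw k, fun k hk => ?_, fun hk => ?_, fun k hk => ?_, ?_⟩
  · simp only [Finset.mem_filter, Finset.mem_union, Finset.mem_image] at hk ⊢
    refine ⟨?_, by rw [hev]; exact hk.2⟩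
    rcases hk.1 with h1 | ⟨a, ha, rfl⟩
    · exact Or.inr ⟨k, h1, rfl⟩
    · rw [neg_neg]; exact Or.inl ha
  · simp [h.zero] at hk
  · exact (Finset.mem_filter.1 hk).2
  · have h1 := tl_tsum h ((T ∪ T.image (fun k => -k)).filter fun k => 0 < hw k)
    have h2 : ∑ k ∈ (T ∪ T.image (fun k => -k)).filter (fun k => 0 < hw k), hw k =
        ∑ k ∈ T ∪ T.image (fun k => -k), hw k := by
      refine Finset.sum_filter_of_ne fun k _ hk => lt_of_le_of_ne (h.nn k) (Ne.symm hk)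
    have h3 : ∑ k ∈ T, hw k ≤ ∑ k ∈ T ∪ T.image (fun k => -k), hw k :=
      Finset.sum_le_sum_of_subset_of_nonneg Finset.subset_union_left fun k _ _ => h.nn k
    linarith

lemma kappa_lemma {K θ : ℝ} (hK : 0 ≤ K) (hθ : 0 < θ) :
    ∃ κ : ℝ, 0 < κ ∧ ∀ᶠ N : ℕ in Filter.atTop, K * (2 * κ + 1 / (κ * √(N:ℝ))) ≤ θ := by
  set κ := θ / (4 * (K + 1)) with hκ
  have hκ0 : 0 < κ := by positivity
  have h1 : K * (2 * κ) < θ := by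
    rw [hκ]
    have : K * (2 * (θ / (4 * (K + 1)))) = θ * (K / (K + 1)) / 2 := by field_simp; ring
    rw [this]
    have : K / (K + 1) ≤ 1 := by rw [div_le_one (by positivity)]; linarith
    nlinarith
  refine ⟨κ, hκ0, ?_⟩
  have h2 : Filter.Tendsto (fun N : ℕ => K * (2 * κ + 1 / (κ * √(N:ℝ)))) Filter.atTop (nhds (K * (2 * κ + 0))) := by
    refine Filter.Tendsto.const_mul _ (Filter.Tendsto.const_add _ ?_)
    refine Filter.Tendsto.div_atTop tendsto_const_nhds ?_
    refine Filter.Tendsto.const_mul_atTop hκ0 ?_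
    exact Real.tendsto_sqrt_atTop.comp tendsto_natCast_atTop_atTop
  rw [add_zero] at h2
  exact (h2.eventually (gt_mem_nhds h1)).mono fun _ h => h.le

lemma A_lim {hw : (Fin d → ℤ) → ℝ} (h : HW hw) (hev : ∀ k, hw (-k) = hw k) :
    Filter.Tendsto (fun N : ℕ => GSE d N (1 / N) (wOf d hw)) Filter.atTop (nhds (eB d hw)) := by
  rw [Metric.tendsto_nhds]
  intro η hη
  set B := ∑' k, hw k with hB
  have hB0 : 0 ≤ B := tsum_nonneg h.nn
  have hW := wOf_Wok h
  rw [← hB] at hW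
  set M := Real.exp (B / 2) with hM
  have hM1 : 1 ≤ M := Real.one_le_exp (by positivity)
  obtain ⟨S, hS, h0, hpos, hBt⟩ := exists_S h hev (τ := η / (4 * M)) (by positivity)
  set Bt := ∑' k, tl S hw k with hBtd
  have hBt0 : 0 ≤ Bt := tsum_nonneg (h.tl S).nn
  have hne : ∀ k ∈ S, k ≠ 0 := fun k hk e => h0 (e ▸ hk)
  have hc := cB_neg hev
  have hq : ∀ k ∈ S, cB d hw k * pSq d k + cB d hw k ^ 2 * pSq d k = hw k / 2 :=
    fun k hk => cB_quad h (hne k hk)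
  have hsum : ∑ k ∈ S, (cB d hw k * pSq d k - hw k / 2) = ∑ k ∈ S, tB d hw k :=
    Finset.sum_congr rfl fun k hk => cB_tB hw (hne k hk)
  have hE := eB_S h S
  have hcS : ∑ k ∈ S, cB d hw k ≤ B / 2 := by
    have h1 := tl_tsum h S
    have h2 : ∑ k ∈ S, cB d hw k ≤ ∑ k ∈ S, hw k / 2 := Finset.sum_le_sum fun k hk => cB_le h (hne k hk)
    rw [← Finset.sum_div] at h2
    linarith
  -- moment constants
  have hD : ∀ k ∈ S, ∃ D : ℝ, 0 ≤ D ∧ ∀ N : ℕ, 0 < N → ∃ ε0 : ℝ, 0 < ε0 ∧ ε0 ≤ 1 ∧ ∀ ε, 0 < ε → ε ≤ ε0 →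
      ∀ f : Cfg d N → ℝ, NM (1 / N) (wOf d hw) ε f → (II fun x => AA k x ^ 2 * f x ^ 2) ≤ D * N ^ 2 :=
    fun k hk => second_moment h (hpos k hk)
  choose! D hD0 hD using hD
  set DD' := ∑ k ∈ S, D k + (1 + 2 * √(B / 2 + 1)) with hDD
  have hsD : 0 ≤ ∑ k ∈ S, D k := Finset.sum_nonneg hD0
  have hDD0 : 0 ≤ DD' := by positivity
  obtain ⟨κ1, hκ1, hN1⟩ := kappa_lemma (K := K0 S (cB d hw) * 3) (θ := η / (4 * M))
    (mul_nonneg (K0_nonneg _ _) (by norm_num)) (by positivity)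
  obtain ⟨κ2, hκ2, hN2⟩ := kappa_lemma (K := K0 S (cB d hw) * DD') (θ := η / (4 * M))
    (mul_nonneg (K0_nonneg _ _) hDD0) (by positivity)
  have hηM : η / (4 * M) ≤ η / 4 := by
    apply div_le_div_of_nonneg_left hη.le (by norm_num); linarith
  filter_upwards [hN1, hN2, Filter.eventually_gt_atTop 0] with N hN1 hN2 hN
  have hN' : (0:ℝ) < N := by exact_mod_cast hN
  have hl : (0:ℝ) ≤ 1 / N := by positivity
  have up := A_upper hN h hS h0 hc (fun k _ => cB_nonneg h k) hq hκ1
  rw [hsum, ← hBtd] at up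
  have up2 : (Bt / 2 + K0 S (cB d hw) * (3 * (2 * κ1 + 1 / (κ1 * √N)))) * Real.exp (∑ k ∈ S, cB d hw k) ≤
      (η / (4 * M) / 2 + η / (4 * M)) * M := by
    refine mul_le_mul ?_ (Real.exp_le_exp.2 hcS) (Real.exp_pos _).le (by positivity)
    rw [← mul_assoc]
    linarith
  have up3 : (η / (4 * M) / 2 + η / (4 * M)) * M = η * (3 / 8) := by field_simp; ring
  -- lower
  have ev : ∀ᶠ ε in nhdsWithin (0:ℝ) (Set.Ioi 0), ∀ k ∈ S, ∀ f : Cfg d N → ℝ,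
      NM (1 / N) (wOf d hw) ε f → (II fun x => AA k x ^ 2 * f x ^ 2) ≤ D k * N ^ 2 := by
    rw [Filter.eventually_all_finset]
    intro k hk
    obtain ⟨ε0, he0, -, he⟩ := hD k hk N hN
    filter_upwards [Ioc_mem_nhdsGT he0] with ε hε
    exact he ε hε.1 hε.2
  obtain ⟨ε, hε1, hε2⟩ := (ev.and (Ioc_mem_nhdsGT (show (0:ℝ) < min 1 (η / 4) by positivity))).exists
  obtain ⟨f, hfs, hf1, hfe⟩ := exists_min (N := N) hW hl hε2.1
  have hf : NM (1 / N) (wOf d hw) ε f := ⟨hfs, hf1, hfe⟩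
  have hεa := hε2.2.trans (min_le_left _ _)
  have hεb := hε2.2.trans (min_le_right _ _)
  have hT := hf.TT_le hW hl
  have hM1' : M1 f ≤ B / 2 + 1 := by
    refine (M1_le_TT hfs.toPer).trans (hT.trans ?_)
    have : 1 / (N:ℝ) * (N * B / 2) = B / 2 := by field_simp
    linarith
  have low := A_lower hN h hS hc hq hfs.toPer hf1 (δ := K0 S (cB d hw) * (DD' * (2 * κ2 + 1 / (κ2 * √N))))
    (by
      refine off_bound hN (by have := hfs.toPer.cont; fun_prop) (fun x => sq_nonneg _) hκ2 (fun k hk => ?_) fun r hr => ?_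
      · refine (hε1 k hk f hf).trans (mul_le_mul_of_nonneg_right ?_ (by positivity))
        have := Finset.single_le_sum hD0 hk
        have : 0 ≤ √(B / 2 + 1) := Real.sqrt_nonneg _
        linarith
      · refine (II_AA_f hr hfs.toPer.cont hf1).trans (mul_le_mul_of_nonneg_right ?_ (by positivity))
        have := Real.sqrt_le_sqrt hM1'
        linarith)
  rw [hsum, ← hBtd, ← mul_assoc] at low
  rw [Real.dist_eq, abs_lt]
  constructor <;> linarith [hE.1, hE.2]

end limA2

section HF
variable {d N : ℕ}

lemma HW.smul {hw : (Fin d → ℤ) → ℝ} (h : HW hw) {g : ℝ} (hg : 0 ≤ g) : HW fun k => g * hw k where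
  nn k := mul_nonneg hg (h.nn k)
  sm := h.sm.mul_left g
  zero := by rw [h.zero, mul_zero]

lemma GSE_scale {hw : (Fin d → ℤ) → ℝ} (h : HW hw) {g : ℝ} (hg : 0 ≤ g) (lam : ℝ) :
    GSE d N lam (wOf d fun k => g * hw k) = GSE d N (lam * g) (wOf d hw) := by
  have e : ∀ y, wOf d (fun k => g * hw k) y = g * wOf d hw y := by
    intro y
    rw [wOf_eq (h.smul hg).sm (h.smul hg).nn, wOf_eq h.sm h.nn, ← tsum_mul_left]
    exact tsum_congr fun k => mul_assoc _ _ _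
  unfold GSE
  congr 1
  ext a
  refine exists_congr fun Ψ => and_congr_right fun _ => ?_
  have : energy d N lam (wOf d fun k => g * hw k) Ψ = energy d N (lam * g) (wOf d hw) Ψ := by
    unfold energy
    refine integral_congr_ae (Filter.Eventually.of_forall fun x => ?_)
    have e2 : (∑ j : Fin N, ∑ k : Fin N, if j < k then wOf d (fun k => g * hw k) (x j - x k) else 0) =
        g * ∑ j : Fin N, ∑ k : Fin N, if j < k then wOf d hw (x j - x k) else 0 := by
      rw [Finset.mul_sum]
      refine Finset.sum_congr rfl fun j _ => ?_
      rw [Finset.mul_sum]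
      refine Finset.sum_congr rfl fun k _ => ?_
      rw [e]; split_ifs <;> simp
    simp only [e2, mul_assoc]
  rw [this]

lemma A_lim_g {hw : (Fin d → ℤ) → ℝ} (h : HW hw) (hev : ∀ k, hw (-k) = hw k) {g : ℝ} (hg : 0 ≤ g) :
    Filter.Tendsto (fun N : ℕ => GSE d N (g / N) (wOf d hw)) Filter.atTop
      (nhds (eB d fun k => g * hw k)) := by
  have := A_lim (h.smul hg) (fun k => by simp only [hev])
  refine this.congr fun N => ?_
  rw [GSE_scale h hg, one_div, div_eq_inv_mul]

/-- derivative summand -/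
def tD (d : ℕ) (hw : (Fin d → ℤ) → ℝ) (k : Fin d → ℤ) : ℝ := (pSq d k * hw k / ePk d hw k - hw k) / 2

/-- derivative of the Bogoliubov energy in the coupling -/
def eD (d : ℕ) (hw : (Fin d → ℤ) → ℝ) : ℝ := ∑' k, tD d hw k

lemma ePk_pos {hw : (Fin d → ℤ) → ℝ} (h : HW hw) {k : Fin d → ℤ} (hk : k ≠ 0) : 0 < ePk d hw k :=
  lt_of_lt_of_le (lt_of_lt_of_le one_pos (pSq_ge hk)) (ePk_ge h k)

lemma tD_zero {hw : (Fin d → ℤ) → ℝ} (h : HW hw) : tD d hw 0 = 0 := by simp [tD, h.zero]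

lemma tD_sm {hw : (Fin d → ℤ) → ℝ} (h : HW hw) : Summable (tD d hw) := by
  refine Summable.of_norm_bounded h.sm fun k => ?_
  by_cases hk : k = 0
  · subst hk; rw [tD_zero h, h.zero]; simp
  have h1 := ePk_pos h hk
  have h2 := ePk_ge h k
  have h3 := h.nn k
  have h4 := pSq_nonneg k
  have h5 : pSq d k * hw k / ePk d hw k ≤ hw k := by
    rw [div_le_iff₀ h1]; nlinarith
  have h6 : 0 ≤ pSq d k * hw k / ePk d hw k := by positivity
  unfold tD
  rw [Real.norm_eq_abs, abs_le]
  constructor <;> linarith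

lemma tB_sm {hw : (Fin d → ℤ) → ℝ} (h : HW hw) : Summable (tB d hw) := by
  have := (HW_tB h).sm.neg
  simpa using this

lemma eB_eq' {hw : (Fin d → ℤ) → ℝ} (h : HW hw) : eB d hw = ∑' k, tB d hw k := by
  rw [eB_eq h, tsum_neg, neg_neg]

lemma tB_diff {hw : (Fin d → ℤ) → ℝ} (h : HW hw) {g : ℝ} (hg : 0 ≤ g) (k : Fin d → ℤ) :
    |tB d (fun k => g * hw k) k - tB d hw k - (g - 1) * tD d hw k| ≤ hw k * ((g - 1) ^ 2 / 2) := by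
  by_cases hk : k = 0
  · subst hk; rw [tD_zero h, tB_zero h, tB_zero (h.smul hg), h.zero]; simp
  set s := g - 1 with hs
  set p := pSq d k with hp
  have hp1 : 1 ≤ p := pSq_ge hk
  set v := hw k with hv
  have hv0 : 0 ≤ v := h.nn k
  set e := ePk d hw k with he
  have he0 : 0 < e := ePk_pos h hk
  have hep : p ≤ e := ePk_ge h k
  have he2 : e ^ 2 = p ^ 2 + 2 * p * v := ePk_sq h k
  set E := ePk d (fun k => g * hw k) k with hE
  have hE0 : 0 < E := ePk_pos (h.smul hg) hk
  have hE2 : E ^ 2 = p ^ 2 + 2 * p * (g * v) := ePk_sq (h.smul hg) k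
  set x := E - e with hx
  have h1 : x * (E + e) = 2 * p * v * s := by rw [hx, hs]; linear_combination hE2 - he2
  have h2 : x ^ 2 * e ^ 2 ≤ 4 * p ^ 2 * v ^ 2 * s ^ 2 := by
    have : x ^ 2 * (E + e) ^ 2 = 4 * p ^ 2 * v ^ 2 * s ^ 2 := by
      rw [← mul_pow, h1]; ring
    rw [← this]
    refine mul_le_mul_of_nonneg_left ?_ (sq_nonneg x)
    nlinarith
  have h3 : 4 * p ^ 2 * v ^ 2 * s ^ 2 ≤ 2 * e * v * s ^ 2 * e ^ 2 := by
    have h31 : 2 * p * v ≤ e ^ 2 := by nlinarith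
    have h32 : p * (2 * p * v) ≤ e * e ^ 2 := mul_le_mul hep h31 (by positivity) he0.le
    have h33 := mul_le_mul_of_nonneg_right h32 (by positivity : 0 ≤ 2 * v * s ^ 2)
    nlinarith
  have h4 : x ^ 2 ≤ 2 * e * v * s ^ 2 := le_of_mul_le_mul_right (h2.trans h3) (by positivity)
  have h5 : tB d (fun k => g * hw k) k - tB d hw k - s * tD d hw k = -(x ^ 2 / (4 * e)) := by
    have a1 : tB d (fun k => g * hw k) k = (E - p - g * v) / 2 := rfl
    have a2 : tB d hw k = (e - p - v) / 2 := rfl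
    have a3 : tD d hw k = (p * v / e - v) / 2 := rfl
    rw [a1, a2, a3]
    clear_value E e p v
    rw [hx, hs]
    field_simp
    linear_combination 2 * (hE2 - he2)
  rw [h5, abs_neg, abs_of_nonneg (by positivity), div_le_iff₀ (by positivity)]
  linarith

lemma eB_diff {hw : (Fin d → ℤ) → ℝ} (h : HW hw) {g : ℝ} (hg : 0 ≤ g) :
    |eB d (fun k => g * hw k) - eB d hw - (g - 1) * eD d hw| ≤ (∑' k, hw k) * ((g - 1) ^ 2 / 2) := by
  rw [eB_eq' h, eB_eq' (h.smul hg), eD, ← tsum_mul_left, ← tsum_mul_right,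
    ← (tB_sm (h.smul hg)).tsum_sub (tB_sm h), ← ((tB_sm (h.smul hg)).sub (tB_sm h)).tsum_sub ((tD_sm h).mul_left _),
    ← Real.norm_eq_abs]
  exact tsum_of_norm_bounded (h.sm.mul_right _).hasSum fun k => tB_diff h hg k

lemma eD_eq {hw : (Fin d → ℤ) → ℝ} (h : HW hw) :
    eD d hw = eB d hw - ∑' k : {k : Fin d → ℤ // k ≠ 0},
      pSq d k.1 * alphaP d hw k.1 ^ 2 / (1 - alphaP d hw k.1 ^ 2) := by
  rw [tsum_ne_zero (F := fun k => pSq d k * alphaP d hw k ^ 2 / (1 - alphaP d hw k ^ 2)) (by simp [pSq_zero])]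
  have : ∀ k, pSq d k * alphaP d hw k ^ 2 / (1 - alphaP d hw k ^ 2) = tB d hw k - tD d hw k := by
    intro k
    by_cases hk : k = 0
    · subst hk; simp [pSq_zero, tB_zero h, tD_zero h]
    unfold alphaP tB tD
    have hp1 : 1 ≤ pSq d k := pSq_ge hk
    have he0 := ePk_pos h hk
    have he2 := ePk_sq h k
    have hv := h.nn k
    set p := pSq d k
    set e := ePk d hw k
    set v := hw k
    have h1 : 0 < p + v + e := by linarith
    have h3 : p * (v / (p + v + e)) ^ 2 / (1 - (v / (p + v + e)) ^ 2) = p * v ^ 2 / ((p + e) * (p + e + 2 * v)) := by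
      have h2 : (p + v + e) ^ 2 - v ^ 2 = (p + e) * (p + e + 2 * v) := by ring
      rw [← h2]
      have h4 : 0 < (p + v + e) ^ 2 - v ^ 2 := by rw [h2]; positivity
      rw [div_pow, one_sub_div (by positivity), mul_div_assoc', div_div_div_cancel_right₀ (by positivity)]
    rw [h3]
    have hv' : v = (e ^ 2 - p ^ 2) / (2 * p) := by rw [he2]; field_simp; ring
    have h5 : p + e + 2 * v = (p + e) * e / p := by rw [hv']; field_simp; ring
    rw [h5, hv']
    have h6 : p + e ≠ 0 := by positivity
    field_simp
    ring
  rw [tsum_congr this, (tB_sm h).tsum_sub (tD_sm h), eB_eq' h, eD]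
  ring

lemma qq_lam {w : (Fin d → ℝ) → ℝ} (l1 l2 : ℝ) (f : Cfg d N → ℝ) :
    qq l1 w f f = qq l2 w f f + (l1 - l2) * VV w f := by unfold qq VV; ring

lemma GSE_le_VV {w : (Fin d → ℝ) → ℝ} {B : ℝ} (hw : Wok w B) {l1 l2 ε : ℝ} (h1 : 0 ≤ l1)
    {f : Cfg d N → ℝ} (hf : NM l2 w ε f) :
    GSE d N l1 w ≤ GSE d N l2 w + ε + (l1 - l2) * VV w f := by
  have e1 := GSE_le hw h1 hf.sm
  rw [hf.nrm, mul_one, qq_lam l1 l2] at e1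
  linarith [hf.le]

lemma GSE_anti {w : (Fin d → ℝ) → ℝ} {B : ℝ} (hw : Wok w B) {l1 l2 : ℝ} (h2 : 0 < l2) (h : l2 ≤ l1) :
    GSE d N l1 w ≤ GSE d N l2 w := by
  refine le_of_forall_pos_le_add fun δ hδ => ?_
  have hl1 : 0 < l1 := by linarith
  set ε := δ * l2 / l1 with hε
  have hε0 : 0 < ε := by positivity
  obtain ⟨f, hfs, hf1, hfe⟩ := exists_min (N := N) hw h2.le hε0
  have e1 := GSE_le_VV hw hl1.le (⟨hfs, hf1, hfe⟩ : NM l2 w ε f)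
  have e2 := GSE_nonpos (N := N) hw h2.le
  have e3 := TT_nonneg f
  have e4 : l2 * VV w f ≤ ε := by
    have : qq l2 w f f = TT f f + l2 * VV w f := rfl
    linarith
  have e5 : (l1 - l2) * VV w f ≤ (l1 - l2) * (ε / l2) :=
    mul_le_mul_of_nonneg_left (by rw [le_div_iff₀ h2]; linarith) (by linarith)
  have e6 : ε + (l1 - l2) * (ε / l2) = δ := by rw [hε]; field_simp; ring
  linarith

lemma F_lim {hw : (Fin d → ℤ) → ℝ} (h : HW hw) (hev : ∀ k, hw (-k) = hw k) {lam : ℕ → ℝ}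
    (hl : Filter.Tendsto (fun N : ℕ => (N : ℝ) * lam N) Filter.atTop (nhds 1)) :
    Filter.Tendsto (fun N : ℕ => GSE d N (lam N) (wOf d hw)) Filter.atTop (nhds (eB d hw)) := by
  set B := ∑' k, hw k with hB
  have hB0 : 0 ≤ B := tsum_nonneg h.nn
  rw [Metric.tendsto_nhds]
  intro η hη
  set K := |eD d hw| + B + 1 with hK
  have hK0 : 0 < K := by positivity
  set t := min (1 / 2) (η / (2 * K)) with ht
  have ht0 : 0 < t := by positivity
  have ht1 : t ≤ 1 / 2 := min_le_left _ _
  have htη : t * K ≤ η / 2 := by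
    have : t ≤ η / (2 * K) := min_le_right _ _
    rw [le_div_iff₀ (by positivity)] at this
    linarith
  have key : ∀ s : ℝ, |s| = t → |eB d (fun k => (1 + s) * hw k) - eB d hw| ≤ η / 2 := by
    intro s hs
    have hs' := abs_le.1 hs.le
    have := eB_diff h (g := 1 + s) (by linarith)
    rw [add_sub_cancel_left, ← hB] at this
    have h1 : |s * eD d hw| ≤ t * |eD d hw| := by rw [abs_mul, hs]
    have h2 : B * (s ^ 2 / 2) ≤ t * B := by
      rw [← sq_abs, hs]
      have : t ^ 2 / 2 ≤ t := by nlinarith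
      nlinarith
    have h3 : t * K = t * |eD d hw| + t * B + t := by rw [hK]; ring
    have h4 := abs_le.1 this
    have h5 := abs_le.1 h1
    rw [abs_le]
    constructor <;> linarith
  have k1 := key t (abs_of_pos ht0)
  have k2 := key (-t) (by rw [abs_neg, abs_of_pos ht0])
  have l1 := Metric.tendsto_nhds.1 (A_lim_g h hev (g := 1 + t) (by linarith)) (η / 2) (by linarith)
  have l2 := Metric.tendsto_nhds.1 (A_lim_g h hev (g := 1 + -t) (by linarith)) (η / 2) (by linarith)
  filter_upwards [l1, l2, hl.eventually (gt_mem_nhds (show 1 < 1 + t by linarith)),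
    hl.eventually (lt_mem_nhds (show 1 + -t < 1 by linarith)), Filter.eventually_gt_atTop 0] with N l1 l2 g1 g2 hN
  have hN' : (0:ℝ) < N := by exact_mod_cast hN
  have hlam : 0 < lam N := by
    by_contra hc
    have := mul_nonpos_of_nonneg_of_nonpos hN'.le (not_lt.1 hc)
    linarith
  have a1 := GSE_anti (N := N) (wOf_Wok h) hlam (l1 := (1 + t) / N) (by rw [le_div_iff₀ hN']; linarith)
  have a2 := GSE_anti (N := N) (wOf_Wok h) (l2 := (1 + -t) / N) (l1 := lam N) (by apply div_pos <;> linarith)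
    (by rw [div_le_iff₀ hN']; linarith)
  rw [Real.dist_eq, abs_lt] at l1 l2 ⊢
  rw [abs_le] at k1 k2
  constructor <;> linarith

end HF

section fin
variable {d N : ℕ}

lemma HF_lim {hw : (Fin d → ℤ) → ℝ} (h : HW hw) (hev : ∀ k, hw (-k) = hw k) {lam : ℕ → ℝ}
    (hl : Filter.Tendsto (fun N : ℕ => (N : ℝ) * lam N) Filter.atTop (nhds 1)) {η : ℝ} (hη : 0 < η) :
    ∀ᶠ N : ℕ in Filter.atTop, ∀ᶠ ε in nhdsWithin (0:ℝ) (Set.Ioi 0), ∀ f : Cfg d N → ℝ,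
      NM (lam N) (wOf d hw) ε f → |VV (wOf d hw) f / N - eD d hw| ≤ η := by
  set B := ∑' k, hw k with hB
  have hB0 : 0 ≤ B := tsum_nonneg h.nn
  set t := min (1 / 2) (η / (2 * (B + 1))) with ht
  have ht0 : 0 < t := by positivity
  have ht1 : t ≤ 1 / 2 := min_le_left _ _
  have htη : B * t ≤ η / 2 := by
    have : t ≤ η / (2 * (B + 1)) := min_le_right _ _
    rw [le_div_iff₀ (by positivity)] at this
    linarith
  have htη2 : B * (t ^ 2 / 2) ≤ t * η / 4 := by nlinarith
  have d1 := eB_diff h (g := 1 + t) (by linarith)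
  have d2 := eB_diff h (g := 1 + -t) (by linarith)
  rw [add_sub_cancel_left, ← hB] at d1 d2
  rw [neg_sq] at d2
  have d1' := (abs_le.1 d1).1
  have d2' := (abs_le.1 d2).1
  have tη : 0 < t * η := by positivity
  set D := eD d hw with hD
  have F := F_lim h hev hl
  have l1 := ((A_lim_g h hev (g := 1 + t) (by linarith)).sub F).sub
    ((hl.const_sub (1 + t)).mul_const (D - η))
  have l2 := ((A_lim_g h hev (g := 1 + -t) (by linarith)).sub F).sub
    ((hl.const_sub (1 + -t)).mul_const (D + η))
  have e1 := l1.eventually (lt_mem_nhds (show t * η / 2 < _ by linarith))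
  have e2 := l2.eventually (lt_mem_nhds (show t * η / 2 < _ by linarith))
  filter_upwards [e1, e2, hl.eventually (gt_mem_nhds (show 1 < 1 + t by linarith)),
    hl.eventually (lt_mem_nhds (show 1 + -t < 1 by linarith)), Filter.eventually_gt_atTop 0] with N e1 e2 g1 g2 hN
  have hN' : (0:ℝ) < N := by exact_mod_cast hN
  filter_upwards [Ioc_mem_nhdsGT (show (0:ℝ) < t * η / 2 by linarith)] with ε hε f hf
  set v := VV (wOf d hw) f / N with hv
  have hVV : VV (wOf d hw) f = N * v := by rw [hv]; field_simp
  have a1 := GSE_le_VV (wOf_Wok h) (l1 := (1 + t) / N) (by positivity) hf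
  have a2 := GSE_le_VV (wOf_Wok h) (l1 := (1 + -t) / N) (by apply div_nonneg <;> linarith) hf
  have c1 : ((1 + t) / N - lam N) * VV (wOf d hw) f = (1 + t - N * lam N) * v := by
    rw [hVV]; field_simp
  have c2 : ((1 + -t) / N - lam N) * VV (wOf d hw) f = (1 + -t - N * lam N) * v := by
    rw [hVV]; field_simp
  rw [c1] at a1
  rw [c2] at a2
  rw [abs_le]
  constructor
  · by_contra hc
    have : (1 + t - N * lam N) * v ≤ (1 + t - N * lam N) * (D - η) :=
      mul_le_mul_of_nonneg_left (by linarith) (by linarith)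
    linarith [hε.2]
  · by_contra hc
    have : (1 + -t - N * lam N) * v ≤ (1 + -t - N * lam N) * (D + η) :=
      mul_le_mul_of_nonpos_left (by linarith) (by linarith)
    linarith [hε.2]

lemma n0_ev {w : (Fin d → ℝ) → ℝ} {B : ℝ} (hw : Wok w B) {lam : ℝ} (hl : 0 ≤ lam) {θ : ℝ} (hθ : 0 < θ) :
    ∀ᶠ ε in nhdsWithin (0:ℝ) (Set.Ioi 0), ∀ f : Cfg d N → ℝ, NM lam w ε f →
      |qq lam w (fun x => ∑ k, Pop k f x) f - GSE d N lam w * (N - M1 f)| ≤ θ := by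
  obtain ⟨C, hC⟩ := n0_trial_bound (N := N) hw hl
  have h1 : Filter.Tendsto (fun ε : ℝ => √(ε * C)) (nhdsWithin (0:ℝ) (Set.Ioi 0)) (nhds (√(0 * C))) :=
    ((Real.continuous_sqrt.comp (continuous_mul_const C)).tendsto 0).mono_left nhdsWithin_le_nhds
  rw [zero_mul, Real.sqrt_zero] at h1
  filter_upwards [h1.eventually (gt_mem_nhds hθ), Ioc_mem_nhdsGT one_pos] with ε h1 h2 f hf
  exact (hC ε h2.1 h2.2 f hf).trans h1.le

lemma small_lim {lam : ℕ → ℝ} (hl : Filter.Tendsto (fun N : ℕ => (N : ℝ) * lam N) Filter.atTop (nhds 1))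
    (K : ℝ) {η : ℝ} (hη : 0 < η) : ∀ᶠ N : ℕ in Filter.atTop, lam N * √(N:ℝ) * K ≤ η := by
  have h1 : Filter.Tendsto (fun N : ℕ => (N * lam N) / √(N:ℝ) * K) Filter.atTop (nhds (0 * K)) :=
    (hl.div_atTop (Real.tendsto_sqrt_atTop.comp tendsto_natCast_atTop_atTop)).mul_const K
  rw [zero_mul] at h1
  filter_upwards [h1.eventually (gt_mem_nhds hη), Filter.eventually_gt_atTop 0] with N h2 hN
  have hN' : (0:ℝ) < N := by exact_mod_cast hN
  have : lam N * √(N:ℝ) = (N * lam N) / √(N:ℝ) := by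
    rw [eq_div_iff (Real.sqrt_pos.2 hN').ne', mul_assoc, Real.mul_self_sqrt hN'.le, mul_comm]
  rw [this]
  exact h2.le

lemma DD_lim {hw : (Fin d → ℤ) → ℝ} (h : HW hw) (hev : ∀ k, hw (-k) = hw k) {lam : ℕ → ℝ}
    (hl : Filter.Tendsto (fun N : ℕ => (N : ℝ) * lam N) Filter.atTop (nhds 1)) {η : ℝ} (hη : 0 < η) :
    ∀ᶠ N : ℕ in Filter.atTop, ∀ᶠ ε in nhdsWithin (0:ℝ) (Set.Ioi 0), ∀ f : Cfg d N → ℝ,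
      NM (lam N) (wOf d hw) ε f → |lam N * DD (wOf d hw) f - eD d hw| ≤ η ∧
        M1 f ≤ (∑' k, hw k) + 1 := by
  have hW := wOf_Wok h
  set w := wOf d hw with hwd
  set B := ∑' k, hw k with hB
  have hB0 : 0 ≤ B := tsum_nonneg h.nn
  set m := B + 1 with hm
  have hm0 : 0 ≤ m := by positivity
  set m2 := 2 + B * (1 + 2 * m) with hm2
  set D := eD d hw with hD
  have g1 : Filter.Tendsto (fun N : ℕ => |N * lam N - 1| * |D|) Filter.atTop (nhds (|1 - 1| * |D|)) :=
    (hl.sub_const 1).abs.mul_const _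
  rw [sub_self, abs_zero, zero_mul] at g1
  filter_upwards [HF_lim h hev hl (show 0 < η / 6 by positivity), small_lim hl (B * (√m * √m2)) (show 0 < η / 3 by positivity),
    g1.eventually (gt_mem_nhds (show 0 < η / 3 by positivity)), hl.eventually (gt_mem_nhds one_lt_two),
    hl.eventually (lt_mem_nhds one_pos), Filter.eventually_gt_atTop 0] with N e1 e2 e3 g2 g3 hN
  have hN' : (0:ℝ) < N := by exact_mod_cast hN
  have hlam : 0 < lam N := pos_of_mul_pos_right g3 hN'.le
  filter_upwards [e1, n0_ev (N := N) hW hlam.le one_pos, Ioc_mem_nhdsGT one_pos,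
    Ioc_mem_nhdsGT (show (0:ℝ) < 1 / N by positivity)] with ε e1 e4 e5 e6 f hf
  have hT := hf.TT_le hW hlam.le
  have hc := hf.sm.toPer.cont
  have hlB : lam N * (N * B / 2) ≤ B := by nlinarith
  have hM1 : M1 f ≤ m := (M1_le_TT hf.sm.toPer).trans (by linarith [e5.2])
  refine ⟨?_, hM1⟩
  have hM2 : M2 f ≤ m2 := by
    refine (M2_bound hW hlam.le hf (e4 f hf)).trans ?_
    have a1 : N * ε ≤ 1 := by
      have := e6.2
      rw [le_div_iff₀ hN'] at this
      linarith
    have a2 := M1_nonneg f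
    have a3 : lam N * (N * B / 2) * (1 + 2 * M1 f) ≤ B * (1 + 2 * m) :=
      mul_le_mul hlB (by linarith) (by linarith) hB0
    linarith
  have h1 := DD_VV hW hc
  have h2 : √(N * M1 f) * √(M2 f) ≤ √N * (√m * √m2) := by
    rw [Real.sqrt_mul hN'.le, mul_assoc]
    exact mul_le_mul_of_nonneg_left (mul_le_mul (Real.sqrt_le_sqrt hM1) (Real.sqrt_le_sqrt hM2)
      (Real.sqrt_nonneg _) (Real.sqrt_nonneg _)) (Real.sqrt_nonneg _)
  have h3 : lam N * |DD w f - VV w f| ≤ η / 3 := by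
    refine le_trans (mul_le_mul_of_nonneg_left (h1.trans (mul_le_mul_of_nonneg_left h2 hB0)) hlam.le) ?_
    refine le_trans (le_of_eq ?_) e2
    ring
  have h4 : lam N * |DD w f - VV w f| = |lam N * DD w f - lam N * VV w f| := by
    rw [← mul_sub, abs_mul, abs_of_pos hlam]
  rw [h4] at h3
  have h5 : lam N * VV w f - D = (N * lam N) * (VV w f / N - D) + (N * lam N - 1) * D := by
    field_simp; ring
  have h6 : |lam N * VV w f - D| ≤ 2 * (η / 6) + η / 3 := by
    rw [h5]
    refine (abs_add_le _ _).trans ?_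
    rw [abs_mul (N * lam N), abs_mul (N * lam N - 1), abs_of_pos g3]
    refine add_le_add (mul_le_mul g2.le (e1 f hf) (abs_nonneg _) zero_le_two) e3.le
  have h7 := abs_sub_le (lam N * DD w f) (lam N * VV w f) D
  linarith

lemma ratio_lower {Δ N a m y : ℝ} (h : y ≤ Δ * (N - a)) (ha : 0 ≤ a) (ham : a ≤ m) (hN : 2 * m < N) (hN0 : 0 < N) :
    y - |y| * (2 * m) / N ≤ N * Δ := by
  have h1 : 0 < N - a := by linarith
  refine le_of_mul_le_mul_right ?_ h1
  have h2 : N * y ≤ N * Δ * (N - a) := by nlinarith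
  refine le_trans ?_ h2
  have h3 : (y - |y| * (2 * m) / N) * (N - a) = N * y - a * y - |y| * (2 * m) + |y| * m * (2 * a / N) := by
    field_simp; ring
  rw [h3]
  have h4 : 2 * a / N ≤ 1 := by rw [div_le_one hN0]; linarith
  have h5 : |y| * m * (2 * a / N) ≤ |y| * m := mul_le_of_le_one_right (mul_nonneg (abs_nonneg _) (by linarith)) h4
  have h6 : -(a * y) ≤ a * |y| := by
    have := mul_le_mul_of_nonneg_left (neg_le_abs y) ha
    linarith
  have h7 : a * |y| ≤ m * |y| := mul_le_mul_of_nonneg_right ham (abs_nonneg _)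
  linarith

lemma main0 {hw : (Fin d → ℤ) → ℝ} (h : HW hw) (hev : ∀ k, hw (-k) = hw k) {lam : ℕ → ℝ}
    (hl : Filter.Tendsto (fun N : ℕ => (N : ℝ) * lam N) Filter.atTop (nhds 1)) :
    Filter.Tendsto (fun n : ℕ => ((n + 1 : ℕ) : ℝ) *
      (GSE d (n + 1) (lam (n + 1)) (wOf d hw) - GSE d n (lam (n + 1)) (wOf d hw))) Filter.atTop
      (nhds (eD d hw)) := by
  have hW := wOf_Wok h
  set w := wOf d hw with hwd
  set B := ∑' k, hw k with hB
  have hB0 : 0 ≤ B := tsum_nonneg h.nn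
  set m := B + 1 with hm
  have hm0 : 0 < m := by positivity
  set D := eD d hw with hD
  have hl1 : Filter.Tendsto (fun n : ℕ => ((n + 1 : ℕ) : ℝ) * lam (n + 1)) Filter.atTop (nhds 1) :=
    hl.comp (Filter.tendsto_add_atTop_nat 1)
  have hl2 : Filter.Tendsto (fun n : ℕ => (n : ℝ) * lam (n + 1)) Filter.atTop (nhds 1) := by
    have h1 : Filter.Tendsto (fun n : ℕ => (n : ℝ) / ((n : ℝ) + 1)) Filter.atTop (nhds 1) :=
      tendsto_natCast_div_add_atTop (1:ℝ)
    have h2 := h1.mul hl1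
    rw [one_mul] at h2
    refine h2.congr fun n => ?_
    push_cast
    field_simp
  rw [Metric.tendsto_nhds]
  intro η hη
  set θ := η / 8 with hθ
  have hθ0 : 0 < θ := by positivity
  have r1 : Filter.Tendsto (fun n : ℕ => (|D| + η) * (2 * m) / ((n + 1 : ℕ) : ℝ)) Filter.atTop (nhds 0) :=
    Filter.Tendsto.div_atTop tendsto_const_nhds
      (tendsto_natCast_atTop_atTop.comp (Filter.tendsto_add_atTop_nat 1))
  have r2 : Filter.Tendsto (fun n : ℕ => ((n + 1 : ℕ) : ℝ)) Filter.atTop Filter.atTop :=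
    tendsto_natCast_atTop_atTop.comp (Filter.tendsto_add_atTop_nat 1)
  have q1 := (Filter.tendsto_add_atTop_nat 1).eventually (DD_lim h hev hl hθ0)
  have q2 := DD_lim h hev hl2 hθ0
  filter_upwards [q1, q2, small_lim hl2 (B * √m) hθ0, r1.eventually (gt_mem_nhds hθ0),
    r2.eventually (Filter.eventually_gt_atTop (2 * m)), hl1.eventually (lt_mem_nhds one_pos)] with n q1 q2 s1 s2 s3 s4
  have hN0 : (0:ℝ) < ((n + 1 : ℕ) : ℝ) := by positivity
  have hlam : 0 < lam (n + 1) := pos_of_mul_pos_right s4 hN0.le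
  set Δ := GSE d (n + 1) (lam (n + 1)) w - GSE d n (lam (n + 1)) w with hΔ
  -- lower bound
  have low : D - 2 * θ - θ ≤ ((n + 1 : ℕ) : ℝ) * Δ := by
    obtain ⟨ε, ⟨q1, q3⟩, hε⟩ := ((q1.and (n0_ev (N := n + 1) hW hlam.le hθ0)).and (Ioc_mem_nhdsGT one_pos)).exists
    obtain ⟨f, hfs, hf1, hfe⟩ := exists_min (N := n + 1) hW hlam.le hε.1
    have hf : NM (lam (n + 1)) w ε f := ⟨hfs, hf1, hfe⟩
    obtain ⟨a1, a2⟩ := q1 f hf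
    have a3 := lower_trial hW hlam.le hf (q3 f hf)
    have a4 := ratio_lower (y := D - 2 * θ) (Δ := Δ) (N := ((n + 1 : ℕ) : ℝ)) (a := M1 f) (m := m)
      (le_trans (by linarith [(abs_le.1 a1).1]) a3) (M1_nonneg f) a2 s3 hN0
    have a5 : |D - 2 * θ| ≤ |D| + η := by
      refine (abs_sub _ _).trans ?_
      rw [abs_of_pos (by positivity : 0 < 2 * θ)]
      linarith
    have a6 : |D - 2 * θ| * (2 * m) / ((n + 1 : ℕ) : ℝ) ≤ (|D| + η) * (2 * m) / ((n + 1 : ℕ) : ℝ) := by gcongr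
    linarith
  have up : ((n + 1 : ℕ) : ℝ) * Δ ≤ D + 4 * θ + θ := by
    obtain ⟨ε, ⟨q1, q3⟩, hε⟩ := ((q2.and (n0_ev (N := n) hW hlam.le hθ0)).and (Ioc_mem_nhdsGT hθ0)).exists
    obtain ⟨f, hfs, hf1, hfe⟩ := exists_min (N := n) hW hlam.le hε.1
    have hf : NM (lam (n + 1)) w ε f := ⟨hfs, hf1, hfe⟩
    obtain ⟨a1, a2⟩ := q1 f hf
    have a3 := upper_trial hW hlam.le hf (q3 f hf)
    have a7 : lam (n + 1) * (B * √(n * M1 f)) ≤ θ := by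
      refine le_trans ?_ s1
      rw [Real.sqrt_mul (Nat.cast_nonneg n)]
      have := mul_le_mul_of_nonneg_left (Real.sqrt_le_sqrt a2)
        (by positivity : 0 ≤ lam (n + 1) * √(n:ℝ) * B)
      linarith
    have a8 : Δ * (((n + 1 : ℕ) : ℝ) - M1 f) ≤ D + 4 * θ := by
      push_cast
      linarith [(abs_le.1 a1).2, hε.2]
    have a4 := ratio_lower (y := -(D + 4 * θ)) (Δ := -Δ) (N := ((n + 1 : ℕ) : ℝ)) (a := M1 f) (m := m)
      (by rw [neg_mul]; linarith) (M1_nonneg f) a2 s3 hN0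
    have a5 : |-(D + 4 * θ)| ≤ |D| + η := by
      rw [abs_neg]
      refine (abs_add_le _ _).trans ?_
      rw [abs_of_pos (by positivity : 0 < 4 * θ)]
      linarith
    have a6 : |-(D + 4 * θ)| * (2 * m) / ((n + 1 : ℕ) : ℝ) ≤ (|D| + η) * (2 * m) / ((n + 1 : ℕ) : ℝ) := by gcongr
    linarith
  rw [Real.dist_eq, abs_lt]
  constructor <;> linarith

end fin

section reduction
variable {d N : ℕ}

/-- zero mode removed -/
def hz (hw : (Fin d → ℤ) → ℝ) (k : Fin d → ℤ) : ℝ := if k = 0 then 0 else hw k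

lemma HW_hz {hw : (Fin d → ℤ) → ℝ} (h0 : ∀ k, 0 ≤ hw k) (hs : Summable hw) : HW (hz hw) where
  nn k := by unfold hz; split_ifs; exacts [le_rfl, h0 k]
  sm := Summable.of_nonneg_of_le (fun k => by unfold hz; split_ifs; exacts [le_rfl, h0 k])
    (fun k => by unfold hz; split_ifs; exacts [h0 k, le_rfl]) hs
  zero := by simp [hz]

lemma wOf_hz {hw : (Fin d → ℤ) → ℝ} (h0 : ∀ k, 0 ≤ hw k) (hs : Summable hw) (y : Fin d → ℝ) :
    wOf d hw y = wOf d (hz hw) y + hw 0 := by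
  rw [wOf_eq hs h0, wOf_eq (HW_hz h0 hs).sm (HW_hz h0 hs).nn,
    (hwcw_summable hs h0 y).tsum_eq_add_tsum_ite 0, add_comm]
  congr 1
  · refine tsum_congr fun k => ?_
    unfold hz
    split_ifs <;> simp
  · simp [cw, th]

lemma count_pairs (a : ℝ) :
    (∑ j : Fin N, ∑ k : Fin N, if j < k then a else 0) = a * (N * (N - 1) / 2) := by
  have h := Wf_eq (N := N) (d := 0) (w := fun _ => a) (fun _ => rfl) 0
  rw [h]
  unfold Wf pw
  have : ∀ j : Fin N, (∑ k : Fin N, if j = k then (0:ℝ) else a) = (N - 1) * a := by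
    intro j
    have e : ∀ k : Fin N, (if j = k then (0:ℝ) else a) = a - if j = k then a else 0 := by
      intro k; split_ifs <;> simp
    rw [Finset.sum_congr rfl fun k _ => e k, Finset.sum_sub_distrib]
    simp
    ring
  rw [Finset.sum_congr rfl fun j _ => this j]
  simp
  ring

lemma energy_shift {w w' : (Fin d → ℝ) → ℝ} {a : ℝ} (hw' : Continuous w') (h : ∀ y, w y = w' y + a) (lam : ℝ)
    {Ψ : (Fin N → Fin d → ℝ) → ℂ} (hΨ : IsAdmissible d N Ψ) :
    energy d N lam w Ψ = energy d N lam w' Ψ + lam * (a * (N * (N - 1) / 2)) := by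
  obtain ⟨hs, -, -, h1⟩ := hΨ
  have cΨ := hs.continuous
  have cd : ∀ v, Continuous fun x => fderiv ℝ Ψ x v := fun v =>
    (hs.continuous_fderiv (by simp)).clm_apply continuous_const
  have hcube : IsCompact (cube d N) := isCompact_univ_pi fun _ => isCompact_univ_pi fun _ => isCompact_Icc
  unfold energy
  have e : ∀ x : Fin N → Fin d → ℝ,
      ((∑ j : Fin N, ∑ i : Fin d, ‖fderiv ℝ Ψ x (Pi.single j (Pi.single i 1))‖ ^ 2) +
      lam * (∑ j : Fin N, ∑ k : Fin N, if j < k then w (x j - x k) else 0) * ‖Ψ x‖ ^ 2) =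
      ((∑ j : Fin N, ∑ i : Fin d, ‖fderiv ℝ Ψ x (Pi.single j (Pi.single i 1))‖ ^ 2) +
      lam * (∑ j : Fin N, ∑ k : Fin N, if j < k then w' (x j - x k) else 0) * ‖Ψ x‖ ^ 2) +
      (lam * (a * (N * (N - 1) / 2))) * ‖Ψ x‖ ^ 2 := by
    intro x
    rw [← count_pairs]
    have : (∑ j : Fin N, ∑ k : Fin N, if j < k then w (x j - x k) else 0) =
        (∑ j : Fin N, ∑ k : Fin N, if j < k then w' (x j - x k) else 0) +
        ∑ j : Fin N, ∑ k : Fin N, if j < k then a else 0 := by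
      rw [← Finset.sum_add_distrib]
      refine Finset.sum_congr rfl fun j _ => ?_
      rw [← Finset.sum_add_distrib]
      refine Finset.sum_congr rfl fun k _ => ?_
      split_ifs
      · exact h _
      · simp
    rw [this]; ring
  rw [integral_congr_ae (Filter.Eventually.of_forall e), integral_add, integral_const_mul, h1, mul_one]
  · refine ContinuousOn.integrableOn_compact hcube (Continuous.continuousOn ?_)
    have c2 : Continuous fun x : Fin N → Fin d → ℝ =>
        ∑ j : Fin N, ∑ k : Fin N, if j < k then w' (x j - x k) else 0 := by
      refine continuous_finset_sum _ fun j _ => continuous_finset_sum _ fun k _ => ?_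
      split_ifs <;> fun_prop
    have c3 : Continuous fun x : Fin N → Fin d → ℝ =>
        ∑ j : Fin N, ∑ i : Fin d, ‖fderiv ℝ Ψ x (Pi.single j (Pi.single i 1))‖ ^ 2 :=
      continuous_finset_sum _ fun j _ => continuous_finset_sum _ fun k _ => (cd _).norm.pow 2
    exact c3.add ((c2.const_mul lam).mul (cΨ.norm.pow 2))
  · refine ContinuousOn.integrableOn_compact hcube (Continuous.continuousOn ?_)
    exact (cΨ.norm.pow 2).const_mul _

lemma GSE_shift {w w' : (Fin d → ℝ) → ℝ} {a B : ℝ} (hw' : Wok w' B) (h : ∀ y, w y = w' y + a) {lam : ℝ}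
    (hl : 0 ≤ lam) : GSE d N lam w = GSE d N lam w' + lam * (a * (N * (N - 1) / 2)) := by
  have hb := GSE_bdd (N := N) hw' hl
  have hn := GSE_nonempty (N := N) w' lam
  have := (OrderIso.addRight (lam * (a * (N * (N - 1) / 2)))).map_csInf' hn hb
  unfold GSE
  rw [OrderIso.addRight_apply] at this
  rw [this]
  congr 1
  ext e
  constructor
  · rintro ⟨Ψ, hΨ, rfl⟩
    exact ⟨_, ⟨Ψ, hΨ, rfl⟩, (energy_shift hw'.cont h lam hΨ).symm⟩
  · rintro ⟨_, ⟨Ψ, hΨ, rfl⟩, rfl⟩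
    exact ⟨Ψ, hΨ, energy_shift hw'.cont h lam hΨ⟩

end reduction

/-- **Binding energy (Theorem 1.1).** If `N·λ_N → 1`, then
`N (E(λ_N,N) - E(λ_N,N-1) - λ_N (N-1) ŵ(0))` converges to
`e_B - ∑_{p≠0} |p|² α_p² / (1 - α_p²)`. -/
theorem binding_energy_expansion (d : ℕ) (hd : 1 ≤ d)
    (hw : (Fin d → ℤ) → ℝ) (hw_nonneg : ∀ k, 0 ≤ hw k)
    (hw_even : ∀ k, hw (-k) = hw k) (hw_summable : Summable hw)
    (lam : ℕ → ℝ) (hlam_pos : ∀ N, 2 ≤ N → 0 < lam N)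
    (hlam_lim : Filter.Tendsto (fun N : ℕ => (N : ℝ) * lam N) Filter.atTop (nhds 1)) :
    Filter.Tendsto
      (fun N : ℕ => (N : ℝ) *
        (GSE d N (lam N) (wOf d hw) - GSE d (N - 1) (lam N) (wOf d hw) -
          lam N * ((N : ℝ) - 1) * hw 0))
      Filter.atTop
      (nhds (eB d hw -
        ∑' k : {k : Fin d → ℤ // k ≠ 0},
          pSq d k.1 * alphaP d hw k.1 ^ 2 / (1 - alphaP d hw k.1 ^ 2))) := by
  have hH := HW_hz hw_nonneg hw_summable
  have hev : ∀ k, hz hw (-k) = hz hw k := fun k => by simp [hz, hw_even]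
  have hzk : ∀ k : {k : Fin d → ℤ // k ≠ 0}, hz hw k.1 = hw k.1 := fun k => by simp [hz, k.2]
  have e1 : eB d hw = eB d (hz hw) := by
    unfold eB ePk
    simp only [hzk]
  have e2 : ∑' k : {k : Fin d → ℤ // k ≠ 0},
      pSq d k.1 * alphaP d hw k.1 ^ 2 / (1 - alphaP d hw k.1 ^ 2) =
      ∑' k : {k : Fin d → ℤ // k ≠ 0},
      pSq d k.1 * alphaP d (hz hw) k.1 ^ 2 / (1 - alphaP d (hz hw) k.1 ^ 2) := by
    unfold alphaP ePk
    simp only [hzk]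
  rw [e1, e2, ← eD_eq hH, ← Filter.tendsto_add_atTop_iff_nat 1]
  refine (main0 hH hev hlam_lim).congr' ?_
  filter_upwards [Filter.eventually_ge_atTop 1] with n hn
  have hl := (hlam_pos (n + 1) (by omega)).le
  have hs := wOf_hz hw_nonneg hw_summable
  rw [Nat.add_sub_cancel, GSE_shift (N := n + 1) (wOf_Wok hH) hs hl, GSE_shift (N := n) (wOf_Wok hH) hs hl]
  push_cast
  ring
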